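/- Let φ and φ₀ be psh functions on the unit polydisc Δⁿ ⊆ ℂⁿ and let f₀ be a tuple of holomorphic functions on Δⁿ. Assume that |f₀|²e^{-2(φ+φ₀)} is not integrable near the origin o, while |f₀|²e^{-2φ₀} is integrable near o. Then for every neighborhood U ⊂⊂ Δⁿ of o, limsup_{t→+∞} [ -log ∫_{{φ<-t}∩U} |f₀|²e^{-2φ₀} ] / (2t) ≤ 1. -/

import Mathlib

open MeasureTheory Filter Topology
open scoped ENNReal NNReal

noncomputable section

/-- `ℂⁿ`. -/
abbrev Cn (n : ℕ) : Type := Fin n → ℂ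

variable {n : ℕ}

/-- The exponential function `EReal → ℝ≥0∞`, with `exp ⊥ = 0` and `exp ⊤ = ⊤`. -/
def expE (x : EReal) : ℝ≥0∞ :=
  if x = ⊥ then 0 else if x = ⊤ then ⊤ else ENNReal.ofReal (Real.exp x.toReal)

/-- The logarithm `ℝ → EReal`, with value `⊥` for `x ≤ 0`. -/
def elog (x : ℝ) : EReal := if x ≤ 0 then (⊥ : EReal) else ((Real.log x : ℝ) : EReal)

/-- The density `e^{c·φ} : ℂⁿ → [0,∞]` associated to an extended-real-valued `φ`. -/
def wexp (c : ℝ) (φ : Cn n → EReal) (z : Cn n) : ℝ≥0∞ := expE ((c : EReal) * φ z)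

/-- `|f₀|² = ∑ⱼ |f₀ⱼ|²` as a `[0,∞]`-valued density, for a tuple `f₀` of functions. -/
def normSq2 {m : ℕ} (f₀ : Fin m → Cn n → ℂ) (z : Cn n) : ℝ≥0∞ :=
  ∑ j, (‖f₀ j z‖₊ : ℝ≥0∞) ^ 2

/-- `log |f₀| = (1/2) log ∑ⱼ |f₀ⱼ|²` for a tuple `f₀`. -/
def logAbsT {m : ℕ} (f₀ : Fin m → Cn n → ℂ) (z : Cn n) : EReal :=
  elog (Real.sqrt (∑ j, ‖f₀ j z‖ ^ 2))

/-- The weight `|f₀|² e^{-2φ₀}`. -/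
def dens0 {m : ℕ} (f₀ : Fin m → Cn n → ℂ) (φ₀ : Cn n → EReal) (z : Cn n) : ℝ≥0∞ :=
  normSq2 f₀ z * wexp (-2) φ₀ z

/-- A nonnegative function is (Lebesgue-)integrable near the origin. -/
def IntNear (g : Cn n → ℝ≥0∞) : Prop := ∃ U ∈ 𝓝 (0 : Cn n), (∫⁻ z in U, g z) < ⊤

/-- `ψ ≤ φ + O(1)` near the origin. -/
def leO (ψ φ : Cn n → EReal) : Prop := ∃ C : ℝ, ∀ᶠ z in 𝓝 (0 : Cn n), ψ z ≤ φ z + (C : EReal)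

/-- `ψ = φ + O(1)` near the origin. -/
def eqO (ψ φ : Cn n → EReal) : Prop := leO ψ φ ∧ leO φ ψ

/-- The truncated average of `u` over the circle `θ ↦ z + r e^{iθ} w`, truncated below at `-m`. -/
def circleAvg (u : Cn n → EReal) (z w : Cn n) (r : ℝ) (m : ℕ) : ℝ :=
  (2 * Real.pi)⁻¹ * ∫ θ in (0:ℝ)..(2 * Real.pi),
    (max (u (z + ((r : ℂ) * Complex.exp (Complex.I * (θ : ℂ))) • w)) ((-(m : ℝ) : ℝ) : EReal)).toReal

/-- `u` is plurisubharmonic on `Ω`: it is upper semicontinuous on `Ω`, takes values in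
`[-∞, ∞)`, is not identically `-∞` on any connected component of `Ω`, and satisfies the
sub-mean value inequality on all small circles inside complex lines. -/
structure PSHOn (u : Cn n → EReal) (Ω : Set (Cn n)) : Prop where
  usc : UpperSemicontinuousOn u Ω
  lt_top : ∀ z ∈ Ω, u z < ⊤
  not_botOnComponents : ∀ z ∈ Ω, ∃ w ∈ connectedComponentIn Ω z, u w ≠ ⊥
  submean : ∀ z ∈ Ω, ∀ w : Cn n, ∃ ε > 0, ∀ r : ℝ, 0 < r → r < ε →
    u z ≤ ⨅ m : ℕ, ((circleAvg u z w r m : ℝ) : EReal)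

/-- `u` is plurisubharmonic near the origin. -/
def PSHNear (u : Cn n → EReal) : Prop := ∃ U ∈ 𝓝 (0 : Cn n), IsOpen U ∧ PSHOn u U

/-- `f` is holomorphic near the origin. -/
def HoloNear (f : Cn n → ℂ) : Prop := ∃ U ∈ 𝓝 (0 : Cn n), IsOpen U ∧ DifferentiableOn ℂ f U

/-- `Φ` is a (local) Zhou weight near the origin related to a general nonnegative
weight `W`. -/
structure IsZhouWeightFor (W : Cn n → ℝ≥0∞) (Φ : Cn n → EReal) : Prop where
  psh : PSHNear Φ
  intN : ∃ N₁ : ℕ, ∀ N₀ : ℕ, N₁ ≤ N₀ →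
    IntNear fun z => W z * ENNReal.ofReal (‖z‖ ^ (2 * N₀)) * wexp (-2) Φ z
  nonint : ¬ IntNear fun z => W z * wexp (-2) Φ z
  maximal : ∀ φ' : Cn n → EReal, PSHNear φ' → leO Φ φ' →
    (¬ IntNear fun z => W z * wexp (-2) φ' z) → eqO φ' Φ

/-- `Φ` is a local Zhou weight related to `|f₀|² e^{-2φ₀}` near the origin (including the
standing assumptions that `f₀` is a tuple of holomorphic functions near `o`, `φ₀` is
plurisubharmonic near `o`, and `|f₀|² e^{-2φ₀}` is integrable near `o`). -/
structure IsLocalZhouWeight {m : ℕ} (f₀ : Fin m → Cn n → ℂ) (φ₀ : Cn n → EReal)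
    (Φ : Cn n → EReal) : Prop where
  holo : ∀ j, HoloNear (f₀ j)
  psh₀ : PSHNear φ₀
  int₀ : IntNear (dens0 f₀ φ₀)
  zhou : IsZhouWeightFor (dens0 f₀ φ₀) Φ

/-- The Zhou number (relative type) `σ(ψ, Φ) = sup { b ≥ 0 : ψ ≤ bΦ + O(1) near o }`. -/
def zhouNumber (ψ Φ : Cn n → EReal) : ℝ :=
  sSup {b : ℝ | 0 ≤ b ∧ leO ψ fun z => (b : EReal) * Φ z}

/-- `log ‖f‖ : ℂⁿ → EReal`. -/
def logAbs (f : Cn n → ℂ) (z : Cn n) : EReal := elog ‖f z‖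

/-- `ν(f, Φ) = σ(log|f|, Φ)`. -/
def nuNumber (f : Cn n → ℂ) (Φ : Cn n → EReal) : ℝ := zhouNumber (logAbs f) Φ

/-- The jumping number `c_o^G(Φ) = sup { c ≥ 0 : |G|² e^{-2cΦ} integrable near o }`. -/
def jumping (G : Cn n → ℂ) (Φ : Cn n → EReal) : ℝ :=
  sSup {c : ℝ | 0 ≤ c ∧ IntNear fun z => (‖G z‖₊ : ℝ≥0∞) ^ 2 * wexp (-2 * c) Φ z}

/-- The inclusion `ℐ(φ)ₒ ⊆ ℐ(ψ)ₒ` of multiplier ideals at the origin. -/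
def mIdealLE (φ ψ : Cn n → EReal) : Prop :=
  ∀ f : Cn n → ℂ, HoloNear f →
    (IntNear fun z => (‖f z‖₊ : ℝ≥0∞) ^ 2 * wexp (-2) φ z) →
    IntNear fun z => (‖f z‖₊ : ℝ≥0∞) ^ 2 * wexp (-2) ψ z

/-- The Tian function `Tn(t; f, v, φ₀) = sup { c ≥ 0 : |f|^{2t} e^{-2cv - 2φ₀} integrable near o }`. -/
def tian (t : ℝ) (f : Cn n → ℂ) (v φ₀ : Cn n → EReal) : ℝ :=
  sSup {c : ℝ | 0 ≤ c ∧
    IntNear fun z => ENNReal.ofReal (‖f z‖ ^ (2 * t)) * wexp (-2 * c) v z * wexp (-2) φ₀ z}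

/-- The unit polydisc `Δⁿ ⊆ ℂⁿ`. -/
def polydisc (n : ℕ) : Set (Cn n) := {z | ∀ j, ‖z j‖ < 1}

open scoped ContDiff Convolution

/-! ### Rotation invariant mollifiers -/

/-- The square of the Euclidean norm on `ℂⁿ`. -/
def euclSq (z : Cn n) : ℝ := ∑ j, ‖z j‖ ^ 2

lemma contDiff_euclSq : ContDiff ℝ ∞ (euclSq : Cn n → ℝ) := by
  unfold euclSq
  refine ContDiff.sum fun j _ => ?_
  exact (contDiff_norm_sq ℝ).comp (contDiff_apply ℝ ℂ j)

lemma euclSq_nonneg (z : Cn n) : 0 ≤ euclSq z :=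
  Finset.sum_nonneg fun _ _ => by positivity

lemma norm_sq_le_euclSq (z : Cn n) : ‖z‖ ^ 2 ≤ euclSq z := by
  have h : ‖z‖ ≤ Real.sqrt (euclSq z) := by
    refine (pi_norm_le_iff_of_nonneg (Real.sqrt_nonneg _)).2 fun j => ?_
    refine Real.le_sqrt_of_sq_le ?_
    exact Finset.single_le_sum (f := fun j => ‖z j‖ ^ 2) (fun _ _ => by positivity)
      (Finset.mem_univ j)
  calc ‖z‖ ^ 2 ≤ Real.sqrt (euclSq z) ^ 2 := by gcongr
    _ = euclSq z := Real.sq_sqrt (euclSq_nonneg z)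

lemma euclSq_le_norm_sq (z : Cn n) : euclSq z ≤ n * ‖z‖ ^ 2 := by
  calc euclSq z ≤ ∑ _j : Fin n, ‖z‖ ^ 2 := by
        unfold euclSq
        gcongr with j
        exact norm_le_pi_norm z j
    _ = n * ‖z‖ ^ 2 := by simp

lemma euclSq_smul (c : ℂ) (z : Cn n) : euclSq (c • z) = ‖c‖ ^ 2 * euclSq z := by
  simp [euclSq, mul_pow, Finset.mul_sum]

/-- `ρ` is a smooth probability density supported in the closed polydisc of radius `δ` and
invariant under multiplication by unit complex numbers. -/
structure IsMollifier (ρ : Cn n → ℝ) (δ : ℝ) : Prop where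
  smooth : ContDiff ℝ ∞ ρ
  nonneg : ∀ w, 0 ≤ ρ w
  supp : ∀ w, ρ w ≠ 0 → ‖w‖ ≤ δ
  integral_eq : ∫ w, ρ w = 1
  rot : ∀ c : ℂ, ‖c‖ = 1 → ∀ w, ρ (c • w) = ρ w

namespace IsMollifier

variable {ρ : Cn n → ℝ} {δ : ℝ}

lemma hasCompactSupport (h : IsMollifier ρ δ) : HasCompactSupport ρ := by
  refine HasCompactSupport.intro (isCompact_closedBall (0 : Cn n) δ) fun w hw => ?_
  by_contra h0
  exact hw (by simpa using h.supp w h0)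

lemma continuous (h : IsMollifier ρ δ) : Continuous ρ := h.smooth.continuous

lemma integrable (h : IsMollifier ρ δ) : Integrable ρ :=
  h.continuous.integrable_of_hasCompactSupport h.hasCompactSupport

lemma neg (h : IsMollifier ρ δ) (w : Cn n) : ρ (-w) = ρ w := by
  simpa using h.rot (-1) (by simp) w

end IsMollifier

lemma exists_isMollifier (n : ℕ) {δ : ℝ} (hδ : 0 < δ) : ∃ ρ : Cn n → ℝ, IsMollifier ρ δ := by
  set b : Cn n → ℝ := fun w => Real.smoothTransition (1 - euclSq w / δ ^ 2) with hb
  have hbs : ContDiff ℝ ∞ b := by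
    refine Real.smoothTransition.contDiff.comp ?_
    exact contDiff_const.sub (contDiff_euclSq.div_const _)
  have hb0 : ∀ w, 0 ≤ b w := fun w => Real.smoothTransition.nonneg _
  have hsupp : ∀ w, b w ≠ 0 → ‖w‖ ≤ δ := by
    intro w hw
    by_contra hlt
    push Not at hlt
    refine hw (Real.smoothTransition.zero_of_nonpos ?_)
    have : δ ^ 2 ≤ euclSq w := le_trans (by gcongr) (norm_sq_le_euclSq w)
    rw [sub_nonpos, one_le_div (by positivity)]
    exact this
  have hcs : HasCompactSupport b := by
    refine HasCompactSupport.intro (isCompact_closedBall (0 : Cn n) δ) fun w hw => ?_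
    by_contra h0
    exact hw (by simpa using hsupp w h0)
  have hpos : 0 < ∫ w, b w := by
    refine hbs.continuous.integral_pos_of_hasCompactSupport_nonneg_nonzero hcs hb0 (x := 0) ?_
    have : (0 : ℝ) < b 0 := by
      refine Real.smoothTransition.pos_of_pos ?_
      simp [euclSq]
    exact this.ne'
  refine ⟨fun w => b w / ∫ w, b w, hbs.div_const _, fun w => div_nonneg (hb0 w) hpos.le, ?_, ?_, ?_⟩
  · intro w hw
    exact hsupp w fun h => hw (by simp [h])
  · rw [integral_div, div_self hpos.ne']
  · intro c hc w
    simp [hb, euclSq_smul, hc]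

lemma measurePreserving_smul {c : ℂ} (hc : ‖c‖ = 1) :
    MeasurePreserving (fun w : Cn n => c • w) volume volume := by
  have h1 : MeasurePreserving (fun x : ℂ => c * x) volume volume := by
    have h := (rotation ⟨c, mem_sphere_zero_iff_norm.2 hc⟩).measurePreserving
    exact h
  exact volume_preserving_pi (fun _ : Fin n => h1)

lemma integral_comp_smul_unit {F : Type*} [NormedAddCommGroup F] [NormedSpace ℝ F]
    {c : ℂ} (hc : ‖c‖ = 1) (v : Cn n → F) : ∫ w, v (c • w) = ∫ w, v w := by
  have he : MeasurableEmbedding (fun w : Cn n => c • w) :=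
    (Homeomorph.smulOfNeZero c (by rintro rfl; simp at hc)).measurableEmbedding
  exact (measurePreserving_smul hc).integral_comp he v

/-- The average of `v` over the circle `z + e^{iθ} w`. -/
def lineAvg {F : Type*} [NormedAddCommGroup F] [NormedSpace ℝ F] (v : Cn n → F) (z w : Cn n) : F :=
  (2 * Real.pi)⁻¹ • ∫ θ in (0 : ℝ)..(2 * Real.pi), v (z + Complex.exp (Complex.I * θ) • w)

lemma norm_exp_I_mul (θ : ℝ) : ‖Complex.exp (Complex.I * θ)‖ = 1 := by
  rw [mul_comm]; exact Complex.norm_exp_ofReal_mul_I θ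

section RotationAverage

variable {F : Type*} [NormedAddCommGroup F] [NormedSpace ℝ F]
  {ρ : Cn n → ℝ} {δ : ℝ}

lemma integrable_mollifier_rot (hρ : IsMollifier ρ δ) {v : Cn n → F} (hv : StronglyMeasurable v)
    {z : Cn n} {C : ℝ} (hC : ∀ w, ‖w‖ ≤ δ → ‖v (z + w)‖ ≤ C) :
    Integrable (fun p : ℝ × Cn n => ρ p.2 • v (z + Complex.exp (Complex.I * p.1) • p.2))
      ((volume.restrict (Set.Ioc 0 (2 * Real.pi))).prod volume) := by
  have hm : StronglyMeasurable
      (fun p : ℝ × Cn n => ρ p.2 • v (z + Complex.exp (Complex.I * p.1) • p.2)) := by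
    refine (hρ.continuous.comp continuous_snd).stronglyMeasurable.smul ?_
    refine hv.comp_measurable (Continuous.measurable ?_)
    fun_prop
  have hi : Integrable (fun p : ℝ × Cn n => (C * 1) * ρ p.2)
      ((volume.restrict (Set.Ioc 0 (2 * Real.pi))).prod volume) := by
    refine Integrable.const_mul ?_ _
    exact hρ.integrable.comp_snd _
  refine hi.mono hm.aestronglyMeasurable (Eventually.of_forall fun p => ?_)
  rw [norm_smul, mul_comm, norm_mul]
  by_cases h0 : ρ p.2 = 0
  · simp [h0]
  · gcongr
    refine (hC _ ?_).trans (by simpa using le_abs_self C)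
    rw [norm_smul, norm_exp_I_mul, one_mul]
    exact hρ.supp _ h0

lemma integrable_mollifier (hρ : IsMollifier ρ δ) {v : Cn n → F} (hv : StronglyMeasurable v)
    {z : Cn n} {C : ℝ} (hC : ∀ w, ‖w‖ ≤ δ → ‖v (z + w)‖ ≤ C) :
    Integrable (fun w => ρ w • v (z + w)) := by
  have hm : StronglyMeasurable (fun w => ρ w • v (z + w)) :=
    hρ.continuous.stronglyMeasurable.smul
      (hv.comp_measurable (Continuous.measurable (by fun_prop)))
  refine (hρ.integrable.const_mul C).mono hm.aestronglyMeasurable (Eventually.of_forall fun w => ?_)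
  rw [norm_smul, mul_comm, norm_mul]
  by_cases h0 : ρ w = 0
  · simp [h0]
  · gcongr
    exact (hC _ (hρ.supp _ h0)).trans (le_abs_self C)

lemma integral_mollifier_eq_lineAvg [CompleteSpace F] (hρ : IsMollifier ρ δ) {v : Cn n → F}
    (hv : StronglyMeasurable v)
    {z : Cn n} {C : ℝ} (hC : ∀ w, ‖w‖ ≤ δ → ‖v (z + w)‖ ≤ C) :
    Integrable (fun w => ρ w • lineAvg v z w) ∧
      ∫ w, ρ w • v (z + w) = ∫ w, ρ w • lineAvg v z w := by
  have hint := integrable_mollifier_rot hρ hv hC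
  have hpi : 0 < 2 * Real.pi := by positivity
  have hform : ∀ w, ρ w • lineAvg v z w = (2 * Real.pi)⁻¹ •
      ∫ θ in Set.Ioc 0 (2 * Real.pi), ρ w • v (z + Complex.exp (Complex.I * θ) • w) := by
    intro w
    rw [integral_smul, lineAvg, intervalIntegral.integral_of_le hpi.le, smul_comm]
  constructor
  · simp_rw [hform]
    exact (hint.integral_prod_right).smul _
  · simp_rw [hform]
    rw [integral_smul, ← integral_integral_swap (f := fun (θ : ℝ) (w : Cn n) =>
      ρ w • v (z + Complex.exp (Complex.I * θ) • w)) hint]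
    have hrot : ∀ θ : ℝ, ∫ w, ρ w • v (z + Complex.exp (Complex.I * θ) • w)
        = ∫ w, ρ w • v (z + w) := by
      intro θ
      rw [← integral_comp_smul_unit (norm_exp_I_mul θ) (fun w => ρ w • v (z + w))]
      simp_rw [hρ.rot _ (norm_exp_I_mul θ)]
    simp_rw [hrot]
    rw [setIntegral_const]
    simp only [Measure.real, Real.volume_Ioc, sub_zero, ENNReal.toReal_ofReal hpi.le, smul_smul]
    rw [inv_mul_cancel₀ hpi.ne', one_smul]

lemma eq_integral_mollifier [CompleteSpace F] (hρ : IsMollifier ρ δ) {v : Cn n → F}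
    (hv : StronglyMeasurable v)
    {z : Cn n} {C : ℝ} (hC : ∀ w, ‖w‖ ≤ δ → ‖v (z + w)‖ ≤ C)
    (havg : ∀ w, ‖w‖ ≤ δ → lineAvg v z w = v z) :
    v z = ∫ w, ρ w • v (z + w) := by
  rw [(integral_mollifier_eq_lineAvg hρ hv hC).2]
  have : ∀ w, ρ w • lineAvg v z w = ρ w • v z := by
    intro w
    by_cases h0 : ρ w = 0
    · simp [h0]
    · rw [havg w (hρ.supp w h0)]
  simp_rw [this]
  rw [integral_smul_const, hρ.integral_eq, one_smul]

lemma le_integral_mollifier (hρ : IsMollifier ρ δ) {v : Cn n → ℝ} (hv : StronglyMeasurable v)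
    {z : Cn n} {C : ℝ} (hC : ∀ w, ‖w‖ ≤ δ → ‖v (z + w)‖ ≤ C)
    (havg : ∀ w, v z ≤ lineAvg v z w) :
    v z ≤ ∫ w, ρ w • v (z + w) := by
  obtain ⟨h1, h2⟩ := integral_mollifier_eq_lineAvg hρ hv hC
  rw [h2]
  calc v z = ∫ w, ρ w • v z := by rw [integral_smul_const, hρ.integral_eq, one_smul]
    _ ≤ _ := by
      refine integral_mono (hρ.integrable.smul_const _) h1 fun w => ?_
      exact mul_le_mul_of_nonneg_left (havg w) (hρ.nonneg w)

end RotationAverage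

/-! ### Holomorphic functions of several variables -/

lemma lineAvg_eq_of_differentiableOn {f : Cn n → ℂ} {z w : Cn n} {δ : ℝ} (hδ : 0 < δ)
    (hf : DifferentiableOn ℂ f (Metric.closedBall z δ)) (hw : ‖w‖ ≤ δ) :
    lineAvg f z w = f z := by
  have hd : DifferentiableOn ℂ (fun l : ℂ => f (z + l • w)) (Metric.closedBall 0 1) := by
    refine hf.comp (Differentiable.differentiableOn (by fun_prop)) fun l hl => ?_
    simp only [Metric.mem_closedBall, dist_zero_right] at hl
    rw [mem_closedBall_iff_norm, add_sub_cancel_left, norm_smul]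
    nlinarith [norm_nonneg w, norm_nonneg l]
  have h := DiffContOnCl.circleAverage (f := fun l : ℂ => f (z + l • w)) (c := 0) (R := 1)
    (by
      rw [abs_one]
      exact (hd.mono Metric.closure_ball_subset_closedBall).diffContOnCl)
  simp only [zero_smul, add_zero] at h
  rw [← h, Real.circleAverage, lineAvg]
  simp [circleMap, mul_comm]

lemma lineAvg_congr {F : Type*} [NormedAddCommGroup F] [NormedSpace ℝ F] {u v : Cn n → F}
    {z w : Cn n} {δ : ℝ} (hw : ‖w‖ ≤ δ) (h : ∀ x ∈ Metric.closedBall z δ, u x = v x) :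
    lineAvg u z w = lineAvg v z w := by
  unfold lineAvg
  congr 2
  ext θ
  refine h _ ?_
  rw [mem_closedBall_iff_norm, add_sub_cancel_left, norm_smul, norm_exp_I_mul, one_mul]
  exact hw

lemma holomorphic_eq_integral_mollifier {ρ : Cn n → ℝ} {δ : ℝ} (hδ : 0 < δ)
    (hρ : IsMollifier ρ δ) {f : Cn n → ℂ} {K : Set (Cn n)} (hK : IsCompact K)
    (hf : DifferentiableOn ℂ f K) {z : Cn n} (hz : Metric.closedBall z δ ⊆ K) :
    f z = ∫ w, ρ w • K.indicator f (z + w) := by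
  have hm : StronglyMeasurable (K.indicator f) := by
    have h1 : Measurable (K.indicator f) := by
      refine measurable_of_restrict_of_restrict_compl hK.measurableSet ?_ ?_
      · have h := (continuousOn_iff_continuous_domRestrict.1 hf.continuousOn).measurable
        have he : K.domRestrict (K.indicator f) = K.domRestrict f :=
          funext fun x => Set.indicator_of_mem x.2 f
        rw [he]
        exact h
      · have he : Kᶜ.domRestrict (K.indicator f) = fun _ => 0 :=
          funext fun x => Set.indicator_of_notMem x.2 f
        rw [he]
        exact measurable_const
    exact h1.stronglyMeasurable
  obtain ⟨C, hC⟩ := hK.exists_bound_of_continuousOn hf.continuousOn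
  have hmem : ∀ w : Cn n, ‖w‖ ≤ δ → z + w ∈ Metric.closedBall z δ := fun w hw => by
    rw [mem_closedBall_iff_norm, add_sub_cancel_left]; exact hw
  have hind : ∀ x ∈ Metric.closedBall z δ, K.indicator f x = f x := fun x hx =>
    Set.indicator_of_mem (hz hx) f
  have h0 := hind z (Metric.mem_closedBall_self hδ.le)
  rw [← h0]
  refine eq_integral_mollifier hρ hm (C := C) ?_ ?_
  · intro w hw
    rw [hind _ (hmem w hw)]
    exact hC _ (hz (hmem w hw))
  · intro w hw
    rw [h0, lineAvg_congr hw hind]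
    exact lineAvg_eq_of_differentiableOn hδ (hf.mono hz) hw

lemma contDiffOn_real_of_differentiableOn {f : Cn n → ℂ} {Ω : Set (Cn n)} (hΩ : IsOpen Ω)
    (hf : DifferentiableOn ℂ f Ω) : ContDiffOn ℝ ∞ f Ω := by
  intro z₀ hz₀
  obtain ⟨ε, hε, hεΩ⟩ := Metric.nhds_basis_closedBall.mem_iff.1 (hΩ.mem_nhds hz₀)
  set δ := ε / 2 with hδd
  have hδ : 0 < δ := by positivity
  obtain ⟨ρ, hρ⟩ := exists_isMollifier n hδ
  set K := Metric.closedBall z₀ ε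
  have hK : IsCompact K := isCompact_closedBall _ _
  set v := K.indicator f
  have hvi : LocallyIntegrable v := by
    refine Integrable.locallyIntegrable ?_
    exact (integrable_indicator_iff hK.measurableSet).2
      ((hf.mono hεΩ).continuousOn.integrableOn_compact hK)
  have hconv : ContDiff ℝ ∞ (ρ ⋆[ContinuousLinearMap.lsmul ℝ ℝ, volume] v) :=
    hρ.hasCompactSupport.contDiff_convolution_left _ hρ.smooth hvi
  have heq : ∀ z ∈ Metric.ball z₀ δ, f z = (ρ ⋆[ContinuousLinearMap.lsmul ℝ ℝ, volume] v) z := by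
    intro z hz
    have hsub : Metric.closedBall z δ ⊆ K := by
      refine Metric.closedBall_subset_closedBall' ?_
      have := Metric.mem_ball.1 hz
      linarith
    rw [holomorphic_eq_integral_mollifier hδ hρ hK (hf.mono hεΩ) hsub, convolution_def,
      ← integral_neg_eq_self]
    refine integral_congr_ae (Eventually.of_forall fun w => ?_)
    simp [hρ.neg, sub_eq_add_neg, v]
  have hev : f =ᶠ[𝓝 z₀] (ρ ⋆[ContinuousLinearMap.lsmul ℝ ℝ, volume] v) := by
    filter_upwards [Metric.ball_mem_nhds z₀ hδ] with z hz using heq z hz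
  exact (hconv.contDiffAt.congr_of_eventuallyEq hev).contDiffWithinAt

/-- The value of a holomorphic function is controlled by its `L²` norm on a polydisc. -/
lemma exists_enorm_sq_le_lintegral (n : ℕ) {δ : ℝ} (hδ : 0 < δ) : ∃ B : ℝ≥0, ∀ f : Cn n → ℂ,
    ∀ z : Cn n, DifferentiableOn ℂ f (Metric.closedBall z δ) →
      ‖f z‖ₑ ^ 2 ≤ B * ∫⁻ x in Metric.closedBall z δ, ‖f x‖ₑ ^ 2 := by
  obtain ⟨ρ, hρ⟩ := exists_isMollifier n hδ
  obtain ⟨B, hB⟩ := hρ.continuous.bounded_above_of_compact_support hρ.hasCompactSupport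
  refine ⟨B.toNNReal, fun f z hf => ?_⟩
  have h := holomorphic_eq_integral_mollifier hδ hρ (isCompact_closedBall z δ)
    (f := fun x => f x ^ 2) (hf.pow 2) subset_rfl
  rw [← enorm_pow, h]
  refine (enorm_integral_le_lintegral_enorm _).trans ?_
  rw [← lintegral_indicator Metric.isClosed_closedBall.measurableSet,
    ← lintegral_const_mul' _ _ ENNReal.coe_ne_top,
    ← lintegral_add_left_eq_self
      (fun x => (B.toNNReal : ℝ≥0∞) * (Metric.closedBall z δ).indicator (fun x => ‖f x‖ₑ ^ 2) x) z]
  refine lintegral_mono fun w => ?_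
  rw [enorm_smul]
  by_cases hw : z + w ∈ Metric.closedBall z δ
  · rw [Set.indicator_of_mem hw, Set.indicator_of_mem hw, enorm_pow]
    gcongr
    rw [← ofReal_norm]
    exact ENNReal.ofReal_le_ofReal (hB w)
  · rw [Set.indicator_of_notMem hw, Set.indicator_of_notMem hw]
    simp

/-! ### Power series expansions -/

/-- The monomial `z^a`. -/
def mono (a : Fin n → ℕ) (z : Cn n) : ℂ := ∏ j, z j ^ a j

lemma mono_add (a b : Fin n → ℕ) (z : Cn n) : mono (a + b) z = mono a z * mono b z := by
  simp [mono, pow_add, Finset.prod_mul_distrib]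

lemma norm_mono_le {a : Fin n → ℕ} {z : Cn n} {r : Fin n → ℝ} (h : ∀ j, ‖z j‖ ≤ r j) :
    ‖mono a z‖ ≤ ∏ j, r j ^ a j := by
  rw [mono, norm_prod]
  refine Finset.prod_le_prod (fun _ _ => norm_nonneg _) fun j _ => ?_
  rw [norm_pow]
  gcongr
  exact h j

lemma summable_prod_pow : ∀ {n : ℕ} {x : Fin n → ℝ}, (∀ j, 0 ≤ x j) → (∀ j, x j < 1) →
    Summable fun a : Fin n → ℕ => ∏ j, x j ^ a j := by
  intro n
  induction n with
  | zero => intro x _ _; exact Summable.of_finite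
  | succ n ih =>
    intro x h0 h1
    have h := (summable_geometric_of_lt_one (h0 0) (h1 0)).mul_of_nonneg
      (ih (x := fun j => x j.succ) (fun j => h0 _) fun j => h1 _)
      (fun k => pow_nonneg (h0 0) k) (fun a => Finset.prod_nonneg fun j _ => pow_nonneg (h0 _) _)
    refine ((Fin.consEquiv fun _ => ℕ).summable_iff).1 ?_
    refine h.congr fun p => ?_
    simp [Fin.prod_univ_succ, Fin.consEquiv]

/-- The embedding of `ℂⁿ` in `ℂⁿ⁺¹` as the hyperplane where the first coordinate vanishes. -/
def inclTail (n : ℕ) : Cn n →L[ℂ] Cn (n + 1) :=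
  ContinuousLinearMap.pi (Fin.cases 0 fun j => ContinuousLinearMap.proj j)

lemma cons_eq_add (ζ : ℂ) (z : Cn n) :
    (Fin.cons ζ z : Cn (n + 1)) = (Pi.single 0 ζ : Cn (n + 1)) + inclTail n z := by
  ext j
  refine Fin.cases ?_ (fun j => ?_) j <;> simp [inclTail]

lemma continuous_cons : Continuous fun p : ℂ × Cn n => (Fin.cons p.1 p.2 : Cn (n + 1)) := by
  simp_rw [cons_eq_add]
  have : Continuous fun p : ℂ × Cn n => (Pi.single 0 p.1 : Cn (n + 1)) :=
    (continuous_single (A := fun _ : Fin (n + 1) => ℂ) 0).comp continuous_fst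
  fun_prop

lemma norm_cons_lt {ζ : ℂ} {z : Cn n} {R : ℝ} (h1 : ‖ζ‖ < R) (h2 : ‖z‖ < R) :
    ‖(Fin.cons ζ z : Cn (n + 1))‖ < R := by
  have hR : 0 < R := (norm_nonneg _).trans_lt h1
  refine (pi_norm_lt_iff hR).2 fun j => ?_
  refine Fin.cases ?_ (fun j => ?_) j
  · simpa using h1
  · simpa using (norm_le_pi_norm z j).trans_lt h2

lemma norm_cons_le {ζ : ℂ} {z : Cn n} {R : ℝ} (h1 : ‖ζ‖ ≤ R) (h2 : ‖z‖ ≤ R) :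
    ‖(Fin.cons ζ z : Cn (n + 1))‖ ≤ R := by
  have hR : 0 ≤ R := (norm_nonneg _).trans h1
  refine (pi_norm_le_iff_of_nonneg hR).2 fun j => ?_
  refine Fin.cases ?_ (fun j => ?_) j
  · simpa using h1
  · simpa using (norm_le_pi_norm z j).trans h2

lemma continuousOn_fderiv_complex {f : Cn n → ℂ} {Ω : Set (Cn n)} (hΩ : IsOpen Ω)
    (hf : DifferentiableOn ℂ f Ω) : ContinuousOn (fderiv ℂ f) Ω := by
  have h1 : ContinuousOn (fderiv ℝ f) Ω :=
    ((contDiffOn_real_of_differentiableOn hΩ hf)).continuousOn_fderiv_of_isOpen hΩ (by simp)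
  have hiso : Isometry (ContinuousLinearMap.restrictScalarsIsometry ℂ (Cn n) ℂ ℝ ℝ) :=
    LinearIsometry.isometry _
  rw [← hiso.comp_continuousOn_iff]
  refine h1.congr fun z hz => ?_
  exact ((hf.differentiableAt (hΩ.mem_nhds hz)).fderiv_restrictScalars ℝ).symm

lemma differentiableOn_integral_cons {F : Cn (n + 1) → ℂ} {R R' : ℝ} (hR : 0 < R) (hRR' : R < R')
    (hF : DifferentiableOn ℂ F (Metric.ball 0 R')) {κ : ℝ → ℂ} (hκ : Continuous κ) :
    DifferentiableOn ℂ (fun z : Cn n => ∫ θ in (0 : ℝ)..(2 * Real.pi),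
      κ θ * F (Fin.cons (circleMap 0 R θ) z)) (Metric.ball 0 R') := by
  intro z₀ hz₀
  obtain ⟨ε, hε, hεΩ⟩ :=
    Metric.nhds_basis_closedBall.mem_iff.1 (Metric.isOpen_ball.mem_nhds hz₀)
  have hmem : ∀ θ : ℝ, ∀ z ∈ Metric.ball (0 : Cn n) R',
      (Fin.cons (circleMap 0 R θ) z : Cn (n + 1)) ∈ Metric.ball (0 : Cn (n + 1)) R' := by
    intro θ z hz
    rw [mem_ball_zero_iff] at hz ⊢
    refine norm_cons_lt ?_ hz
    simpa [circleMap, abs_of_pos hR] using hRR'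
  have hcc : Continuous fun p : ℝ × Cn n => (Fin.cons (circleMap 0 R p.1) p.2 : Cn (n + 1)) :=
    continuous_cons.comp (((continuous_circleMap 0 R).comp continuous_fst).prodMk continuous_snd)
  have hD := continuousOn_fderiv_complex Metric.isOpen_ball hF
  have hFc : ∀ z ∈ Metric.ball (0 : Cn n) R', Continuous fun θ : ℝ =>
      κ θ * F (Fin.cons (circleMap 0 R θ) z) := by
    intro z hz
    refine hκ.mul ?_
    exact hF.continuousOn.comp_continuous (hcc.comp (Continuous.prodMk_left z)) fun θ => hmem θ z hz
  have hDc : ∀ z ∈ Metric.ball (0 : Cn n) R', Continuous fun θ : ℝ =>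
      κ θ • (fderiv ℂ F (Fin.cons (circleMap 0 R θ) z)).comp (inclTail n) := by
    intro z hz
    refine hκ.smul ?_
    refine Continuous.clm_comp ?_ continuous_const
    exact hD.comp_continuous (hcc.comp (Continuous.prodMk_left z)) fun θ => hmem θ z hz
  have hbd : ContinuousOn (fun p : ℝ × Cn n =>
      κ p.1 • (fderiv ℂ F (Fin.cons (circleMap 0 R p.1) p.2)).comp (inclTail n))
      (Set.Icc 0 (2 * Real.pi) ×ˢ Metric.closedBall z₀ ε) := by
    refine (hκ.comp continuous_fst).continuousOn.smul ?_
    refine ContinuousOn.clm_comp ?_ continuousOn_const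
    exact hD.comp hcc.continuousOn fun p hp => hmem p.1 p.2 (hεΩ hp.2)
  obtain ⟨B, hB⟩ := (isCompact_Icc.prod (isCompact_closedBall z₀ ε)).exists_bound_of_continuousOn hbd
  have h := intervalIntegral.hasFDerivAt_integral_of_dominated_of_fderiv_le (𝕜 := ℂ)
    (μ := volume) (a := 0) (b := 2 * Real.pi) (x₀ := z₀) (bound := fun _ => B)
    (F := fun z θ => κ θ * F (Fin.cons (circleMap 0 R θ) z))
    (F' := fun z θ => κ θ • (fderiv ℂ F (Fin.cons (circleMap 0 R θ) z)).comp (inclTail n))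
    (Metric.closedBall_mem_nhds z₀ hε) ?_ ((hFc z₀ hz₀).intervalIntegrable _ _)
    (hDc z₀ hz₀).aestronglyMeasurable ?_ intervalIntegrable_const ?_
  · exact h.differentiableAt.differentiableWithinAt
  · filter_upwards [Metric.isOpen_ball.mem_nhds hz₀] with z hz
    exact (hFc z hz).aestronglyMeasurable
  · refine Eventually.of_forall fun θ hθ z hz => hB (θ, z) ⟨?_, hz⟩
    rw [Set.uIoc_of_le (by positivity)] at hθ
    exact ⟨hθ.1.le, hθ.2⟩
  · refine Eventually.of_forall fun θ _ z hz => ?_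
    have h1 : HasFDerivAt F (fderiv ℂ F (Fin.cons (circleMap 0 R θ) z))
        (Fin.cons (circleMap 0 R θ) z) :=
      (hF.differentiableAt (Metric.isOpen_ball.mem_nhds (hmem θ z (hεΩ hz)))).hasFDerivAt
    have h2 : HasFDerivAt (fun z : Cn n => (Fin.cons (circleMap 0 R θ) z : Cn (n + 1)))
        (inclTail n) z := by
      simp_rw [cons_eq_add]
      exact (inclTail n).hasFDerivAt.const_add _
    exact (h1.comp z h2).const_mul (κ θ)

/-- Power series expansion of a holomorphic function on a polydisc, with Cauchy's estimates. -/
lemma exists_powerSeries : ∀ {n : ℕ} {F : Cn n → ℂ} {R R' M : ℝ}, 0 < R → R < R' →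
    DifferentiableOn ℂ F (Metric.ball 0 R') → (∀ z, ‖z‖ ≤ R → ‖F z‖ ≤ M) →
    ∃ c : (Fin n → ℕ) → ℂ, (∀ a, ‖c a‖ * R ^ (∑ j, a j) ≤ M) ∧
      ∀ z, ‖z‖ < R → HasSum (fun a => c a * mono a z) (F z) := by
  intro n
  induction n with
  | zero =>
    intro F R R' M hR _ _ hM
    refine ⟨fun _ => F 0, fun a => by simpa using hM 0 (by rw [norm_zero]; exact hR.le), fun z _ => ?_⟩
    have hz : z = 0 := Subsingleton.elim _ _
    subst hz
    convert hasSum_unique (fun _ : Fin 0 → ℕ => F 0) using 1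
    ext a; simp [mono]
  | succ n ih =>
    intro F R R' M hR hRR' hF hM
    have hpi : (0 : ℝ) < 2 * Real.pi := by positivity
    set G : ℕ → Cn n → ℂ := fun k z => (2 * Real.pi : ℂ)⁻¹ * ∫ θ in (0 : ℝ)..(2 * Real.pi),
      (circleMap 0 R θ)⁻¹ ^ k * F (Fin.cons (circleMap 0 R θ) z) with hG
    have hcm : ∀ θ, ‖circleMap 0 R θ‖ = R := fun θ => by simp [circleMap, abs_of_pos hR]
    have hcm0 : ∀ θ, circleMap 0 R θ ≠ 0 := fun θ h => by
      have := hcm θ; rw [h, norm_zero] at this; exact hR.ne this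
    have hGd : ∀ k, DifferentiableOn ℂ (G k) (Metric.ball 0 R') := by
      intro k
      refine DifferentiableOn.const_mul ?_ _
      refine differentiableOn_integral_cons hR hRR' hF ?_
      exact (((continuous_circleMap 0 R).inv₀ hcm0).pow k)
    have hGM : ∀ k z, ‖z‖ ≤ R → ‖G k z‖ ≤ M / R ^ k := by
      intro k z hz
      have h := intervalIntegral.norm_integral_le_of_norm_le_const (a := 0) (b := 2 * Real.pi)
        (C := M / R ^ k)
        (f := fun θ => (circleMap 0 R θ)⁻¹ ^ k * F (Fin.cons (circleMap 0 R θ) z)) (by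
          intro θ _
          rw [norm_mul, norm_pow, norm_inv, hcm, div_eq_inv_mul, inv_pow]
          gcongr
          exact hM _ (norm_cons_le (hcm θ).le hz))
      rw [hG, norm_mul]
      have h2 : ‖(2 * Real.pi : ℂ)⁻¹‖ = (2 * Real.pi)⁻¹ := by
        rw [norm_inv]
        congr 1
        simp [abs_of_pos Real.pi_pos]
      rw [h2]
      calc (2 * Real.pi)⁻¹ * _ ≤ (2 * Real.pi)⁻¹ * (M / R ^ k * |2 * Real.pi - 0|) := by gcongr
        _ = M / R ^ k := by
          rw [sub_zero, abs_of_pos hpi]; field_simp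
    have hGs : ∀ (ζ : ℂ) (z : Cn n), ‖ζ‖ < R → ‖z‖ < R →
        HasSum (fun k => ζ ^ k * G k z) (F (Fin.cons ζ z)) := by
      intro ζ z hζ hz
      have hd : DifferentiableOn ℂ (fun ζ : ℂ => F (Fin.cons ζ z)) (Metric.closedBall 0 R) := by
        refine hF.comp (Differentiable.differentiableOn ?_) ?_
        · simp_rw [cons_eq_add]
          refine Differentiable.add_const _ ?_
          exact (ContinuousLinearMap.single ℂ (fun _ : Fin (n + 1) => ℂ) 0).differentiable
        · intro ζ hζ
          rw [mem_ball_zero_iff]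
          rw [mem_closedBall_zero_iff] at hζ
          exact norm_cons_lt (hζ.trans_lt hRR') (hz.trans hRR')
      lift R to ℝ≥0 using hR.le
      have hps := (hd.hasFPowerSeriesOnBall (by exact_mod_cast hR)).hasSum (y := ζ)
        (by simpa [← ofReal_norm, ENNReal.ofReal_lt_coe_iff] using hζ)
      rw [zero_add] at hps
      refine hps.congr_fun fun k => ?_
      rw [cauchyPowerSeries_apply, circleIntegral]
      simp only [hG, deriv_circleMap, sub_zero, smul_eq_mul, mul_inv]
      rw [mul_left_comm, ← intervalIntegral.integral_const_mul,
        ← intervalIntegral.integral_const_mul, ← intervalIntegral.integral_const_mul]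
      refine intervalIntegral.integral_congr fun θ _ => ?_
      have := hcm0 θ
      simp only [div_pow, inv_pow]
      field_simp
    have hc := fun k => ih hR hRR' (hGd k) (hGM k)
    choose c hc1 hc2 using hc
    refine ⟨fun a => c (a 0) (Fin.tail a), fun a => ?_, fun z hz => ?_⟩
    · have h := hc1 (a 0) (Fin.tail a)
      rw [Fin.sum_univ_succ, pow_add]
      rw [le_div_iff₀ (by positivity)] at h
      simp only [Fin.tail] at h
      calc _ = ‖c (a 0) (Fin.tail a)‖ * R ^ (∑ i : Fin n, a i.succ) * R ^ a 0 := by ring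
        _ ≤ M := h
    · have hM0 : 0 ≤ M := (norm_nonneg _).trans (hM 0 (by rw [norm_zero]; exact hR.le))
      have hzj : ∀ j, ‖z j‖ < R := fun j => (norm_le_pi_norm z j).trans_lt hz
      have hsum : Summable fun a : Fin (n + 1) → ℕ => c (a 0) (Fin.tail a) * mono a z := by
        have hs := (summable_prod_pow (x := fun j => ‖z j‖ / R) (fun j => by positivity)
          (fun j => (div_lt_one hR).2 (hzj j))).mul_left M
        refine Summable.of_norm_bounded hs fun a => ?_
        have h1 : ‖c (a 0) (Fin.tail a)‖ * R ^ (∑ j, a j) ≤ M := by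
          have h := hc1 (a 0) (Fin.tail a)
          rw [Fin.sum_univ_succ, pow_add]
          rw [le_div_iff₀ (by positivity)] at h
          simp only [Fin.tail] at h
          calc _ = ‖c (a 0) (Fin.tail a)‖ * R ^ (∑ i : Fin n, a i.succ) * R ^ a 0 := by ring
            _ ≤ M := h
        have h2 : ∏ j, (‖z j‖ / R) ^ a j = ‖mono a z‖ / R ^ (∑ j, a j) := by
          simp [mono, div_pow, Finset.prod_div_distrib, Finset.prod_pow_eq_pow_sum]
        rw [h2, norm_mul, mul_div_assoc', le_div_iff₀ (by positivity)]
        nlinarith [norm_nonneg (mono a z)]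
      have hsum' : Summable fun p : ℕ × (Fin n → ℕ) =>
          z 0 ^ p.1 * (c p.1 p.2 * mono p.2 (Fin.tail z)) := by
        refine (((Fin.consEquiv fun _ => ℕ).summable_iff).2 hsum).congr fun p => ?_
        simp [mono, Fin.prod_univ_succ, Fin.consEquiv, Fin.tail]
        ring
      have htail : ‖Fin.tail z‖ < R := (pi_norm_lt_iff hR).2 fun j => hzj _
      have hfib : ∀ k, HasSum (fun a => z 0 ^ k * (c k a * mono a (Fin.tail z)))
          (z 0 ^ k * G k (Fin.tail z)) := fun k => (hc2 k _ htail).mul_left _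
      have h1 := hsum'.hasSum.prod_fiberwise hfib
      have h2 := hGs (z 0) (Fin.tail z) (hzj 0) htail
      rw [Fin.cons_self_tail] at h2
      have h3 := h1.unique h2
      rw [← h3]
      refine ((Fin.consEquiv fun _ => ℕ).hasSum_iff).1 ?_
      convert hsum'.hasSum using 1
      ext p
      simp [mono, Fin.prod_univ_succ, Fin.consEquiv, Fin.tail]
      ring

/-! ### Operators on `ℓ¹` -/

section EllOne

variable {σ : Type*} {X : Type*} [NormedAddCommGroup X] [NormedSpace ℂ X]

lemma memℓp_one_iff {h : σ → ℂ} : Memℓp h 1 ↔ Summable fun b => ‖h b‖ := by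
  rw [memℓp_gen_iff (by simp)]
  simp

lemma ellOne_summable (h : lp (fun _ : σ => ℂ) 1) : Summable fun b => ‖h b‖ :=
  memℓp_one_iff.1 (lp.memℓp h)

lemma ellOne_norm (h : lp (fun _ : σ => ℂ) 1) : ‖h‖ = ∑' b, ‖h b‖ := by
  rw [lp.norm_eq_tsum_rpow (by simp)]
  simp

lemma summable_smul_of_norm_le [CompleteSpace X] {v : σ → X} {C : ℝ} (hv : ∀ b, ‖v b‖ ≤ C)
    (h : lp (fun _ : σ => ℂ) 1) : Summable fun b => h b • v b := by
  refine Summable.of_norm_bounded ((ellOne_summable h).mul_right C) fun b => ?_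
  rw [norm_smul]
  gcongr
  exact hv b

/-- The operator on `ℓ¹` sending the basis vector with index `b` to `v b`. -/
def ellOneOp [CompleteSpace X] (v : σ → X) (C : ℝ) (hv : ∀ b, ‖v b‖ ≤ C) :
    lp (fun _ : σ => ℂ) 1 →L[ℂ] X :=
  LinearMap.mkContinuous
    { toFun := fun h => ∑' b, h b • v b
      map_add' := fun g h => by
        rw [← (summable_smul_of_norm_le hv g).tsum_add (summable_smul_of_norm_le hv h)]
        simp [add_smul]
      map_smul' := fun c h => by
        rw [RingHom.id_apply, ← tsum_const_smul'']
        simp [smul_smul] }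
    C (fun h => by
      simp only [LinearMap.coe_mk, AddHom.coe_mk]
      have h1 := (ellOne_summable h).mul_left C
      calc ‖∑' b, h b • v b‖ ≤ ∑' b, C * ‖h b‖ := by
            refine tsum_of_norm_bounded h1.hasSum fun b => ?_
            rw [norm_smul, mul_comm]
            gcongr
            exact hv b
        _ = C * ‖h‖ := by rw [tsum_mul_left, ellOne_norm])

lemma ellOneOp_apply [CompleteSpace X] (v : σ → X) (C : ℝ) (hv : ∀ b, ‖v b‖ ≤ C)
    (h : lp (fun _ : σ => ℂ) 1) : ellOneOp v C hv h = ∑' b, h b • v b := rfl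

lemma norm_ellOneOp_le [CompleteSpace X] (v : σ → X) {C : ℝ} (hC : 0 ≤ C) (hv : ∀ b, ‖v b‖ ≤ C) :
    ‖ellOneOp v C hv‖ ≤ C :=
  LinearMap.mkContinuous_norm_le _ hC _

variable [DecidableEq σ]

/-- The basis vector of `ℓ¹` with index `b`. -/
def ellOneBasis (b : σ) : lp (fun _ : σ => ℂ) 1 := lp.single 1 b (1 : ℂ)

lemma norm_ellOneBasis (b : σ) : ‖ellOneBasis b‖ = 1 := by
  rw [ellOneBasis, lp.norm_single (by simp)]
  simp

lemma tsum_smul_ellOneBasis (h : lp (fun _ : σ => ℂ) 1) : ∑' b, h b • ellOneBasis b = h := by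
  have h1 := lp.hasSum_single (E := fun _ : σ => ℂ) (p := 1) (by simp) h
  refine (tsum_congr fun b => ?_).trans h1.tsum_eq
  rw [ellOneBasis, ← lp.single_smul, smul_eq_mul, mul_one]

end EllOne

/-! ### A multiplicative numbering of the monomials -/

/-- The product of prime powers `∏ⱼ pⱼ^{aⱼ}`, an injective numbering of the exponents. -/
def expNum (a : Fin n → ℕ) : ℕ := ∏ j : Fin n, Nat.nth Nat.Prime j ^ a j

lemma prime_nth (j : ℕ) : (Nat.nth Nat.Prime j).Prime :=
  Nat.nth_mem_of_infinite Nat.infinite_setOfPred_prime j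

lemma expNum_pos (a : Fin n → ℕ) : 0 < expNum a :=
  Finset.prod_pos fun j _ => pow_pos (prime_nth j).pos _

lemma expNum_add (a b : Fin n → ℕ) : expNum (a + b) = expNum a * expNum b := by
  simp [expNum, pow_add, Finset.prod_mul_distrib]

lemma expNum_injective : Function.Injective (expNum : (Fin n → ℕ) → ℕ) := by
  intro a b hab
  have key : ∀ (c : Fin n → ℕ) (j : Fin n),
      (expNum c).factorization (Nat.nth Nat.Prime j) = c j := by
    intro c j
    rw [expNum, Nat.factorization_prod fun (i : Fin n) _ => pow_ne_zero _ (prime_nth i).ne_zero]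
    simp only [Finsupp.coe_finsetSum, Finset.sum_apply]
    rw [Finset.sum_eq_single j]
    · rw [(prime_nth j).factorization_pow]; simp
    · intro i _ hij
      rw [(prime_nth i).factorization_pow, Finsupp.single_eq_of_ne]
      intro h
      exact hij (Fin.ext (Nat.nth_injective Nat.infinite_setOfPred_prime h).symm)
    · simp
  ext j
  rw [← key a j, ← key b j, hab]

lemma two_pow_le_expNum (a : Fin n → ℕ) : 2 ^ (∑ j, a j) ≤ expNum a := by
  rw [← Finset.prod_pow_eq_pow_sum]
  exact Finset.prod_le_prod' fun j _ => Nat.pow_le_pow_left (prime_nth j).two_le _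

/-- The weight of the exponent `a`: the norm of `z^a` on the polydisc of radii `pⱼ^{-s}`. -/
def expWt (s : ℕ) (a : Fin n → ℕ) : ℝ := ((expNum a : ℝ)⁻¹) ^ s

lemma expWt_pos (s : ℕ) (a : Fin n → ℕ) : 0 < expWt s a := by
  have := expNum_pos a
  unfold expWt
  positivity

lemma expWt_add (s : ℕ) (a b : Fin n → ℕ) : expWt s (a + b) = expWt s a * expWt s b := by
  simp [expWt, expNum_add, mul_pow, mul_comm]

lemma expWt_anti {s t : ℕ} (h : s ≤ t) (a : Fin n → ℕ) : expWt t a ≤ expWt s a := by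
  have h1 : (1 : ℝ) ≤ expNum a := by exact_mod_cast expNum_pos a
  exact pow_le_pow_of_le_one (by positivity) (inv_le_one_of_one_le₀ h1) h

lemma exists_expWt_le {R : ℝ} (hR : 0 < R) :
    ∃ s : ℕ, ∀ a : Fin n → ℕ, expWt s a ≤ R ^ (∑ j, a j) := by
  obtain ⟨s, hs⟩ := exists_pow_lt_of_lt_one hR (by norm_num : (2⁻¹ : ℝ) < 1)
  refine ⟨s, fun a => ?_⟩
  have h1 : (2 : ℝ) ^ (∑ j, a j) ≤ expNum a := by exact_mod_cast two_pow_le_expNum a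
  calc expWt s a ≤ ((2 ^ (∑ j, a j) : ℝ)⁻¹) ^ s := by unfold expWt; gcongr
    _ = ((2⁻¹ : ℝ) ^ s) ^ (∑ j, a j) := by
      rw [← inv_pow, ← pow_mul, ← pow_mul, mul_comm]
    _ ≤ _ := by gcongr

lemma exists_ball_norm_mono_le (n s : ℕ) :
    ∃ r > 0, ∀ z : Cn n, ‖z‖ < r → ∀ a : Fin n → ℕ, ‖mono a z‖ ≤ expWt s a := by
  set P : ℕ := (∏ j : Fin n, Nat.nth Nat.Prime j) with hP
  have hPpos : 0 < P := Finset.prod_pos fun j _ => (prime_nth j).pos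
  refine ⟨((P : ℝ)⁻¹) ^ s, by positivity, fun z hz a => ?_⟩
  refine (norm_mono_le (r := fun j => ((Nat.nth Nat.Prime j : ℝ)⁻¹) ^ s) fun j => ?_).trans_eq ?_
  · refine ((norm_le_pi_norm z j).trans hz.le).trans ?_
    have h1 : Nat.nth Nat.Prime j ≤ P :=
      Nat.le_of_dvd hPpos (Finset.dvd_prod_of_mem (fun j : Fin n => Nat.nth Nat.Prime j)
        (Finset.mem_univ j))
    have h2 := (prime_nth j).pos
    gcongr
  · simp [expWt, expNum, ← Finset.prod_inv_distrib, ← Finset.prod_pow, ← pow_mul, mul_comm]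

/-! ### Germs that are square integrable against a weight -/

/-- `F` is square integrable near the origin against the weight `W`. -/
def SqIntNear (W : Cn n → ℝ≥0∞) (F : Cn n → ℂ) : Prop := IntNear fun z => ‖F z‖ₑ ^ 2 * W z

lemma SqIntNear.of_norm_le_sum {W : Cn n → ℝ≥0∞} (hW : Measurable W) {ι : Type*} {M : Finset ι}
    {G : ι → Cn n → ℂ} {F : Cn n → ℂ} {C r : ℝ} (hr : 0 < r)
    (hGc : ∀ i ∈ M, ContinuousOn (G i) (Metric.ball 0 r)) (hG : ∀ i ∈ M, SqIntNear W (G i))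
    (hF : ∀ z ∈ Metric.ball (0 : Cn n) r, ‖F z‖ ≤ C * ∑ i ∈ M, ‖G i z‖) : SqIntNear W F := by
  have hU : ∃ V ∈ 𝓝 (0 : Cn n), ∀ i ∈ M, ∫⁻ z in V, ‖G i z‖ₑ ^ 2 * W z < ⊤ := by
    have h1 : ∀ i ∈ M, ∃ U ∈ 𝓝 (0 : Cn n), ∫⁻ z in U, ‖G i z‖ₑ ^ 2 * W z < ⊤ := hG
    choose! U hU hUi using h1
    refine ⟨⋂ i ∈ M, U i, (Filter.biInter_finset_mem M).2 hU, fun i hi => ?_⟩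
    exact (lintegral_mono_set (Set.biInter_subset_of_mem hi)).trans_lt (hUi i hi)
  obtain ⟨V, hV, hVi⟩ := hU
  obtain ⟨ε, hε, hεV⟩ := Metric.mem_nhds_iff.1 (Filter.inter_mem hV (Metric.ball_mem_nhds 0 hr))
  set B := Metric.ball (0 : Cn n) ε
  refine ⟨B, Metric.ball_mem_nhds 0 hε, ?_⟩
  set K : ℝ := C ^ 2 * M.card
  have hbound : ∀ z ∈ B, ‖F z‖ₑ ^ 2 * W z ≤
      ENNReal.ofReal K * ∑ i ∈ M, ‖G i z‖ₑ ^ 2 * W z := by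
    intro z hz
    have h1 : ‖F z‖ ^ 2 ≤ K * ∑ i ∈ M, ‖G i z‖ ^ 2 := by
      calc ‖F z‖ ^ 2 ≤ (C * ∑ i ∈ M, ‖G i z‖) ^ 2 := by
            gcongr; exact hF z (hεV hz).2
        _ = C ^ 2 * (∑ i ∈ M, ‖G i z‖) ^ 2 := by ring
        _ ≤ C ^ 2 * (M.card * ∑ i ∈ M, ‖G i z‖ ^ 2) := by
            gcongr; exact sq_sum_le_card_mul_sum_sq
        _ = _ := by simp only [K]; ring
    rw [← Finset.sum_mul, ← mul_assoc]
    gcongr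
    have h2 := ENNReal.ofReal_le_ofReal h1
    rw [ENNReal.ofReal_mul (by positivity), ENNReal.ofReal_sum_of_nonneg (fun _ _ => by positivity)]
      at h2
    simpa [ENNReal.ofReal_pow, ofReal_norm] using h2
  calc ∫⁻ z in B, ‖F z‖ₑ ^ 2 * W z
      ≤ ∫⁻ z in B, ENNReal.ofReal K * ∑ i ∈ M, ‖G i z‖ₑ ^ 2 * W z :=
        setLIntegral_mono' Metric.isOpen_ball.measurableSet hbound
    _ = ENNReal.ofReal K * ∑ i ∈ M, ∫⁻ z in B, ‖G i z‖ₑ ^ 2 * W z := by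
        rw [lintegral_const_mul' _ _ ENNReal.ofReal_ne_top, lintegral_finsetSum']
        intro i hi
        have hc : ContinuousOn (G i) B := (hGc i hi).mono fun z hz => (hεV hz).2
        exact ((hc.aemeasurable Metric.isOpen_ball.measurableSet).enorm.pow_const 2).mul
          hW.aemeasurable
    _ < ⊤ := by
        refine ENNReal.mul_lt_top ENNReal.ofReal_lt_top ?_
        refine ENNReal.sum_lt_top.2 fun i hi => ?_
        exact (lintegral_mono_set fun z hz => (hεV hz).1).trans_lt (hVi i hi)

/-- The sum of the power series with coefficients `c`. -/
def germ (c : (Fin n → ℕ) → ℂ) (z : Cn n) : ℂ := ∑' b, c b * mono b z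

lemma continuous_mono (b : Fin n → ℕ) : Continuous (mono b : Cn n → ℂ) := by
  unfold mono
  fun_prop

lemma continuousOn_germ {c : (Fin n → ℕ) → ℂ} {s : ℕ} (hc : Summable fun b => ‖c b‖ * expWt s b)
    {r : ℝ} (hr : ∀ z : Cn n, ‖z‖ < r → ∀ a : Fin n → ℕ, ‖mono a z‖ ≤ expWt s a) :
    ContinuousOn (germ c) (Metric.ball 0 r) := by
  refine continuousOn_tsum (fun b => ((continuous_mono b).const_mul _).continuousOn) hc ?_
  intro b z hz
  rw [norm_mul]
  gcongr
  exact hr z (by simpa using hz) b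

/-- Exponents of the initial monomials of the germs that are square integrable against `W`. -/
def initExps (W : Cn n → ℝ≥0∞) : Set (Fin n → ℕ) :=
  {a | ∃ d : (Fin n → ℕ) → ℂ, (∃ s, Summable fun b => ‖d b‖ * expWt s b) ∧ SqIntNear W (germ d) ∧
    d a = 1 ∧ ∀ b, expNum b < expNum a → d b = 0}

lemma exists_tsum_expWt_le {d : (Fin n → ℕ) → ℂ} (hd : ∃ s, Summable fun b => ‖d b‖ * expWt s b)
    {a : Fin n → ℕ} (hda : d a = 1) (hdb : ∀ b, expNum b < expNum a → d b = 0) :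
    ∃ s₀, ∀ s, s₀ ≤ s → (Summable fun b => ‖d b‖ * expWt s b) ∧
      ∑' b, ‖d b - (Pi.single a 1 : (Fin n → ℕ) → ℂ) b‖ * expWt s b ≤ 2⁻¹ * expWt s a := by
  obtain ⟨s₁, hs₁⟩ := hd
  have hsum : ∀ s, s₁ ≤ s → Summable fun b => ‖d b‖ * expWt s b := fun s hs =>
    Summable.of_nonneg_of_le (fun b => mul_nonneg (norm_nonneg _) (expWt_pos _ _).le)
      (fun b => by gcongr; exact expWt_anti hs b) hs₁
  set A := ∑' b, ‖d b‖ * expWt s₁ b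
  have ha := expNum_pos a
  set κ : ℝ := expNum a / (expNum a + 1)
  have hκ0 : 0 ≤ κ := by positivity
  have hκ1 : κ < 1 := (div_lt_one (by positivity)).2 (by linarith)
  have hlim : Tendsto (fun k : ℕ => κ ^ k * A) atTop (𝓝 0) := by
    simpa using (tendsto_pow_atTop_nhds_zero_of_lt_one hκ0 hκ1).mul_const A
  have hpos : 0 < 2⁻¹ * expWt s₁ a := mul_pos (by norm_num) (expWt_pos _ _)
  obtain ⟨k₀, hk₀⟩ := (eventually_atTop.1 (hlim.eventually (gt_mem_nhds hpos)))
  refine ⟨s₁ + k₀, fun s hs => ⟨hsum s (by omega), ?_⟩⟩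
  obtain ⟨k, rfl⟩ : ∃ k, s = s₁ + k := ⟨s - s₁, by omega⟩
  have hk := hk₀ k (by omega)
  have hterm : ∀ b, ‖d b - (Pi.single a 1 : (Fin n → ℕ) → ℂ) b‖ * expWt (s₁ + k) b ≤
      (κ ^ k * expWt k a) * (‖d b‖ * expWt s₁ b) := by
    intro b
    have hwa := expWt_pos k a
    rcases lt_trichotomy (expNum b) (expNum a) with h | h | h
    · have hba : b ≠ a := fun h' => by rw [h'] at h; exact lt_irrefl _ h
      simp [hdb b h, hba]
    · have hba : b = a := expNum_injective h
      subst hba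
      have := expWt_pos s₁ b
      simp only [hda, Pi.single_eq_same, sub_self, norm_zero, zero_mul]
      positivity
    · have hba : b ≠ a := fun h' => by rw [h'] at h; exact lt_irrefl _ h
      have h2 : expWt k b ≤ κ ^ k * expWt k a := by
        unfold expWt
        rw [← mul_pow]
        have hb := expNum_pos b
        gcongr
        have h3 : ((expNum a : ℝ) + 1) ≤ expNum b := by exact_mod_cast h
        have h4 : κ * (expNum a : ℝ)⁻¹ = ((expNum a : ℝ) + 1)⁻¹ := by
          simp only [κ]; field_simp
        rw [h4]
        gcongr
      have h5 : expWt (s₁ + k) b = expWt s₁ b * expWt k b := by simp [expWt, pow_add]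
      rw [h5]
      simp only [Pi.single_eq_of_ne hba, sub_zero]
      have := expWt_pos s₁ b
      calc ‖d b‖ * (expWt s₁ b * expWt k b) ≤ ‖d b‖ * (expWt s₁ b * (κ ^ k * expWt k a)) := by
            gcongr
        _ = _ := by ring
  calc _ ≤ ∑' b, (κ ^ k * expWt k a) * (‖d b‖ * expWt s₁ b) := by
        refine Summable.tsum_le_tsum hterm ?_ (hs₁.mul_left _)
        exact Summable.of_nonneg_of_le
          (fun b => mul_nonneg (norm_nonneg _) (expWt_pos _ _).le) hterm (hs₁.mul_left _)
    _ = (κ ^ k * A) * expWt k a := by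
        rw [tsum_mul_left]; ring
    _ ≤ (2⁻¹ * expWt s₁ a) * expWt k a := by
        have := expWt_pos k a
        gcongr
    _ = _ := by simp [expWt, pow_add, mul_assoc]

lemma exists_finset_forall_exists_le (E : Set (Fin n → ℕ)) :
    ∃ M : Finset (Fin n → ℕ), (∀ a ∈ M, a ∈ E) ∧ ∀ a ∈ E, ∃ b ∈ M, b ≤ a := by
  have hfin : {a | Minimal (· ∈ E) a}.Finite := by
    have hpwo : {a | Minimal (· ∈ E) a}.IsPWO := Set.isPWO_of_wellQuasiOrderedLE _
    exact (setOfPred_minimal_antichain _).finite_of_partiallyWellOrderedOn hpwo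
  refine ⟨hfin.toFinset, fun a ha => ?_, fun a ha => ?_⟩
  · exact ((Set.Finite.mem_toFinset _).1 ha).1
  · obtain ⟨b, hb, hbm⟩ := exists_minimal_le_of_wellFoundedLT (· ∈ E) a ha
    exact ⟨b, (Set.Finite.mem_toFinset _).2 hbm, hb⟩

/-! ### Division and closedness -/

/-- Evaluation at `z` of the power series whose rescaled coefficients are given in `ℓ¹`. -/
def ellOneEval (s : ℕ) (z : Cn n) : lp (fun _ : Fin n → ℕ => ℂ) 1 →L[ℂ] ℂ :=
  open Classical in
  if h : ∀ b : Fin n → ℕ, ‖mono b z / expWt s b‖ ≤ 1 then ellOneOp _ 1 h else 0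

section Division

variable {s : ℕ} {r : ℝ}

lemma ellOneEval_apply (hr : ∀ z : Cn n, ‖z‖ < r → ∀ a : Fin n → ℕ, ‖mono a z‖ ≤ expWt s a)
    {z : Cn n} (hz : z ∈ Metric.ball 0 r) (h : lp (fun _ : Fin n → ℕ => ℂ) 1) :
    ellOneEval s z h = germ (fun b => h b / expWt s b) z := by
  have h1 : ∀ b : Fin n → ℕ, ‖mono b z / expWt s b‖ ≤ 1 := by
    intro b
    have := expWt_pos s b
    rw [norm_div, Complex.norm_real, Real.norm_of_nonneg this.le, div_le_one this]
    exact hr z (by simpa using hz) b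
  rw [ellOneEval, dif_pos h1, ellOneOp_apply, germ]
  refine tsum_congr fun b => ?_
  rw [smul_eq_mul]; ring

lemma ellOneEval_basis (hr : ∀ z : Cn n, ‖z‖ < r → ∀ a : Fin n → ℕ, ‖mono a z‖ ≤ expWt s a)
    {z : Cn n} (hz : z ∈ Metric.ball 0 r) (a : Fin n → ℕ) :
    ellOneEval s z (ellOneBasis a) = mono a z / expWt s a := by
  rw [ellOneEval_apply hr hz, germ, tsum_eq_single a]
  · simp [ellOneBasis]; ring
  · intro b hb
    simp [ellOneBasis, hb]

/-- Multiplication by a monomial on rescaled coefficients. -/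
def ellOneShift (a : Fin n → ℕ) :
    lp (fun _ : Fin n → ℕ => ℂ) 1 →L[ℂ] lp (fun _ : Fin n → ℕ => ℂ) 1 :=
  ellOneOp (fun b => ellOneBasis (b + a)) 1 fun _ => (norm_ellOneBasis _).le

lemma norm_ellOneShift_le (a : Fin n → ℕ) (h : lp (fun _ : Fin n → ℕ => ℂ) 1) :
    ‖ellOneShift a h‖ ≤ ‖h‖ := by
  have := (ellOneShift a).le_of_opNorm_le (norm_ellOneOp_le _ zero_le_one _) h
  rwa [one_mul] at this

lemma ellOneOp_basis {X : Type*} [NormedAddCommGroup X] [NormedSpace ℂ X] [CompleteSpace X]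
    {σ : Type*} [DecidableEq σ] (v : σ → X) (C : ℝ) (hv : ∀ b, ‖v b‖ ≤ C) (a : σ) :
    ellOneOp v C hv (ellOneBasis a) = v a := by
  rw [ellOneOp_apply, tsum_eq_single a]
  · simp [ellOneBasis]
  · intro b hb
    simp [ellOneBasis, hb]

lemma ellOneEval_shift (hr : ∀ z : Cn n, ‖z‖ < r → ∀ a : Fin n → ℕ, ‖mono a z‖ ≤ expWt s a)
    {z : Cn n} (hz : z ∈ Metric.ball 0 r) (a : Fin n → ℕ) (h : lp (fun _ : Fin n → ℕ => ℂ) 1) :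
    ellOneEval s z (ellOneShift a h) = mono a z / expWt s a * ellOneEval s z h := by
  have h1 := (summable_smul_of_norm_le (fun b => (norm_ellOneBasis (b + a)).le) h)
  rw [ellOneShift, ellOneOp_apply, (ellOneEval s z).map_tsum h1, ellOneEval_apply hr hz h, germ,
    ← tsum_mul_left]
  refine tsum_congr fun b => ?_
  rw [map_smul, ellOneEval_basis hr hz, mono_add, expWt_add, smul_eq_mul]
  push_cast
  ring

lemma continuousOn_ellOneEval
    (hr : ∀ z : Cn n, ‖z‖ < r → ∀ a : Fin n → ℕ, ‖mono a z‖ ≤ expWt s a)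
    (h : lp (fun _ : Fin n → ℕ => ℂ) 1) :
    ContinuousOn (fun z => ellOneEval s z h) (Metric.ball 0 r) := by
  refine (continuousOn_germ (c := fun b => h b / expWt s b) (s := s) ?_ hr).congr
    fun z hz => ellOneEval_apply hr hz h
  refine (ellOne_summable h).congr fun b => ?_
  have := expWt_pos s b
  rw [norm_div, Complex.norm_real, Real.norm_of_nonneg this.le, div_mul_cancel₀ _ this.ne']

lemma summable_div_expWt (h : lp (fun _ : Fin n → ℕ => ℂ) 1) :
    Summable fun b => ‖h b / (expWt s b : ℂ)‖ * expWt s b := by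
  refine (ellOne_summable h).congr fun b => ?_
  have := expWt_pos s b
  rw [norm_div, Complex.norm_real, Real.norm_of_nonneg this.le, div_mul_cancel₀ _ this.ne']

/-- The rescaled coefficients of a power series, as an element of `ℓ¹`. -/
def rescale (s : ℕ) (c : (Fin n → ℕ) → ℂ) (hc : Summable fun b => ‖c b‖ * expWt s b) :
    lp (fun _ : Fin n → ℕ => ℂ) 1 :=
  ⟨fun b => c b * (expWt s b : ℂ), memℓp_one_iff.2 (hc.congr fun b => by
    rw [norm_mul, Complex.norm_real, Real.norm_of_nonneg (expWt_pos s b).le])⟩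

lemma rescale_apply (c : (Fin n → ℕ) → ℂ) (hc : Summable fun b => ‖c b‖ * expWt s b)
    (b : Fin n → ℕ) : rescale s c hc b = c b * (expWt s b : ℂ) := rfl

lemma norm_rescale_sub (c d : (Fin n → ℕ) → ℂ) (hc : Summable fun b => ‖c b‖ * expWt s b)
    (hd : Summable fun b => ‖d b‖ * expWt s b) :
    ‖rescale s c hc - rescale s d hd‖ = ∑' b, ‖c b - d b‖ * expWt s b := by
  rw [ellOne_norm]
  refine tsum_congr fun b => ?_
  rw [lp.coeFn_sub, Pi.sub_apply, rescale_apply, rescale_apply, ← sub_mul, norm_mul,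
    Complex.norm_real, Real.norm_of_nonneg (expWt_pos s b).le]

lemma ellOneEval_rescale
    (hr : ∀ z : Cn n, ‖z‖ < r → ∀ a : Fin n → ℕ, ‖mono a z‖ ≤ expWt s a)
    {z : Cn n} (hz : z ∈ Metric.ball 0 r) (c : (Fin n → ℕ) → ℂ)
    (hc : Summable fun b => ‖c b‖ * expWt s b) :
    ellOneEval s z (rescale s c hc) = germ c z := by
  rw [ellOneEval_apply hr hz]
  congr 1
  ext b
  rw [rescale_apply, mul_div_cancel_right₀]
  exact Complex.ofReal_ne_zero.2 (expWt_pos s b).ne'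

/-- Restriction of an element of `ℓ¹` to a set of indices. -/
def ellOneRestrict {σ : Type*} (E : Set σ) (h : lp (fun _ : σ => ℂ) 1) : lp (fun _ : σ => ℂ) 1 :=
  ⟨E.indicator h, memℓp_one_iff.2 (Summable.of_nonneg_of_le (fun _ => norm_nonneg _)
    (fun _ => norm_indicator_le_norm_self _ _) (ellOne_summable h))⟩

lemma ellOneRestrict_apply {σ : Type*} (E : Set σ) (h : lp (fun _ : σ => ℂ) 1) (b : σ) :
    ellOneRestrict E h b = E.indicator h b := rfl

lemma ellOneRestrict_add_compl {σ : Type*} (E : Set σ) (h : lp (fun _ : σ => ℂ) 1) :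
    ellOneRestrict E h + ellOneRestrict Eᶜ h = h := by
  refine lp.ext ?_
  rw [lp.coeFn_add]
  exact Set.indicator_self_add_compl E _

lemma SqIntNear.congr {W : Cn n → ℝ≥0∞} {F G : Cn n → ℂ} (hr : 0 < r)
    (h : ∀ z ∈ Metric.ball (0 : Cn n) r, F z = G z) (hG : SqIntNear W G) : SqIntNear W F := by
  obtain ⟨U, hU, hUi⟩ := hG
  obtain ⟨ε, hε, hεU⟩ := Metric.mem_nhds_iff.1 (Filter.inter_mem hU (Metric.ball_mem_nhds 0 hr))
  refine ⟨_, Metric.ball_mem_nhds 0 hε, lt_of_le_of_lt ?_ hUi⟩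
  refine (setLIntegral_mono' Metric.isOpen_ball.measurableSet fun z hz => ?_).trans
    (lintegral_mono_set fun z hz => (hεU hz).1)
  rw [h z (hεU hz).2]

lemma SqIntNear.sub {W : Cn n → ℝ≥0∞} (hW : Measurable W) {F G : Cn n → ℂ} (hr : 0 < r)
    (hFc : ContinuousOn F (Metric.ball 0 r)) (hGc : ContinuousOn G (Metric.ball 0 r))
    (hF : SqIntNear W F) (hG : SqIntNear W G) : SqIntNear W (fun z => F z - G z) := by
  refine SqIntNear.of_norm_le_sum hW (M := Finset.univ) (G := fun b : Bool => if b then F else G)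
    (C := 1) hr ?_ ?_ ?_
  · intro i _; cases i <;> simpa
  · intro i _; cases i <;> simpa
  · intro z _
    simpa using norm_sub_le _ _

/-- The germs that are square integrable against `W` form a closed set: a convergent power series
which is a limit of such germs is itself square integrable against `W`. -/
theorem SqIntNear.of_approx {W : Cn n → ℝ≥0∞} (hW : Measurable W) {c : (Fin n → ℕ) → ℂ} {R : ℝ}
    (hR : 0 < R) (hc : Summable fun b => ‖c b‖ * R ^ (∑ j, b j))
    (happ : ∀ ε > 0, ∃ d : (Fin n → ℕ) → ℂ, SqIntNear W (germ d) ∧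
      (Summable fun b => ‖d b‖ * R ^ (∑ j, b j)) ∧
      ∑' b, ‖c b - d b‖ * R ^ (∑ j, b j) ≤ ε) : SqIntNear W (germ c) := by
  classical
  set E := initExps W with hE
  obtain ⟨M, hME, hM⟩ := exists_finset_forall_exists_le E
  have hd : ∀ a ∈ M, ∃ d : (Fin n → ℕ) → ℂ, SqIntNear W (germ d) ∧
      ∃ s₀, ∀ s, s₀ ≤ s → (Summable fun b => ‖d b‖ * expWt s b) ∧
      ∑' b, ‖d b - (Pi.single a 1 : (Fin n → ℕ) → ℂ) b‖ * expWt s b ≤ 2⁻¹ * expWt s a := by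
    intro a ha
    obtain ⟨d, h1, h2, h3, h4⟩ := hME a ha
    exact ⟨d, h2, exists_tsum_expWt_le h1 h3 h4⟩
  choose! d hd1 s₀ hd2 using hd
  obtain ⟨s₁, hs₁⟩ := exists_expWt_le (n := n) hR
  set s := s₁ + ∑ a ∈ M, s₀ a with hs
  have hsR : ∀ b : Fin n → ℕ, expWt s b ≤ R ^ (∑ j, b j) := fun b =>
    (expWt_anti (by omega) b).trans (hs₁ b)
  have hsM : ∀ a ∈ M, s₀ a ≤ s := fun a ha =>
    (Finset.single_le_sum (f := s₀) (fun _ _ => Nat.zero_le _) ha).trans (by omega)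
  obtain ⟨r, hr0, hr⟩ := exists_ball_norm_mono_le n s
  have hwt : ∀ e : (Fin n → ℕ) → ℂ, (Summable fun b => ‖e b‖ * R ^ (∑ j, b j)) →
      Summable fun b => ‖e b‖ * expWt s b := fun e he =>
    Summable.of_nonneg_of_le (fun b => mul_nonneg (norm_nonneg _) (expWt_pos _ _).le)
      (fun b => by gcongr; exact hsR b) he
  -- normalized generators
  have hg : ∀ a ∈ M, ∃ g : lp (fun _ : Fin n → ℕ => ℂ) 1, ‖g - ellOneBasis a‖ ≤ 2⁻¹ ∧
      SqIntNear W (fun z => ellOneEval s z g) := by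
    intro a ha
    obtain ⟨h1, h2⟩ := hd2 a ha s (hsM a ha)
    have hwa := expWt_pos s a
    have hwa' : (expWt s a : ℂ) ≠ 0 := by exact_mod_cast hwa.ne'
    refine ⟨(expWt s a : ℂ)⁻¹ • rescale s (d a) h1, ?_, ?_⟩
    · have h3 : Summable fun b => ‖(Pi.single a 1 : (Fin n → ℕ) → ℂ) b‖ * expWt s b := by
        refine summable_of_ne_finset_zero (s := {a}) fun b hb => ?_
        simp [Pi.single_eq_of_ne (Finset.notMem_singleton.1 hb)]
      have h4 : ellOneBasis a = (expWt s a : ℂ)⁻¹ • rescale s (Pi.single a 1) h3 := by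
        refine lp.ext (funext fun b => ?_)
        rw [lp.coeFn_smul, Pi.smul_apply, rescale_apply]
        by_cases hb : b = a
        · subst hb; simp [ellOneBasis, hwa']
        · simp [ellOneBasis, hb]
      rw [h4, ← smul_sub, norm_smul, norm_rescale_sub, norm_inv, Complex.norm_real,
        Real.norm_of_nonneg hwa.le, inv_mul_le_iff₀ hwa, mul_comm]
      exact h2
    · refine SqIntNear.of_norm_le_sum hW (M := {a}) (G := fun a => germ (d a))
        (C := ‖(expWt s a : ℂ)⁻¹‖) hr0 ?_ ?_ ?_
      · intro i hi
        rw [Finset.mem_singleton.1 hi]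
        exact continuousOn_germ h1 hr
      · intro i hi
        rw [Finset.mem_singleton.1 hi]
        exact hd1 a ha
      · intro z hz
        rw [map_smul, ellOneEval_rescale hr hz, norm_smul, Finset.sum_singleton]
  choose! g hg1 hg2 using hg
  have hM' : ∀ a ∈ E, ∃ b, b ∈ M ∧ b ≤ a := fun a ha => by
    obtain ⟨b, hb, hba⟩ := hM a ha; exact ⟨b, hb, hba⟩
  choose! i hiM hia using hM'
  set v : (Fin n → ℕ) → lp (fun _ : Fin n → ℕ => ℂ) 1 := fun b =>
    if b ∈ E then ellOneShift (b - i b) (g (i b)) else ellOneBasis b with hv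
  have hvE : ∀ b ∈ E, v b = ellOneShift (b - i b) (g (i b)) := fun b hb => if_pos hb
  have hvE' : ∀ b ∉ E, v b = ellOneBasis b := fun b hb => if_neg hb
  have hv1 : ∀ b, ‖ellOneBasis b - v b‖ ≤ 2⁻¹ := by
    intro b
    by_cases hb : b ∈ E
    · have h1 : ellOneBasis b = ellOneShift (b - i b) (ellOneBasis (i b)) := by
        rw [ellOneShift, ellOneOp_basis, add_tsub_cancel_of_le (hia b hb)]
      rw [hvE b hb, h1, ← map_sub]
      refine (norm_ellOneShift_le _ _).trans ?_
      rw [norm_sub_rev]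
      exact hg1 _ (hiM b hb)
    · rw [hvE' b hb, sub_self, norm_zero]
      norm_num
  have hv2 : ∀ b, ‖v b‖ ≤ 2 := by
    intro b
    calc ‖v b‖ = ‖ellOneBasis b - (ellOneBasis b - v b)‖ := by rw [sub_sub_cancel]
      _ ≤ ‖ellOneBasis b‖ + ‖ellOneBasis b - v b‖ := norm_sub_le _ _
      _ ≤ 1 + 2⁻¹ := add_le_add (norm_ellOneBasis b).le (hv1 b)
      _ ≤ 2 := by norm_num
  set S := ellOneOp (fun b => ellOneBasis b - v b) 2⁻¹ hv1 with hS
  have hS1 : ‖S‖ < 1 := (norm_ellOneOp_le _ (by norm_num) _).trans_lt (by norm_num)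
  have hT : ∀ h, ellOneOp v 2 hv2 h = (1 - S) h := by
    intro h
    have h1 := summable_smul_of_norm_le (fun b => (norm_ellOneBasis b).le) h
    have h2 := summable_smul_of_norm_le hv2 h
    rw [sub_apply, hS, ellOneOp_apply, ellOneOp_apply]
    simp_rw [smul_sub]
    rw [h1.tsum_sub h2, tsum_smul_ellOneBasis]
    simp
  set u := Units.oneSub S hS1
  set Q : lp (fun _ : Fin n → ℕ => ℂ) 1 →L[ℂ] lp (fun _ : Fin n → ℕ => ℂ) 1 := ↑u⁻¹ with hQ
  have hTQ : ∀ h, ellOneOp v 2 hv2 (Q h) = h := by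
    intro h
    rw [hT]
    have h1 : (u : lp (fun _ : Fin n → ℕ => ℂ) 1 →L[ℂ] lp (fun _ : Fin n → ℕ => ℂ) 1) * ↑u⁻¹ = 1 :=
      u.mul_inv
    exact congrArg (fun T : lp (fun _ : Fin n → ℕ => ℂ) 1 →L[ℂ] _ => T h) h1
  -- combinations of the generators are square integrable
  have hcomb : ∀ q, SqIntNear W (fun z => ellOneEval s z (ellOneOp v 2 hv2 (ellOneRestrict E q))) := by
    intro q
    refine SqIntNear.of_norm_le_sum hW (M := M) (G := fun a z => ellOneEval s z (g a)) (C := ‖q‖)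
      hr0 (fun a _ => continuousOn_ellOneEval hr _) hg2 fun z hz => ?_
    have h1 := summable_smul_of_norm_le hv2 (ellOneRestrict E q)
    rw [ellOneOp_apply, (ellOneEval s z).map_tsum h1, ellOne_norm, ← tsum_mul_right]
    refine tsum_of_norm_bounded ((ellOne_summable q).mul_right _).hasSum fun b => ?_
    rw [map_smul, norm_smul, ellOneRestrict_apply]
    by_cases hb : b ∈ E
    · rw [Set.indicator_of_mem hb, hvE b hb, ellOneEval_shift hr hz, norm_mul]
      gcongr
      have hw := expWt_pos s (b - i b)
      have h3 : ‖mono (b - i b) z / (expWt s (b - i b) : ℂ)‖ ≤ 1 := by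
        rw [norm_div, Complex.norm_real, Real.norm_of_nonneg hw.le, div_le_one hw]
        exact hr z (by simpa using hz) _
      calc _ ≤ 1 * ‖ellOneEval s z (g (i b))‖ := by gcongr
        _ = ‖ellOneEval s z (g (i b))‖ := one_mul _
        _ ≤ _ := Finset.single_le_sum (f := fun a => ‖ellOneEval s z (g a)‖)
          (fun _ _ => norm_nonneg _) (hiM b hb)
    · rw [Set.indicator_of_notMem hb, norm_zero, zero_mul]
      positivity
  have hsplit : ∀ q, ellOneOp v 2 hv2 q =
      ellOneOp v 2 hv2 (ellOneRestrict E q) + ellOneRestrict Eᶜ q := by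
    intro q
    conv_lhs => rw [← ellOneRestrict_add_compl E q, map_add]
    congr 1
    rw [ellOneOp_apply]
    conv_rhs => rw [← tsum_smul_ellOneBasis (ellOneRestrict Eᶜ q)]
    refine tsum_congr fun b => ?_
    by_cases hb : b ∈ E
    · simp [ellOneRestrict_apply, hb]
    · rw [hvE' b hb]
  -- the remainder of a square integrable germ vanishes
  have hrem : ∀ h, SqIntNear W (fun z => ellOneEval s z h) → ellOneRestrict Eᶜ (Q h) = 0 := by
    intro h hh
    by_contra hne
    set ρ := ellOneRestrict Eᶜ (Q h) with hρ
    have hρi : SqIntNear W (fun z => ellOneEval s z ρ) := by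
      refine (SqIntNear.sub hW hr0 (continuousOn_ellOneEval hr _) (continuousOn_ellOneEval hr _)
        hh (hcomb (Q h))).congr hr0 fun z _ => ?_
      have h1 := hsplit (Q h)
      rw [hTQ] at h1
      rw [← map_sub]
      congr 1
      exact eq_sub_of_add_eq' h1.symm
    have hex : ∃ k, ∃ b, ρ b ≠ 0 ∧ expNum b = k := by
      by_contra! hcon
      refine hne (lp.ext (funext fun b => ?_))
      by_contra hb
      exact hcon (expNum b) b hb rfl
    obtain ⟨b, hb, hbk⟩ := Nat.find_spec hex
    have hmin : ∀ b', expNum b' < expNum b → ρ b' = 0 := by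
      intro b' hb'
      by_contra h0
      rw [hbk] at hb'
      exact Nat.find_min hex hb' ⟨b', h0, rfl⟩
    have hwb : (expWt s b : ℂ) ≠ 0 := by exact_mod_cast (expWt_pos s b).ne'
    set κ := ρ b / (expWt s b : ℂ) with hκ
    have hκ0 : κ ≠ 0 := div_ne_zero hb hwb
    have hbE : b ∈ E := by
      refine ⟨fun b' => κ⁻¹ * (ρ b' / (expWt s b' : ℂ)), ⟨s, ?_⟩, ?_, ?_, ?_⟩
      · refine ((summable_div_expWt (s := s) ρ).mul_left ‖κ⁻¹‖).congr fun b' => ?_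
        rw [norm_mul κ⁻¹]; ring
      · refine SqIntNear.of_norm_le_sum hW (M := {()}) (G := fun _ z => ellOneEval s z ρ)
          (C := ‖κ⁻¹‖) hr0 (fun _ _ => continuousOn_ellOneEval hr _) (fun _ _ => hρi) ?_
        intro z hz
        rw [Finset.sum_singleton, ellOneEval_apply hr hz, ← norm_mul]
        simp_rw [germ, mul_assoc, tsum_mul_left]
        exact le_rfl
      · exact inv_mul_cancel₀ hκ0
      · intro b' hb'
        simp [hmin b' hb']
    refine hb ?_
    rw [hρ, ellOneRestrict_apply, Set.indicator_of_notMem (by simpa using hbE)]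
  set cS := rescale s c (hwt c hc) with hcS
  have hzero : ellOneRestrict Eᶜ (Q cS) = 0 := by
    refine lp.ext (funext fun b => ?_)
    rw [ellOneRestrict_apply]
    by_cases hb : b ∈ Eᶜ
    swap
    · rw [Set.indicator_of_notMem hb]; rfl
    rw [Set.indicator_of_mem hb]
    change _ = (0 : ℂ)
    rw [← norm_le_zero_iff]
    refine le_of_forall_pos_le_add fun ε hε => ?_
    obtain ⟨e, he1, he2, he3⟩ := happ (ε / (‖Q‖ + 1)) (by positivity)
    set eS := rescale s e (hwt e he2)
    have h1 := hrem eS (he1.congr hr0 fun z hz => ellOneEval_rescale hr hz _ _)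
    have h2 : Q eS b = 0 := by
      have := congrArg (fun f : lp (fun _ : Fin n → ℕ => ℂ) 1 => f b) h1
      simpa [ellOneRestrict_apply, Set.indicator_of_mem hb] using this
    have hsub : Summable fun b => ‖c b - e b‖ * R ^ (∑ j, b j) := by
      refine Summable.of_nonneg_of_le (fun b => by positivity) (fun b => ?_) (hc.add he2)
      rw [← add_mul]
      gcongr
      exact norm_sub_le _ _
    have h3 : ‖cS - eS‖ ≤ ε / (‖Q‖ + 1) := by
      rw [norm_rescale_sub]
      refine le_trans (Summable.tsum_le_tsum (fun b => ?_) (hwt (fun b => c b - e b) hsub) hsub) he3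
      gcongr
      exact hsR b
    calc ‖Q cS b‖ = ‖(Q (cS - eS)) b‖ := by
          rw [map_sub, lp.coeFn_sub, Pi.sub_apply, h2, sub_zero]
      _ ≤ ‖Q (cS - eS)‖ := lp.norm_apply_le_norm one_ne_zero _ _
      _ ≤ ‖Q‖ * (ε / (‖Q‖ + 1)) := (Q.le_opNorm _).trans (by gcongr)
      _ ≤ (‖Q‖ + 1) * (ε / (‖Q‖ + 1)) := by gcongr; linarith
      _ = 0 + ε := by rw [mul_div_cancel₀ _ (by positivity), zero_add]
  refine (hcomb (Q cS)).congr hr0 fun z hz => ?_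
  have h1 := hsplit (Q cS)
  rw [hzero, add_zero, hTQ] at h1
  rw [← h1, ellOneEval_rescale hr hz]

end Division

/-! ### Wirtinger derivatives -/

section Wirtinger

open scoped ComplexConjugate

/-- The Wirtinger derivative `∂/∂zⱼ`. -/
def dz (j : Fin n) (a : Cn n → ℂ) (z : Cn n) : ℂ :=
  (fderiv ℝ a z (Pi.single j 1) - Complex.I * fderiv ℝ a z (Pi.single j Complex.I)) / 2

/-- The Wirtinger derivative `∂/∂z̄ⱼ`. -/
def dzb (j : Fin n) (a : Cn n → ℂ) (z : Cn n) : ℂ :=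
  (fderiv ℝ a z (Pi.single j 1) + Complex.I * fderiv ℝ a z (Pi.single j Complex.I)) / 2

/-- Smooth compactly supported functions. -/
structure IsTest (a : Cn n → ℂ) : Prop where
  smooth : ContDiff ℝ ∞ a
  supp : HasCompactSupport a

variable {a b : Cn n → ℂ} {j k : Fin n} {z : Cn n}

lemma contDiff_fderiv_apply_vec (ha : ContDiff ℝ ∞ a) (v : Cn n) :
    ContDiff ℝ ∞ fun z => fderiv ℝ a z v :=
  (ha.fderiv_right (m := ∞) (by simp)).clm_apply contDiff_const

lemma contDiff_dz (ha : ContDiff ℝ ∞ a) (j : Fin n) : ContDiff ℝ ∞ (dz j a) :=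
  ((contDiff_fderiv_apply_vec ha _).sub
    (contDiff_const.mul (contDiff_fderiv_apply_vec ha _))).div_const _

lemma contDiff_dzb (ha : ContDiff ℝ ∞ a) (j : Fin n) : ContDiff ℝ ∞ (dzb j a) :=
  ((contDiff_fderiv_apply_vec ha _).add
    (contDiff_const.mul (contDiff_fderiv_apply_vec ha _))).div_const _

lemma ContDiff.differentiableAt_top (ha : ContDiff ℝ ∞ a) : DifferentiableAt ℝ a z :=
  ha.differentiable (by simp) z

lemma contDiff_conj (ha : ContDiff ℝ ∞ a) : ContDiff ℝ ∞ fun z => conj (a z) :=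
  Complex.conjCLE.contDiff.comp ha

namespace IsTest

lemma continuous (ha : IsTest a) : Continuous a := ha.smooth.continuous

lemma integrable (ha : IsTest a) : Integrable a :=
  ha.continuous.integrable_of_hasCompactSupport ha.supp

lemma dz (ha : IsTest a) (j : Fin n) : IsTest (dz j a) := by
  refine ⟨contDiff_dz ha.smooth j, ?_⟩
  refine HasCompactSupport.intro' (K := tsupport (fderiv ℝ a)) (ha.supp.fderiv ℝ)
    (isClosed_tsupport _) fun z hz => ?_
  simp [_root_.dz, image_eq_zero_of_notMem_tsupport hz]

lemma dzb (ha : IsTest a) (j : Fin n) : IsTest (dzb j a) := by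
  refine ⟨contDiff_dzb ha.smooth j, ?_⟩
  refine HasCompactSupport.intro' (K := tsupport (fderiv ℝ a)) (ha.supp.fderiv ℝ)
    (isClosed_tsupport _) fun z hz => ?_
  simp [_root_.dzb, image_eq_zero_of_notMem_tsupport hz]

lemma mul_right (ha : IsTest a) (hb : ContDiff ℝ ∞ b) : IsTest fun z => a z * b z :=
  ⟨ha.smooth.mul hb, ha.supp.mul_right⟩

lemma mul_left (hb : IsTest b) (ha : ContDiff ℝ ∞ a) : IsTest fun z => a z * b z :=
  ⟨ha.mul hb.smooth, hb.supp.mul_left⟩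

lemma conjugate (ha : IsTest a) : IsTest fun z => conj (a z) :=
  ⟨contDiff_conj ha.smooth, ha.supp.comp_left (map_zero _)⟩

lemma add (ha : IsTest a) (hb : IsTest b) : IsTest fun z => a z + b z :=
  ⟨ha.smooth.add hb.smooth, ha.supp.add hb.supp⟩

lemma neg (ha : IsTest a) : IsTest fun z => - a z :=
  ⟨ha.smooth.neg, ha.supp.neg⟩

lemma sub (ha : IsTest a) (hb : IsTest b) : IsTest fun z => a z - b z := by
  simpa [sub_eq_add_neg] using ha.add hb.neg

lemma zero : IsTest (fun _ : Cn n => (0 : ℂ)) :=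
  ⟨contDiff_const, HasCompactSupport.zero⟩

lemma sum {ι : Type*} (s : Finset ι) {f : ι → Cn n → ℂ} (hf : ∀ i ∈ s, IsTest (f i)) :
    IsTest fun z => ∑ i ∈ s, f i z := by
  classical
  induction s using Finset.induction_on with
  | empty => simpa using zero
  | insert i s hi ih =>
    simp_rw [Finset.sum_insert hi]
    exact (hf i (Finset.mem_insert_self _ _)).add
      (ih fun k hk => hf k (Finset.mem_insert_of_mem hk))

end IsTest

lemma dz_mul (ha : DifferentiableAt ℝ a z) (hb : DifferentiableAt ℝ b z) :
    dz j (fun z => a z * b z) z = dz j a z * b z + a z * dz j b z := by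
  have h := fderiv_mul ha hb
  change fderiv ℝ (fun z => a z * b z) z = _ at h
  simp only [dz, h, add_apply, smul_apply, smul_eq_mul]
  ring

lemma dzb_mul (ha : DifferentiableAt ℝ a z) (hb : DifferentiableAt ℝ b z) :
    dzb j (fun z => a z * b z) z = dzb j a z * b z + a z * dzb j b z := by
  have h := fderiv_mul ha hb
  change fderiv ℝ (fun z => a z * b z) z = _ at h
  simp only [dzb, h, add_apply, smul_apply, smul_eq_mul]
  ring

lemma dzb_sub (ha : DifferentiableAt ℝ a z) (hb : DifferentiableAt ℝ b z) :
    dzb j (fun z => a z - b z) z = dzb j a z - dzb j b z := by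
  have h := fderiv_sub ha hb
  change fderiv ℝ (fun z => a z - b z) z = _ at h
  simp only [dzb, h, sub_apply]
  ring

lemma fderiv_conj_apply (ha : DifferentiableAt ℝ a z) (v : Cn n) :
    fderiv ℝ (fun z => conj (a z)) z v = conj (fderiv ℝ a z v) := by
  have h := (Complex.conjCLE.toContinuousLinearMap.hasFDerivAt.comp z ha.hasFDerivAt).fderiv
  change fderiv ℝ (fun z => conj (a z)) z = _ at h
  rw [h]
  rfl

lemma dz_conj (ha : DifferentiableAt ℝ a z) :
    dz j (fun z => conj (a z)) z = conj (dzb j a z) := by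
  simp [dz, dzb, fderiv_conj_apply ha, sub_eq_add_neg, Complex.conj_ofNat]

lemma dzb_conj (ha : DifferentiableAt ℝ a z) :
    dzb j (fun z => conj (a z)) z = conj (dz j a z) := by
  simp [dz, dzb, fderiv_conj_apply ha, sub_eq_add_neg, Complex.conj_ofNat]

lemma fderiv_fderiv_apply_comm (ha : ContDiff ℝ ∞ a) (v w : Cn n) :
    fderiv ℝ (fun z => fderiv ℝ a z v) z w = fderiv ℝ (fun z => fderiv ℝ a z w) z v := by
  have hd : DifferentiableAt ℝ (fderiv ℝ a) z :=
    (ha.fderiv_right (m := ∞) (by simp)).differentiable (by simp) z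
  have h1 : ∀ v w : Cn n, fderiv ℝ (fun z => fderiv ℝ a z v) z w
      = fderiv ℝ (fderiv ℝ a) z w v := by
    intro v w
    rw [fderiv_clm_apply hd (differentiableAt_const v)]
    simp
  rw [h1, h1]
  exact (ha.contDiffAt.isSymmSndFDerivAt (by simp; exact WithTop.coe_le_coe.2 (le_top : (2 : ℕ∞) ≤ ⊤))).eq w v

lemma fderiv_dz_apply (ha : ContDiff ℝ ∞ a) (w : Cn n) :
    fderiv ℝ (dz j a) z w = (fderiv ℝ (fun z => fderiv ℝ a z (Pi.single j 1)) z w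
      - Complex.I * fderiv ℝ (fun z => fderiv ℝ a z (Pi.single j Complex.I)) z w) / 2 := by
  have h1 := (contDiff_fderiv_apply_vec ha (Pi.single j 1)).differentiableAt_top (z := z)
  have h2 := (contDiff_fderiv_apply_vec ha (Pi.single j Complex.I)).differentiableAt_top (z := z)
  have h := ((h1.hasFDerivAt.sub (h2.hasFDerivAt.const_mul Complex.I)).mul_const (2 : ℂ)⁻¹).fderiv
  have he : dz j a = fun y => (fderiv ℝ a y (Pi.single j 1)
      - Complex.I * fderiv ℝ a y (Pi.single j Complex.I)) * 2⁻¹ := by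
    ext y; simp [dz, div_eq_mul_inv]
  rw [he]
  erw [h]
  simp
  ring

lemma fderiv_dzb_apply (ha : ContDiff ℝ ∞ a) (w : Cn n) :
    fderiv ℝ (dzb j a) z w = (fderiv ℝ (fun z => fderiv ℝ a z (Pi.single j 1)) z w
      + Complex.I * fderiv ℝ (fun z => fderiv ℝ a z (Pi.single j Complex.I)) z w) / 2 := by
  have h1 := (contDiff_fderiv_apply_vec ha (Pi.single j 1)).differentiableAt_top (z := z)
  have h2 := (contDiff_fderiv_apply_vec ha (Pi.single j Complex.I)).differentiableAt_top (z := z)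
  have h := ((h1.hasFDerivAt.add (h2.hasFDerivAt.const_mul Complex.I)).mul_const (2 : ℂ)⁻¹).fderiv
  have he : dzb j a = fun y => (fderiv ℝ a y (Pi.single j 1)
      + Complex.I * fderiv ℝ a y (Pi.single j Complex.I)) * 2⁻¹ := by
    ext y; simp [dzb, div_eq_mul_inv]
  rw [he]
  erw [h]
  simp
  ring

lemma dzb_dz_comm (ha : ContDiff ℝ ∞ a) : dzb k (dz j a) z = dz j (dzb k a) z := by
  rw [dzb, dz, fderiv_dz_apply ha, fderiv_dz_apply ha, fderiv_dzb_apply ha, fderiv_dzb_apply ha,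
    fderiv_fderiv_apply_comm ha (Pi.single j 1) (Pi.single k 1),
    fderiv_fderiv_apply_comm ha (Pi.single j 1) (Pi.single k Complex.I),
    fderiv_fderiv_apply_comm ha (Pi.single j Complex.I) (Pi.single k 1),
    fderiv_fderiv_apply_comm ha (Pi.single j Complex.I) (Pi.single k Complex.I)]
  ring

lemma dzb_dzb_comm (ha : ContDiff ℝ ∞ a) : dzb k (dzb j a) z = dzb j (dzb k a) z := by
  rw [dzb, dzb, fderiv_dzb_apply ha, fderiv_dzb_apply ha, fderiv_dzb_apply ha, fderiv_dzb_apply ha,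
    fderiv_fderiv_apply_comm ha (Pi.single j 1) (Pi.single k 1),
    fderiv_fderiv_apply_comm ha (Pi.single j 1) (Pi.single k Complex.I),
    fderiv_fderiv_apply_comm ha (Pi.single j Complex.I) (Pi.single k 1),
    fderiv_fderiv_apply_comm ha (Pi.single j Complex.I) (Pi.single k Complex.I)]
  ring

lemma IsTest.integral_fderiv_eq_zero (ha : IsTest a) (v : Cn n) : ∫ z, fderiv ℝ a z v = 0 := by
  have hi : Integrable fun z => fderiv ℝ a z v :=
    (contDiff_fderiv_apply_vec ha.smooth v).continuous.integrable_of_hasCompactSupport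
      (HasCompactSupport.intro' (K := tsupport (fderiv ℝ a)) (ha.supp.fderiv ℝ)
        (isClosed_tsupport _) fun z hz => by simp [image_eq_zero_of_notMem_tsupport hz])
  have h := integral_mul_fderiv_eq_neg_fderiv_mul_of_integrable (μ := volume)
    (f := fun _ : Cn n => (1 : ℂ)) (g := a) (v := v)
    (by simp) (by simpa using hi) (by simpa using ha.integrable)
    (fun _ _ => differentiableAt_const _) (fun _ _ => ha.smooth.differentiableAt_top)
  simpa using h

lemma IsTest.integral_dz_eq_zero (ha : IsTest a) (j : Fin n) : ∫ z, _root_.dz j a z = 0 := by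
  have hi : ∀ v, Integrable fun z => fderiv ℝ a z v := fun v =>
    (contDiff_fderiv_apply_vec ha.smooth v).continuous.integrable_of_hasCompactSupport
      (HasCompactSupport.intro' (K := tsupport (fderiv ℝ a)) (ha.supp.fderiv ℝ)
        (isClosed_tsupport _) fun z hz => by simp [image_eq_zero_of_notMem_tsupport hz])
  simp_rw [_root_.dz, div_eq_mul_inv]
  rw [integral_mul_const, integral_sub (hi _) ((hi _).const_mul _), integral_const_mul,
    ha.integral_fderiv_eq_zero, ha.integral_fderiv_eq_zero]
  simp

end Wirtinger

/-! ### The weighted identity of Bochner–Kodaira type -/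

section Weighted

open scoped ComplexConjugate

/-- The measure `e^{-Ψ} dV`. -/
def wt (Ψ : Cn n → ℝ) : Measure (Cn n) :=
  volume.withDensity fun z => ENNReal.ofReal (Real.exp (-Ψ z))

/-- The complex valued derivative `∂Ψ/∂zⱼ`. -/
def dPsi (Ψ : Cn n → ℝ) (j : Fin n) : Cn n → ℂ := dz j fun z => (Ψ z : ℂ)

/-- The twisted derivative `∂/∂zⱼ - ∂Ψ/∂zⱼ`. -/
def dl (Ψ : Cn n → ℝ) (j : Fin n) (a : Cn n → ℂ) (z : Cn n) : ℂ := dz j a z - dPsi Ψ j z * a z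

/-- The formal adjoint of `∂̄` in `L²(e^{-Ψ})`. -/
def theta (Ψ : Cn n → ℝ) (α : Fin n → Cn n → ℂ) (z : Cn n) : ℂ := -∑ j, dl Ψ j (α j) z

/-- The Levi form of `Ψ`. -/
def levi (Ψ : Cn n → ℝ) (z : Cn n) (α : Fin n → ℂ) : ℝ :=
  (∑ j, ∑ k, dzb k (dPsi Ψ j) z * α j * conj (α k)).re

variable {Ψ : Cn n → ℝ} {a b : Cn n → ℂ} {j k : Fin n}

lemma contDiff_ofReal (hΨ : ContDiff ℝ ∞ Ψ) : ContDiff ℝ ∞ fun z => (Ψ z : ℂ) :=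
  Complex.ofRealCLM.contDiff.comp hΨ

lemma contDiff_dPsi (hΨ : ContDiff ℝ ∞ Ψ) (j : Fin n) : ContDiff ℝ ∞ (dPsi Ψ j) :=
  contDiff_dz (contDiff_ofReal hΨ) j

lemma contDiff_dl (hΨ : ContDiff ℝ ∞ Ψ) (ha : ContDiff ℝ ∞ a) (j : Fin n) :
    ContDiff ℝ ∞ (dl Ψ j a) :=
  (contDiff_dz ha j).sub ((contDiff_dPsi hΨ j).mul ha)

lemma IsTest.dl (hΨ : ContDiff ℝ ∞ Ψ) (ha : IsTest a) (j : Fin n) : IsTest (dl Ψ j a) :=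
  (ha.dz j).sub (ha.mul_left (contDiff_dPsi hΨ j))

lemma IsTest.theta (hΨ : ContDiff ℝ ∞ Ψ) {α : Fin n → Cn n → ℂ} (hα : ∀ j, IsTest (α j)) :
    IsTest (theta Ψ α) :=
  (IsTest.sum Finset.univ fun j _ => (hα j).dl hΨ j).neg

lemma continuous_wt_density (hΨ : Continuous Ψ) : Continuous fun z => Real.exp (-Ψ z) :=
  Real.continuous_exp.comp hΨ.neg

lemma integral_wt (hΨ : Continuous Ψ) (f : Cn n → ℂ) :
    ∫ z, f z ∂(wt Ψ) = ∫ z, (Real.exp (-Ψ z) : ℂ) * f z := by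
  have hm : Measurable fun z => Real.toNNReal (Real.exp (-Ψ z)) :=
    (continuous_wt_density hΨ).measurable.real_toNNReal
  rw [wt]
  erw [integral_withDensity_eq_integral_smul hm]
  refine integral_congr_ae (Eventually.of_forall fun z => ?_)
  simp [NNReal.smul_def, Real.exp_nonneg]

lemma isLocallyFinite_wt (hΨ : Continuous Ψ) : IsLocallyFiniteMeasure (wt Ψ) :=
  IsLocallyFiniteMeasure.withDensity_ofReal (continuous_wt_density hΨ)

lemma Continuous.integrable_wt {E : Type*} [NormedAddCommGroup E] {f : Cn n → E}
    (hf : Continuous f) (hΨ : Continuous Ψ)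
    (hc : HasCompactSupport f) : Integrable f (wt Ψ) :=
  haveI := isLocallyFinite_wt hΨ
  hf.integrable_of_hasCompactSupport hc

lemma IsTest.integrable_wt (ha : IsTest a) (hΨ : Continuous Ψ) : Integrable a (wt Ψ) :=
  ha.continuous.integrable_wt hΨ ha.supp

lemma fderiv_exp_neg (hΨ : ContDiff ℝ ∞ Ψ) (z v : Cn n) (s : ℝ) :
    fderiv ℝ (fun z => ((Real.exp (s * Ψ z) : ℝ) : ℂ)) z v
      = s * fderiv ℝ (fun z => (Ψ z : ℂ)) z v * (Real.exp (s * Ψ z) : ℂ) := by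
  have hd := hΨ.differentiable (by simp) z
  have h1 := (Complex.ofRealCLM.hasFDerivAt.comp z (hd.hasFDerivAt.const_mul s).exp).fderiv
  have h2 := (Complex.ofRealCLM.hasFDerivAt.comp z hd.hasFDerivAt).fderiv
  change fderiv ℝ (fun z => ((Real.exp (s * Ψ z) : ℝ) : ℂ)) z = _ at h1
  change fderiv ℝ (fun z => ((Ψ z : ℝ) : ℂ)) z = _ at h2
  rw [h1, h2]
  simp
  ring

lemma contDiff_exp_mul (hΨ : ContDiff ℝ ∞ Ψ) (s : ℝ) :
    ContDiff ℝ ∞ fun z => ((Real.exp (s * Ψ z) : ℝ) : ℂ) :=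
  contDiff_ofReal (contDiff_const.mul hΨ).exp

lemma dz_exp_mul (hΨ : ContDiff ℝ ∞ Ψ) (z : Cn n) (s : ℝ) :
    dz j (fun z => ((Real.exp (s * Ψ z) : ℝ) : ℂ)) z
      = s * dPsi Ψ j z * (Real.exp (s * Ψ z) : ℂ) := by
  simp only [dz, dPsi, fderiv_exp_neg hΨ]
  ring

lemma integral_dl_mul_conj (hΨ : ContDiff ℝ ∞ Ψ) (ha : IsTest a) (hb : ContDiff ℝ ∞ b)
    (j : Fin n) :
    ∫ z, dl Ψ j a z * conj (b z) ∂(wt Ψ) = -∫ z, a z * conj (dzb j b z) ∂(wt Ψ) := by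
  have hc := hΨ.continuous
  have he := contDiff_exp_mul hΨ (-1)
  have ht : IsTest fun z => (a z * conj (b z)) * ((Real.exp ((-1) * Ψ z) : ℝ) : ℂ) :=
    (ha.mul_right (contDiff_conj hb)).mul_right he
  have h := ht.integral_dz_eq_zero j
  have hi1 : Integrable (fun z => dl Ψ j a z * conj (b z)) (wt Ψ) :=
    ((ha.dl hΨ j).mul_right (contDiff_conj hb)).integrable_wt hc
  have hi2 : Integrable (fun z => a z * conj (dzb j b z)) (wt Ψ) :=
    (ha.mul_right (contDiff_conj (contDiff_dzb hb j))).integrable_wt hc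
  rw [← add_eq_zero_iff_eq_neg, ← integral_add hi1 hi2, integral_wt hc, ← h]
  refine integral_congr_ae (Eventually.of_forall fun z => ?_)
  have hda := ha.smooth.differentiableAt_top (z := z)
  have hdb := (contDiff_conj hb).differentiableAt_top (z := z)
  have hde := he.differentiableAt_top (z := z)
  simp only
  rw [dz_mul (hda.fun_mul hdb) hde, dz_mul hda hdb, dz_exp_mul hΨ, dz_conj hb.differentiableAt_top]
  simp [dl]
  ring

lemma integral_mul_conj_dl (hΨ : ContDiff ℝ ∞ Ψ) (ha : ContDiff ℝ ∞ a) (hb : IsTest b)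
    (j : Fin n) :
    ∫ z, a z * conj (dl Ψ j b z) ∂(wt Ψ) = -∫ z, dzb j a z * conj (b z) ∂(wt Ψ) := by
  have h := congrArg conj (integral_dl_mul_conj hΨ hb ha j)
  rw [map_neg, ← integral_conj, ← integral_conj] at h
  simpa [mul_comm] using h

lemma dzb_dl (hΨ : ContDiff ℝ ∞ Ψ) (ha : ContDiff ℝ ∞ a) (z : Cn n) :
    dzb j (dl Ψ k a) z = dl Ψ k (dzb j a) z - dzb j (dPsi Ψ k) z * a z := by
  have h1 := (contDiff_dz ha k).differentiableAt_top (z := z)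
  have h2 := (contDiff_dPsi hΨ k).differentiableAt_top (z := z)
  have h3 := ha.differentiableAt_top (z := z)
  have : dl Ψ k a = fun z => dz k a z - dPsi Ψ k z * a z := rfl
  rw [this, dzb_sub h1 (h2.fun_mul h3), dzb_mul h2 h3, dzb_dz_comm ha, dl]
  ring

lemma integral_dl_mul_conj_dl (hΨ : ContDiff ℝ ∞ Ψ) (ha : IsTest a) (hb : IsTest b) :
    ∫ z, dl Ψ j a z * conj (dl Ψ k b z) ∂(wt Ψ)
      = (∫ z, dzb k a z * conj (dzb j b z) ∂(wt Ψ))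
        + ∫ z, a z * conj (dzb j (dPsi Ψ k) z * b z) ∂(wt Ψ) := by
  have hc := hΨ.continuous
  rw [integral_dl_mul_conj hΨ ha (contDiff_dl hΨ hb.smooth k)]
  simp_rw [dzb_dl hΨ hb.smooth, map_sub, mul_sub]
  have hi1 : Integrable (fun z => a z * conj (dl Ψ k (dzb j b) z)) (wt Ψ) :=
    (ha.mul_right (contDiff_conj (contDiff_dl hΨ (contDiff_dzb hb.smooth j) k))).integrable_wt hc
  have hi2 : Integrable (fun z => a z * conj (dzb j (dPsi Ψ k) z * b z)) (wt Ψ) :=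
    (ha.mul_right (contDiff_conj
      ((contDiff_dzb (contDiff_dPsi hΨ k) j).mul hb.smooth))).integrable_wt hc
  rw [integral_sub hi1 hi2, integral_mul_conj_dl hΨ ha.smooth (hb.dzb j)]
  ring

/-- The Bochner–Kodaira identity in `ℂⁿ` for smooth compactly supported `(0,1)`-forms. -/
lemma integral_norm_theta_sq (hΨ : ContDiff ℝ ∞ Ψ) {α : Fin n → Cn n → ℂ}
    (hα : ∀ j, IsTest (α j)) :
    ∫ z, ‖theta Ψ α z‖ ^ 2 ∂(wt Ψ)
      = (∫ z, (∑ j, ∑ k, dzb k (α j) z * conj (dzb j (α k) z)).re ∂(wt Ψ))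
        + ∫ z, levi Ψ z (fun j => α j z) ∂(wt Ψ) := by
  have hc := hΨ.continuous
  have hi1 : ∀ j k, Integrable (fun z => dl Ψ j (α j) z * conj (dl Ψ k (α k) z)) (wt Ψ) :=
    fun j k => (((hα j).dl hΨ j).mul_right
      (contDiff_conj (contDiff_dl hΨ (hα k).smooth k))).integrable_wt hc
  have hi2 : ∀ j k, Integrable (fun z => dzb k (α j) z * conj (dzb j (α k) z)) (wt Ψ) :=
    fun j k => (((hα j).dzb k).mul_right
      (contDiff_conj (contDiff_dzb (hα k).smooth j))).integrable_wt hc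
  have hi3 : ∀ j k, Integrable
      (fun z => α j z * conj (dzb j (dPsi Ψ k) z * α k z)) (wt Ψ) :=
    fun j k => ((hα j).mul_right (contDiff_conj
      ((contDiff_dzb (contDiff_dPsi hΨ k) j).mul (hα k).smooth))).integrable_wt hc
  have hs2 : Integrable (fun z => ∑ j, ∑ k, dzb k (α j) z * conj (dzb j (α k) z)) (wt Ψ) :=
    integrable_finsetSum _ fun j _ => integrable_finsetSum _ fun k _ => hi2 j k
  have hs3 : Integrable
      (fun z => ∑ j, ∑ k, α j z * conj (dzb j (dPsi Ψ k) z * α k z)) (wt Ψ) :=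
    integrable_finsetSum _ fun j _ => integrable_finsetSum _ fun k _ => hi3 j k
  have h1 : (fun z => ‖theta Ψ α z‖ ^ 2)
      = fun z => (∑ j, ∑ k, dl Ψ j (α j) z * conj (dl Ψ k (α k) z)).re := by
    ext z
    have : ∑ j, ∑ k, dl Ψ j (α j) z * conj (dl Ψ k (α k) z) = theta Ψ α z * conj (theta Ψ α z) := by
      simp [theta, Finset.sum_mul_sum]
    rw [this, Complex.mul_conj']
    norm_cast
  have h3 : (fun z => levi Ψ z (fun j => α j z))
      = fun z => (∑ j, ∑ k, α j z * conj (dzb j (dPsi Ψ k) z * α k z)).re := by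
    ext z
    rw [levi, ← Complex.conj_re, Finset.sum_comm]
    simp only [map_sum, map_mul, Complex.conj_conj]
    congr 1
    refine Finset.sum_congr rfl fun j _ => Finset.sum_congr rfl fun k _ => ?_
    ring
  rw [h1, h3]
  have hre : ∀ f : Cn n → ℂ, Integrable f (wt Ψ) →
      ∫ z, (f z).re ∂(wt Ψ) = (∫ z, f z ∂(wt Ψ)).re := fun f hf => integral_re hf
  rw [hre _ (integrable_finsetSum _ fun j _ => integrable_finsetSum _ fun k _ => hi1 j k),
    hre _ hs2, hre _ hs3, ← Complex.add_re]
  congr 1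
  rw [integral_finsetSum _ fun j _ => integrable_finsetSum _ fun k _ => hi1 j k,
    integral_finsetSum _ fun j _ => integrable_finsetSum _ fun k _ => hi2 j k,
    integral_finsetSum _ fun j _ => integrable_finsetSum _ fun k _ => hi3 j k,
    ← Finset.sum_add_distrib]
  refine Finset.sum_congr rfl fun j _ => ?_
  rw [integral_finsetSum _ fun k _ => hi1 j k, integral_finsetSum _ fun k _ => hi2 j k,
    integral_finsetSum _ fun k _ => hi3 j k, ← Finset.sum_add_distrib]
  exact Finset.sum_congr rfl fun k _ => integral_dl_mul_conj_dl hΨ (hα j) (hα k)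

lemma neg_re_sum_mul_conj_le (x : Fin n → Fin n → ℂ) :
    -(∑ j, ∑ k, x k j * conj (x j k)).re ≤ ∑ j, ∑ k, ‖x j k - x k j‖ ^ 2 := by
  rw [Complex.re_sum, ← Finset.sum_neg_distrib]
  refine Finset.sum_le_sum fun j _ => ?_
  rw [Complex.re_sum, ← Finset.sum_neg_distrib]
  refine Finset.sum_le_sum fun k _ => ?_
  rw [← Complex.normSq_eq_norm_sq, Complex.normSq_apply]
  simp
  nlinarith [sq_nonneg ((x j k).re + (x k j).re), sq_nonneg ((x j k).im + (x k j).im),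
    sq_nonneg ((x j k).re - (x k j).re), sq_nonneg ((x j k).im - (x k j).im)]

/-- The basic a priori estimate for smooth compactly supported `(0,1)`-forms. -/
lemma apriori_estimate (hΨ : ContDiff ℝ ∞ Ψ) {α β : Fin n → Cn n → ℂ}
    (hα : ∀ j, IsTest (α j)) {b : Cn n → ℝ}
    (hb : Integrable b (wt Ψ))
    (h : ∀ z, ∀ v : Fin n → ℂ, 2 * ‖∑ j, β j z * conj (v j)‖ ≤ b z + levi Ψ z v) :
    2 * ‖∫ z, ∑ j, β j z * conj (α j z) ∂(wt Ψ)‖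
      ≤ (∫ z, b z ∂(wt Ψ)) + (∫ z, ‖theta Ψ α z‖ ^ 2 ∂(wt Ψ))
        + ∫ z, ∑ j, ∑ k, ‖dzb j (α k) z - dzb k (α j) z‖ ^ 2 ∂(wt Ψ) := by
  have hc := hΨ.continuous
  have hi2 : IsTest (fun z => ∑ j, ∑ k, dzb k (α j) z * conj (dzb j (α k) z)) :=
    IsTest.sum _ fun j _ => IsTest.sum _ fun k _ => ((hα j).dzb k).mul_right
      (contDiff_conj (contDiff_dzb (hα k).smooth j))
  have hi3 : IsTest (fun z => ∑ j, ∑ k, dzb k (dPsi Ψ j) z * α j z * conj (α k z)) :=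
    IsTest.sum _ fun j _ => IsTest.sum _ fun k _ =>
      ((hα j).mul_left (contDiff_dzb (contDiff_dPsi hΨ j) k)).mul_right
        (contDiff_conj (hα k).smooth)
  have hi4 : IsTest (fun z => ∑ j, ∑ k, (dzb j (α k) z - dzb k (α j) z)
      * conj (dzb j (α k) z - dzb k (α j) z)) :=
    IsTest.sum _ fun j _ => IsTest.sum _ fun k _ => (((hα k).dzb j).sub ((hα j).dzb k)).mul_right
      (contDiff_conj ((contDiff_dzb (hα k).smooth j).sub (contDiff_dzb (hα j).smooth k)))
  have hl : Integrable (fun z => levi Ψ z (fun j => α j z)) (wt Ψ) := (hi3.integrable_wt hc).re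
  have hr := (hi2.integrable_wt hc).re
  have hq : Integrable (fun z => ∑ j, ∑ k, ‖dzb j (α k) z - dzb k (α j) z‖ ^ 2) (wt Ψ) := by
    refine (hi4.integrable_wt hc).re.congr (Eventually.of_forall fun z => ?_)
    simp only [Complex.mul_conj']
    norm_cast
  have h1 : 2 * ‖∫ z, ∑ j, β j z * conj (α j z) ∂(wt Ψ)‖
      ≤ ∫ z, (b z + levi Ψ z (fun j => α j z)) ∂(wt Ψ) := by
    rw [← le_div_iff₀' two_pos, ← integral_div]
    refine norm_integral_le_of_norm_le ((hb.add hl).div_const 2) (Eventually.of_forall fun z => ?_)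
    rw [le_div_iff₀' two_pos]
    exact h z _
  rw [integral_add hb hl] at h1
  have h2 := integral_norm_theta_sq hΨ hα
  have h3 : -(∫ z, (∑ j, ∑ k, dzb k (α j) z * conj (dzb j (α k) z)).re ∂(wt Ψ))
      ≤ ∫ z, ∑ j, ∑ k, ‖dzb j (α k) z - dzb k (α j) z‖ ^ 2 ∂(wt Ψ) := by
    rw [← integral_neg]
    exact integral_mono hr.neg hq fun z => neg_re_sum_mul_conj_le fun j k => dzb j (α k) z
  linarith

end Weighted

/-! ### Regularisation by convolution -/

section Regularisation

open scoped ComplexConjugate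

/-- Convolution with a kernel. -/
def cv (r f : Cn n → ℂ) (z : Cn n) : ℂ := ∫ ζ, r (z - ζ) * f ζ

variable {r f : Cn n → ℂ} {j k : Fin n} {ρ : Cn n → ℝ} {δ : ℝ}

lemma cv_eq_convolution : cv r f = r ⋆[ContinuousLinearMap.mul ℝ ℂ, volume] f := by
  ext z
  rw [convolution_eq_swap]
  rfl

lemma integrable_cv (hr : IsTest r) (hf : LocallyIntegrable f) (z : Cn n) :
    Integrable fun ζ => r (z - ζ) * f ζ := by
  have h := hr.supp.convolutionExists_left (ContinuousLinearMap.mul ℝ ℂ) hr.continuous hf z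
  exact (convolutionExistsAt_iff_integrable_swap (L := ContinuousLinearMap.mul ℝ ℂ)).1 h

lemma contDiff_cv (hr : IsTest r) (hf : LocallyIntegrable f) : ContDiff ℝ ∞ (cv r f) := by
  rw [cv_eq_convolution]
  exact hr.supp.contDiff_convolution_left _ hr.smooth hf

lemma fderiv_cv (hr : IsTest r) (hf : LocallyIntegrable f) (z v : Cn n) :
    fderiv ℝ (cv r f) z v = cv (fun z => fderiv ℝ r z v) f z := by
  have h1 : ContDiff ℝ 1 r := hr.smooth.of_le (by simp)
  have h := (hr.supp.hasFDerivAt_convolution_left (ContinuousLinearMap.mul ℝ ℂ) h1 hf z).fderiv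
  have hc : Continuous (fderiv ℝ r) := hr.smooth.continuous_fderiv (by simp)
  have he := (hr.supp.fderiv ℝ).convolutionExists_left
    ((ContinuousLinearMap.mul ℝ ℂ).precompL (Cn n)) hc hf z
  have hi := (convolutionExistsAt_iff_integrable_swap
    (L := (ContinuousLinearMap.mul ℝ ℂ).precompL (Cn n))).1 he
  rw [cv_eq_convolution, h, convolution_eq_swap, ContinuousLinearMap.integral_apply hi]
  rfl

lemma isTest_fderiv_apply (hr : IsTest r) (v : Cn n) : IsTest fun z => fderiv ℝ r z v :=
  ⟨contDiff_fderiv_apply_vec hr.smooth v,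
    HasCompactSupport.intro' (K := tsupport (fderiv ℝ r)) (hr.supp.fderiv ℝ)
        (isClosed_tsupport _) fun z hz => by simp [image_eq_zero_of_notMem_tsupport hz]⟩

lemma dz_cv (hr : IsTest r) (hf : LocallyIntegrable f) (z : Cn n) :
    dz j (cv r f) z = cv (dz j r) f z := by
  rw [dz, fderiv_cv hr hf, fderiv_cv hr hf, cv, cv, cv, ← integral_const_mul,
    ← integral_sub (integrable_cv (isTest_fderiv_apply hr _) hf z)
      ((integrable_cv (isTest_fderiv_apply hr _) hf z).const_mul _), ← integral_div]
  refine integral_congr_ae (Eventually.of_forall fun ζ => ?_)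
  simp only [dz]
  ring

lemma dzb_cv (hr : IsTest r) (hf : LocallyIntegrable f) (z : Cn n) :
    dzb j (cv r f) z = cv (dzb j r) f z := by
  rw [dzb, fderiv_cv hr hf, fderiv_cv hr hf, cv, cv, cv, ← integral_const_mul,
    ← integral_add (integrable_cv (isTest_fderiv_apply hr _) hf z)
      ((integrable_cv (isTest_fderiv_apply hr _) hf z).const_mul _), ← integral_div]
  refine integral_congr_ae (Eventually.of_forall fun ζ => ?_)
  simp only [dzb]
  ring

lemma isTest_comp_sub (hr : IsTest r) (z : Cn n) : IsTest fun ζ => r (z - ζ) :=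
  ⟨hr.smooth.comp (contDiff_const.sub contDiff_id),
    hr.supp.comp_homeomorph (Homeomorph.subLeft z)⟩

lemma fderiv_kernel_sub (hr : ContDiff ℝ ∞ r) (z ζ v : Cn n) :
    fderiv ℝ (fun ζ => r (z - ζ)) ζ v = -fderiv ℝ r (z - ζ) v := by
  have h := ((hr.differentiableAt_top (z := z - ζ)).hasFDerivAt.comp ζ
    ((hasFDerivAt_id ζ).const_sub z)).fderiv
  change fderiv ℝ (fun ζ => r (z - ζ)) ζ = _ at h
  rw [h]
  simp

lemma dz_comp_sub (hr : ContDiff ℝ ∞ r) (z ζ : Cn n) :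
    dz j (fun ζ => r (z - ζ)) ζ = -dz j r (z - ζ) := by
  simp only [dz, fderiv_kernel_sub hr]; ring

lemma dzb_comp_sub (hr : ContDiff ℝ ∞ r) (z ζ : Cn n) :
    dzb j (fun ζ => r (z - ζ)) ζ = -dzb j r (z - ζ) := by
  simp only [dzb, fderiv_kernel_sub hr]; ring

lemma IsMollifier.isTest (hρ : IsMollifier ρ δ) : IsTest fun z => (ρ z : ℂ) :=
  ⟨contDiff_ofReal hρ.smooth, hρ.hasCompactSupport.comp_left Complex.ofReal_zero⟩

lemma IsMollifier.integral_sub (hρ : IsMollifier ρ δ) (z : Cn n) : ∫ ζ, ρ (z - ζ) = 1 := by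
  rw [integral_sub_left_eq_self ρ volume z, hρ.integral_eq]

lemma IsMollifier.supp_sub (hρ : IsMollifier ρ δ) {z ζ : Cn n} (h : ρ (z - ζ) ≠ 0) :
    dist ζ z ≤ δ := by
  rw [dist_comm, dist_eq_norm]; exact hρ.supp _ h

lemma IsMollifier.integrable_sub (hρ : IsMollifier ρ δ) (z : Cn n) :
    Integrable fun ζ => ρ (z - ζ) := hρ.integrable.comp_sub_left z

lemma locallyIntegrable_ofReal_norm (hf : LocallyIntegrable f) :
    LocallyIntegrable fun ζ => (‖f ζ‖ : ℂ) := by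
  intro x
  obtain ⟨U, hU, hi⟩ := hf x
  exact ⟨U, hU, hi.norm.ofReal⟩

/-- A weighted pointwise bound for convolutions with a mollifier. -/
lemma norm_cv_le (hρ : IsMollifier ρ δ) {g h : Cn n → ℂ} {z : Cn n} {κ : ℝ}
    (hg : LocallyIntegrable g) (hh : ∀ ζ, dist ζ z ≤ δ → ‖h ζ‖ ≤ κ * ‖g ζ‖) :
    ‖cv (fun z => (ρ z : ℂ)) h z‖ ≤ κ * (cv (fun z => (ρ z : ℂ)) (fun ζ => (‖g ζ‖ : ℂ)) z).re := by
  have hn := locallyIntegrable_ofReal_norm hg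
  have hi := integrable_cv hρ.isTest hn z
  have hre : (cv (fun z => (ρ z : ℂ)) (fun ζ => (‖g ζ‖ : ℂ)) z).re
      = ∫ ζ, ((ρ (z - ζ) : ℂ) * (‖g ζ‖ : ℂ)).re := (integral_re hi).symm
  rw [hre, ← integral_const_mul]
  refine norm_integral_le_of_norm_le (hi.re.const_mul κ) (Eventually.of_forall fun ζ => ?_)
  have h0 := hρ.nonneg (z - ζ)
  simp only [norm_mul, Complex.norm_real, Real.norm_eq_abs, abs_of_nonneg h0]
  have : ((ρ (z - ζ) : ℂ) * (‖g ζ‖ : ℂ)).re = ρ (z - ζ) * ‖g ζ‖ := by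
    simp
  rw [this]
  by_cases h1 : ρ (z - ζ) = 0
  · simp [h1]
  · nlinarith [hh ζ (hρ.supp_sub h1)]

lemma norm_cv_sub_le (hρ : IsMollifier ρ δ) {w : Cn n → ℂ} (hw : Continuous w) {z : Cn n} {κ : ℝ}
    (hκ : ∀ ζ, dist ζ z ≤ δ → ‖w ζ - w z‖ ≤ κ) :
    ‖cv (fun z => (ρ z : ℂ)) w z - w z‖ ≤ κ := by
  have hi := integrable_cv hρ.isTest hw.locallyIntegrable z
  have hi2 := integrable_cv hρ.isTest (continuous_const (y := w z)).locallyIntegrable z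
  have h1 : w z = ∫ ζ, (ρ (z - ζ) : ℂ) * w z := by
    rw [integral_mul_const, integral_complex_ofReal, hρ.integral_sub]; simp
  have h2 : cv (fun z => (ρ z : ℂ)) w z - w z = ∫ ζ, (ρ (z - ζ) : ℂ) * (w ζ - w z) := by
    conv_lhs => rw [h1]
    rw [cv, ← MeasureTheory.integral_sub hi hi2]
    simp_rw [mul_sub]
  rw [h2]
  calc _ ≤ ∫ ζ, ρ (z - ζ) * κ := by
        refine norm_integral_le_of_norm_le ((hρ.integrable_sub z).mul_const κ)
          (Eventually.of_forall fun ζ => ?_)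
        have h0 := hρ.nonneg (z - ζ)
        simp only [norm_mul, Complex.norm_real, Real.norm_eq_abs, abs_of_nonneg h0]
        by_cases h1 : ρ (z - ζ) = 0
        · simp [h1]
        · exact mul_le_mul_of_nonneg_left (hκ ζ (hρ.supp_sub h1)) h0
    _ = κ := by rw [integral_mul_const, hρ.integral_sub, one_mul]

/-- Uniform continuity on a neighbourhood of a compact set. -/
lemma exists_forall_dist_le {E : Type*} [PseudoMetricSpace E] {w : Cn n → E} (hw : Continuous w)
    {K : Set (Cn n)}
    (hK : IsCompact K) {κ : ℝ} (hκ : 0 < κ) :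
    ∃ δ > 0, ∀ z ∈ K, ∀ ζ, dist ζ z ≤ δ → dist (w ζ) (w z) ≤ κ := by
  have hK' := hK.cthickening (r := 1)
  have hu := hK'.uniformContinuousOn_of_continuous hw.continuousOn
  rw [Metric.uniformContinuousOn_iff_le] at hu
  obtain ⟨δ, hδ, h⟩ := hu κ hκ
  refine ⟨min δ 1, lt_min hδ one_pos, fun z hz ζ hζ => h ζ ?_ z ?_ (hζ.trans (min_le_left _ _))⟩
  · exact Metric.mem_cthickening_of_dist_le ζ z 1 K hz (hζ.trans (min_le_right _ _))
  · exact Metric.self_subset_cthickening K hz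

lemma exists_cutoff {S : Set (Cn n)} (hS : IsCompact S) {τ : ℝ} (hτ : 0 < τ) :
    ∃ χ : Cn n → ℝ, ContDiff ℝ ∞ χ ∧ HasCompactSupport χ ∧ (∀ z, 0 ≤ χ z) ∧ (∀ z, χ z ≤ 1) ∧
      (∀ z ∈ S, χ z = 1) ∧ ∀ j z, ‖dz j (fun z => (χ z : ℂ)) z‖ ≤ τ ∧
        ‖dzb j (fun z => (χ z : ℂ)) z‖ ≤ τ := by
  let B : ContDiffBump (0 : Cn n) := ⟨1, 2, by norm_num, by norm_num⟩
  have hBs : ContDiff ℝ ∞ (B : Cn n → ℝ) := B.contDiff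
  obtain ⟨C, hC⟩ := (hBs.continuous_fderiv (by simp)).bounded_above_of_compact_support
    (B.hasCompactSupport.fderiv ℝ)
  obtain ⟨R0, hR0⟩ := hS.isBounded.exists_norm_le
  set R := max (max R0 1) (C / τ) with hR
  have hRpos : 0 < R := lt_of_lt_of_le one_pos ((le_max_right _ _).trans (le_max_left _ _))
  have hCR : C * R⁻¹ ≤ τ := by
    rw [mul_inv_le_iff₀ hRpos]
    have : C / τ ≤ R := le_max_right _ _
    rwa [div_le_iff₀ hτ, mul_comm] at this
  set χ : Cn n → ℝ := fun z => B (R⁻¹ • z) with hχ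
  have hχs : ContDiff ℝ ∞ χ := hBs.comp (contDiff_const_smul _)
  have hd : ∀ z v, ‖v‖ ≤ 1 → ‖fderiv ℝ (fun z => (χ z : ℂ)) z v‖ ≤ τ := by
    intro z v hv
    have h1 : HasFDerivAt (fun z : Cn n => R⁻¹ • z) (R⁻¹ • ContinuousLinearMap.id ℝ (Cn n)) z :=
      (hasFDerivAt_id z).const_smul R⁻¹
    have h2 : HasFDerivAt B (fderiv ℝ B (R⁻¹ • z)) (R⁻¹ • z) :=
      (hBs.differentiable (by simp) _).hasFDerivAt
    have h3 := (Complex.ofRealCLM.hasFDerivAt.comp z (h2.comp z h1)).fderiv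
    change fderiv ℝ (fun z => (χ z : ℂ)) z = _ at h3
    rw [h3]
    simp only [ContinuousLinearMap.comp_apply, Complex.ofRealCLM_apply, Complex.norm_real,
      smul_apply, ContinuousLinearMap.id_apply, map_smul, norm_smul]
    rw [Real.norm_of_nonneg (inv_nonneg.2 hRpos.le)]
    refine le_trans ?_ hCR
    rw [mul_comm C]
    refine mul_le_mul_of_nonneg_left ?_ (inv_nonneg.2 hRpos.le)
    refine (ContinuousLinearMap.le_opNorm _ _).trans ?_
    calc _ ≤ C * 1 := mul_le_mul (hC _) hv (norm_nonneg _) ((norm_nonneg _).trans (hC 0))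
      _ = C := mul_one C
  have hv1 : ∀ j : Fin n, ‖(Pi.single j 1 : Cn n)‖ ≤ 1 := fun j => by
    rw [Pi.norm_single]; simp
  have hvI : ∀ j : Fin n, ‖(Pi.single j Complex.I : Cn n)‖ ≤ 1 := fun j => by
    rw [Pi.norm_single]; simp
  refine ⟨χ, hχs, ?_, fun z => B.nonneg, fun z => B.le_one, ?_, fun j z => ⟨?_, ?_⟩⟩
  · exact B.hasCompactSupport.comp_homeomorph (Homeomorph.smulOfNeZero R⁻¹ (inv_ne_zero hRpos.ne'))
  · intro z hz
    refine B.one_of_mem_closedBall ?_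
    rw [mem_closedBall_zero_iff, norm_smul, Real.norm_of_nonneg (inv_nonneg.2 hRpos.le)]
    rw [inv_mul_le_iff₀ hRpos]
    exact (hR0 z hz).trans (by
      rw [show B.rIn = 1 from rfl, mul_one]
      exact (le_max_left _ _).trans (le_max_left _ _))
  · rw [dz, norm_div]
    have h1 := hd z _ (hv1 j)
    have h2 := hd z _ (hvI j)
    have := norm_sub_le (fderiv ℝ (fun z => (χ z : ℂ)) z (Pi.single j 1))
      (Complex.I * fderiv ℝ (fun z => (χ z : ℂ)) z (Pi.single j Complex.I))
    rw [norm_mul, Complex.norm_I, one_mul] at this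
    rw [RCLike.norm_ofNat, div_le_iff₀ two_pos]
    linarith
  · rw [dzb, norm_div]
    have h1 := hd z _ (hv1 j)
    have h2 := hd z _ (hvI j)
    have := norm_add_le (fderiv ℝ (fun z => (χ z : ℂ)) z (Pi.single j 1))
      (Complex.I * fderiv ℝ (fun z => (χ z : ℂ)) z (Pi.single j Complex.I))
    rw [norm_mul, Complex.norm_I, one_mul] at this
    rw [RCLike.norm_ofNat, div_le_iff₀ two_pos]
    linarith

lemma lintegral_sq_le_of_prob {X : Type*} [MeasurableSpace X] (μ : Measure X)
    [IsProbabilityMeasure μ] {f : X → ℝ≥0∞} (hf : AEMeasurable f μ) :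
    (∫⁻ x, f x ∂μ) ^ 2 ≤ ∫⁻ x, f x ^ 2 ∂μ := by
  have h := ENNReal.lintegral_mul_le_Lp_mul_Lq μ (p := 2) (q := 2) Real.HolderConjugate.two_two
    hf (aemeasurable_const (b := (1 : ℝ≥0∞)))
  simp only [Pi.mul_apply, mul_one, ENNReal.one_rpow, lintegral_const, measure_univ] at h
  calc _ ≤ ((∫⁻ x, f x ^ (2 : ℝ) ∂μ) ^ (1 / (2 : ℝ))) ^ 2 := by gcongr
    _ = _ := by
      rw [← ENNReal.rpow_natCast, ← ENNReal.rpow_mul]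
      simp

/-- Young's inequality for the weighted norms, on a compact set. -/
lemma integral_cv_norm_sq_le {Ψ : Cn n → ℝ} (hΨ : Continuous Ψ) (hρ : IsMollifier ρ δ)
    {γ : Cn n → ℂ} (hγ : LocallyIntegrable γ) (hγ2 : Integrable (fun z => ‖γ z‖ ^ 2) (wt Ψ))
    {K : Set (Cn n)} (hK : IsCompact K)
    (hKδ : ∀ z ∈ K, ∀ ζ, dist ζ z ≤ δ → Real.exp (-Ψ z) ≤ 2 * Real.exp (-Ψ ζ)) :
    ∫ z in K, (cv (fun z => (ρ z : ℂ)) (fun ζ => (‖γ ζ‖ : ℂ)) z).re ^ 2 ∂(wt Ψ)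
      ≤ 2 * ∫ z, ‖γ z‖ ^ 2 ∂(wt Ψ) := by
  have hn := locallyIntegrable_ofReal_norm hγ
  set N : Cn n → ℝ := fun z => (cv (fun z => (ρ z : ℂ)) (fun ζ => (‖γ ζ‖ : ℂ)) z).re with hN
  have hNc : Continuous N := Complex.continuous_re.comp (contDiff_cv hρ.isTest hn).continuous
  have hNre : ∀ z, N z = ∫ ζ, ρ (z - ζ) * ‖γ ζ‖ := by
    intro z
    have hi := integrable_cv hρ.isTest hn z
    have := integral_re hi
    simp only [hN, cv]
    refine Eq.trans this.symm ?_
    congr 1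
    ext ζ
    simp
  have hNi : ∀ z, Integrable fun ζ => ρ (z - ζ) * ‖γ ζ‖ := by
    intro z
    refine (integrable_cv hρ.isTest hn z).re.congr (Eventually.of_forall fun ζ => ?_)
    simp
  have hγm : AEMeasurable (fun ζ => ‖γ ζ‖ₑ) volume := hγ.aestronglyMeasurable.enorm
  have hwm : Measurable fun z => ENNReal.ofReal (Real.exp (-Ψ z)) :=
    (continuous_wt_density hΨ).measurable.ennreal_ofReal
  have hρm : Continuous ρ := hρ.continuous
  have hJ : ∀ z, ENNReal.ofReal (N z ^ 2) ≤ ∫⁻ ζ, ENNReal.ofReal (ρ (z - ζ)) * ‖γ ζ‖ₑ ^ 2 := by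
    intro z
    have hm : Measurable fun ζ => ENNReal.ofReal (ρ (z - ζ)) :=
      (hρm.comp (continuous_const.sub continuous_id)).measurable.ennreal_ofReal
    have : IsProbabilityMeasure (volume.withDensity fun ζ => ENNReal.ofReal (ρ (z - ζ))) := by
      constructor
      rw [withDensity_apply _ MeasurableSet.univ, Measure.restrict_univ,
        ← ofReal_integral_eq_lintegral_ofReal (hρ.integrable_sub z)
          (Eventually.of_forall fun ζ => hρ.nonneg _), hρ.integral_sub, ENNReal.ofReal_one]
    have hac : (volume.withDensity fun ζ => ENNReal.ofReal (ρ (z - ζ))) ≪ volume :=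
      withDensity_absolutelyContinuous _ _
    have h := lintegral_sq_le_of_prob (volume.withDensity fun ζ => ENNReal.ofReal (ρ (z - ζ)))
      (hγm.mono_ac hac)
    rw [lintegral_withDensity_eq_lintegral_mul₀ hm.aemeasurable hγm,
      lintegral_withDensity_eq_lintegral_mul₀ hm.aemeasurable (hγm.pow_const 2)] at h
    refine le_trans (le_of_eq ?_) h
    rw [ENNReal.ofReal_pow, hNre, ofReal_integral_eq_lintegral_ofReal (hNi z)]
    · congr 1
      refine lintegral_congr fun ζ => ?_
      rw [ENNReal.ofReal_mul (hρ.nonneg _), ofReal_norm]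
      rfl
    · exact Eventually.of_forall fun ζ => mul_nonneg (hρ.nonneg _) (norm_nonneg _)
    · rw [hNre]
      exact integral_nonneg fun ζ => mul_nonneg (hρ.nonneg _) (norm_nonneg _)
  have hfin : ∫⁻ z, ‖γ z‖ₑ ^ 2 ∂(wt Ψ) = ENNReal.ofReal (∫ z, ‖γ z‖ ^ 2 ∂(wt Ψ)) := by
    rw [ofReal_integral_eq_lintegral_ofReal hγ2 (Eventually.of_forall fun z => by positivity)]
    refine lintegral_congr fun z => ?_
    rw [ENNReal.ofReal_pow (norm_nonneg _), ofReal_norm]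
  have := isLocallyFinite_wt hΨ
  have hi2 : IntegrableOn (fun z => N z ^ 2) K (wt Ψ) :=
    (hNc.pow 2).continuousOn.integrableOn_compact hK
  have h0 : 0 ≤ ∫ z, ‖γ z‖ ^ 2 ∂(wt Ψ) := integral_nonneg fun z => by positivity
  rw [← ENNReal.ofReal_le_ofReal_iff (by positivity),
    ofReal_integral_eq_lintegral_ofReal hi2 (Eventually.of_forall fun z => by positivity),
    ENNReal.ofReal_mul zero_le_two, ← hfin]
  have hwr : (wt Ψ).restrict K = (volume.restrict K).withDensity
      fun z => ENNReal.ofReal (Real.exp (-Ψ z)) := restrict_withDensity hK.measurableSet _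
  have hprod : AEMeasurable (fun p : Cn n × Cn n =>
      ENNReal.ofReal (ρ (p.1 - p.2)) * (ENNReal.ofReal (Real.exp (-Ψ p.2)) * ‖γ p.2‖ₑ ^ 2))
      ((volume.restrict K).prod volume) := by
    refine AEMeasurable.fun_mul ?_ ?_
    · exact ((hρm.comp (continuous_fst.sub continuous_snd)).measurable.ennreal_ofReal).aemeasurable
    · exact (hwm.aemeasurable.mul (hγm.pow_const 2)).comp_quasiMeasurePreserving
        Measure.quasiMeasurePreserving_snd
  calc ∫⁻ z in K, ENNReal.ofReal (N z ^ 2) ∂(wt Ψ)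
      = ∫⁻ z in K, ENNReal.ofReal (Real.exp (-Ψ z)) * ENNReal.ofReal (N z ^ 2) := by
        rw [hwr, lintegral_withDensity_eq_lintegral_mul _ hwm
          (hNc.fun_pow 2).measurable.ennreal_ofReal]
        rfl
    _ ≤ ∫⁻ z in K, 2 * ∫⁻ ζ, ENNReal.ofReal (ρ (z - ζ)) *
          (ENNReal.ofReal (Real.exp (-Ψ ζ)) * ‖γ ζ‖ₑ ^ 2) := by
        refine setLIntegral_mono_ae' hK.measurableSet (Eventually.of_forall fun z hz => ?_)
        refine (mul_le_mul_right (hJ z) _).trans ?_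
        rw [← lintegral_const_mul' _ _ ENNReal.ofReal_ne_top, ← lintegral_const_mul' _ _ (by simp)]
        refine lintegral_mono fun ζ => ?_
        by_cases h1 : ρ (z - ζ) = 0
        · simp [h1]
        · have h2 := ENNReal.ofReal_le_ofReal (hKδ z hz ζ (hρ.supp_sub h1))
          rw [ENNReal.ofReal_mul zero_le_two, ENNReal.ofReal_ofNat] at h2
          calc _ ≤ (2 * ENNReal.ofReal (Real.exp (-Ψ ζ))) *
                (ENNReal.ofReal (ρ (z - ζ)) * ‖γ ζ‖ₑ ^ 2) := mul_le_mul_left h2 _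
            _ = _ := by ring
    _ = 2 * ∫⁻ ζ, ∫⁻ z in K, ENNReal.ofReal (ρ (z - ζ)) *
          (ENNReal.ofReal (Real.exp (-Ψ ζ)) * ‖γ ζ‖ₑ ^ 2) := by
        rw [lintegral_const_mul' _ _ (by simp), lintegral_lintegral_swap hprod]
    _ ≤ 2 * ∫⁻ ζ, ENNReal.ofReal (Real.exp (-Ψ ζ)) * ‖γ ζ‖ₑ ^ 2 := by
        refine mul_le_mul_right (lintegral_mono fun ζ => ?_) _
        refine (setLIntegral_le_lintegral _ _).trans ?_
        have hm : Measurable fun z => ENNReal.ofReal (ρ (z - ζ)) :=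
          (hρm.comp (continuous_id.sub continuous_const)).measurable.ennreal_ofReal
        rw [lintegral_mul_const _ hm, lintegral_sub_right_eq_self (fun z => ENNReal.ofReal (ρ z)) ζ,
          ← ofReal_integral_eq_lintegral_ofReal hρ.integrable
            (Eventually.of_forall fun ζ => hρ.nonneg _), hρ.integral_eq]
        simp
    _ = ENNReal.ofReal 2 * ∫⁻ z, ‖γ z‖ₑ ^ 2 ∂(wt Ψ) := by
        rw [wt, lintegral_withDensity_eq_lintegral_mul₀ hwm.aemeasurable (hγm.pow_const 2)]
        simp

end Regularisation

/-! ### The a priori estimate for weakly defined forms -/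

section Friedrichs

open scoped ComplexConjugate

variable {Ψ : Cn n → ℝ} {ρ : Cn n → ℝ} {δ : ℝ} {γ : Fin n → Cn n → ℂ} {w g : Cn n → ℂ}

lemma IsTest.integrable_mul {η f : Cn n → ℂ} (hη : IsTest η) (hf : LocallyIntegrable f) :
    Integrable fun z => η z * f z :=
  hf.integrable_smul_left_of_hasCompactSupport hη.continuous hη.supp

lemma sum_integral_kernel (hΨ : ContDiff ℝ ∞ Ψ)
    (hadj : ∀ η, IsTest η → ∑ j, ∫ z, γ j z * conj (dzb j η z) ∂(wt Ψ)
      = ∫ z, w z * conj (η z) ∂(wt Ψ)) (hρ : IsMollifier ρ δ) (z : Cn n) :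
    ∑ j, ∫ ζ, ((ρ (z - ζ) : ℂ) * dPsi Ψ j ζ - dz j (fun z => (ρ z : ℂ)) (z - ζ)) * γ j ζ
      = cv (fun z => (ρ z : ℂ)) w z := by
  have hc := hΨ.continuous
  set η : Cn n → ℂ := fun ζ => (ρ (z - ζ) : ℂ) * ((Real.exp (1 * Ψ ζ) : ℝ) : ℂ) with hη
  have hk : IsTest fun ζ => (ρ (z - ζ) : ℂ) := isTest_comp_sub hρ.isTest z
  have he := contDiff_exp_mul hΨ 1
  have hηt : IsTest η := hk.mul_right he
  have h := hadj η hηt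
  have hηc : (fun z => conj (η z)) = η := by
    ext ζ; simp only [hη, map_mul, Complex.conj_ofReal]
  have hd : ∀ j ζ, conj (dzb j η ζ) = ((Real.exp (Ψ ζ) : ℝ) : ℂ) *
      ((ρ (z - ζ) : ℂ) * dPsi Ψ j ζ - dz j (fun z => (ρ z : ℂ)) (z - ζ)) := by
    intro j ζ
    rw [← dz_conj hηt.smooth.differentiableAt_top, hηc, hη,
      dz_mul hk.smooth.differentiableAt_top he.differentiableAt_top, dz_exp_mul hΨ,
      dz_comp_sub hρ.isTest.smooth]
    simp only [one_mul, Complex.ofReal_one]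
    ring
  have hexp : ∀ ζ, ((Real.exp (-Ψ ζ) : ℝ) : ℂ) * ((Real.exp (Ψ ζ) : ℝ) : ℂ) = 1 := by
    intro ζ
    rw [← Complex.ofReal_mul, ← Real.exp_add]; simp
  calc _ = ∑ j, ∫ z, γ j z * conj (dzb j η z) ∂(wt Ψ) := by
        refine Finset.sum_congr rfl fun j _ => ?_
        rw [integral_wt hc]
        refine integral_congr_ae (Eventually.of_forall fun ζ => ?_)
        simp only [hd]
        linear_combination (-((ρ (z - ζ) : ℂ) * dPsi Ψ j ζ
          - dz j (fun z => (ρ z : ℂ)) (z - ζ)) * γ j ζ) * hexp ζ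
    _ = _ := by
        rw [h, integral_wt hc, cv]
        refine integral_congr_ae (Eventually.of_forall fun ζ => ?_)
        have : conj (η ζ) = η ζ := congrFun hηc ζ
        simp only [this]
        simp only [hη, one_mul]
        linear_combination (ρ (z - ζ) * w ζ : ℂ) * hexp ζ

lemma theta_cv (hΨ : ContDiff ℝ ∞ Ψ) (hγ : ∀ j, LocallyIntegrable (γ j))
    (hadj : ∀ η, IsTest η → ∑ j, ∫ z, γ j z * conj (dzb j η z) ∂(wt Ψ)
      = ∫ z, w z * conj (η z) ∂(wt Ψ)) (hρ : IsMollifier ρ δ) (z : Cn n) :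
    theta Ψ (fun j => cv (fun z => (ρ z : ℂ)) (γ j)) z = cv (fun z => (ρ z : ℂ)) w z
      + ∑ j, cv (fun z => (ρ z : ℂ)) (fun ζ => (dPsi Ψ j z - dPsi Ψ j ζ) * γ j ζ) z := by
  rw [← sum_integral_kernel hΨ hadj hρ z, theta, ← Finset.sum_neg_distrib,
    ← Finset.sum_add_distrib]
  refine Finset.sum_congr rfl fun j _ => ?_
  have hk : IsTest fun ζ => (ρ (z - ζ) : ℂ) := isTest_comp_sub hρ.isTest z
  have hk' : IsTest fun ζ => dz j (fun z => (ρ z : ℂ)) (z - ζ) :=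
    isTest_comp_sub (hρ.isTest.dz j) z
  have hi1 : Integrable fun ζ =>
      ((ρ (z - ζ) : ℂ) * dPsi Ψ j ζ - dz j (fun z => (ρ z : ℂ)) (z - ζ)) * γ j ζ :=
    ((hk.mul_right (contDiff_dPsi hΨ j)).sub hk').integrable_mul (hγ j)
  have hi2 : Integrable fun ζ => (ρ (z - ζ) : ℂ) * ((dPsi Ψ j z - dPsi Ψ j ζ) * γ j ζ) := by
    have := (hk.mul_right (contDiff_const.sub (contDiff_dPsi hΨ j)
      (f := fun _ => dPsi Ψ j z))).integrable_mul (hγ j)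
    simpa only [mul_assoc] using this
  have hi3 := hk'.integrable_mul (hγ j)
  have hi4 := hk.integrable_mul (hγ j)
  rw [dl, dz_cv hρ.isTest (hγ j), cv, cv, cv, ← integral_add hi1 hi2, ← integral_const_mul,
    ← integral_sub hi3 (hi4.const_mul _), ← integral_neg]
  refine integral_congr_ae (Eventually.of_forall fun ζ => ?_)
  simp only
  ring

lemma dzb_cv_comm (hγ : ∀ j, LocallyIntegrable (γ j))
    (hcl : ∀ η, IsTest η → ∀ j k, ∫ z, dzb j η z * γ k z = ∫ z, dzb k η z * γ j z)
    (hρ : IsMollifier ρ δ) (z : Cn n) (j k : Fin n) :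
    dzb j (cv (fun z => (ρ z : ℂ)) (γ k)) z = dzb k (cv (fun z => (ρ z : ℂ)) (γ j)) z := by
  have hk : IsTest fun ζ => (ρ (z - ζ) : ℂ) := isTest_comp_sub hρ.isTest z
  have h := hcl _ hk j k
  simp_rw [dzb_comp_sub hρ.isTest.smooth, neg_mul, integral_neg] at h
  rw [dzb_cv hρ.isTest (hγ k), dzb_cv hρ.isTest (hγ j)]
  exact neg_inj.1 h

/-- The convolution of the moduli of the components of a form. -/
def cvSum (ρ : Cn n → ℝ) (γ : Fin n → Cn n → ℂ) (z : Cn n) : ℝ :=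
  ∑ j, (cv (fun z => (ρ z : ℂ)) (fun ζ => (‖γ j ζ‖ : ℂ)) z).re

lemma norm_cv_le_cvSum (hγ : ∀ j, LocallyIntegrable (γ j)) (hρ : IsMollifier ρ δ) (j : Fin n)
    (z : Cn n) : ‖cv (fun z => (ρ z : ℂ)) (γ j) z‖ ≤ cvSum ρ γ z := by
  have h : ∀ j, ‖cv (fun z => (ρ z : ℂ)) (γ j) z‖
      ≤ 1 * (cv (fun z => (ρ z : ℂ)) (fun ζ => (‖γ j ζ‖ : ℂ)) z).re :=
    fun j => norm_cv_le hρ (hγ j) fun ζ _ => by rw [one_mul]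
  simp only [one_mul] at h
  exact (h j).trans (Finset.single_le_sum (f := fun j =>
    (cv (fun z => (ρ z : ℂ)) (fun ζ => (‖γ j ζ‖ : ℂ)) z).re)
    (fun k _ => (norm_nonneg _).trans (h k)) (Finset.mem_univ j))

lemma cvSum_nonneg (hγ : ∀ j, LocallyIntegrable (γ j)) (hρ : IsMollifier ρ δ) (z : Cn n) :
    0 ≤ cvSum ρ γ z := by
  refine Finset.sum_nonneg fun j _ => ?_
  have := norm_cv_le (κ := 1) (z := z) hρ (hγ j) (h := γ j) fun ζ _ => by rw [one_mul]
  rw [one_mul] at this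
  exact (norm_nonneg _).trans this

lemma continuous_cvSum (hγ : ∀ j, LocallyIntegrable (γ j)) (hρ : IsMollifier ρ δ) :
    Continuous (cvSum ρ γ) :=
  continuous_finsetSum _ fun j _ => Complex.continuous_re.comp
    (contDiff_cv hρ.isTest (locallyIntegrable_ofReal_norm (hγ j))).continuous

lemma norm_theta_cv_sub_le (hΨ : ContDiff ℝ ∞ Ψ) (hγ : ∀ j, LocallyIntegrable (γ j))
    (hw : Continuous w)
    (hadj : ∀ η, IsTest η → ∑ j, ∫ z, γ j z * conj (dzb j η z) ∂(wt Ψ)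
      = ∫ z, w z * conj (η z) ∂(wt Ψ)) (hρ : IsMollifier ρ δ) {z : Cn n} {κ : ℝ}
    (h1 : ∀ ζ, dist ζ z ≤ δ → ‖w ζ - w z‖ ≤ κ)
    (h2 : ∀ ζ, dist ζ z ≤ δ → ∀ j, ‖dPsi Ψ j ζ - dPsi Ψ j z‖ ≤ κ) :
    ‖theta Ψ (fun j => cv (fun z => (ρ z : ℂ)) (γ j)) z - w z‖ ≤ κ * (1 + cvSum ρ γ z) := by
  rw [theta_cv hΨ hγ hadj hρ, add_sub_right_comm, mul_add, mul_one, cvSum, Finset.mul_sum]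
  refine (norm_add_le _ _).trans (add_le_add (norm_cv_sub_le hρ hw h1) ?_)
  refine (norm_sum_le _ _).trans (Finset.sum_le_sum fun j _ => ?_)
  refine norm_cv_le hρ (hγ j) fun ζ hζ => ?_
  rw [norm_mul, norm_sub_rev]
  exact mul_le_mul_of_nonneg_right (h2 ζ hζ j) (norm_nonneg _)

lemma integral_cvSum_sq_le (hΨ : Continuous Ψ) (hρ : IsMollifier ρ δ)
    (hγ : ∀ j, LocallyIntegrable (γ j)) (hγ2 : ∀ j, Integrable (fun z => ‖γ j z‖ ^ 2) (wt Ψ))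
    {K : Set (Cn n)} (hK : IsCompact K)
    (hKδ : ∀ z ∈ K, ∀ ζ, dist ζ z ≤ δ → Real.exp (-Ψ z) ≤ 2 * Real.exp (-Ψ ζ)) :
    ∫ z in K, cvSum ρ γ z ^ 2 ∂(wt Ψ) ≤ n * (2 * ∑ j, ∫ z, ‖γ j z‖ ^ 2 ∂(wt Ψ)) := by
  have := isLocallyFinite_wt hΨ
  have hi : ∀ j, IntegrableOn
      (fun z => (cv (fun z => (ρ z : ℂ)) (fun ζ => (‖γ j ζ‖ : ℂ)) z).re ^ 2) K (wt Ψ) := fun j =>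
    ((Complex.continuous_re.comp (contDiff_cv hρ.isTest
      (locallyIntegrable_ofReal_norm (hγ j))).continuous).pow 2).continuousOn.integrableOn_compact hK
  have hi0 : IntegrableOn (fun z => cvSum ρ γ z ^ 2) K (wt Ψ) :=
    ((continuous_cvSum hγ hρ).pow 2).continuousOn.integrableOn_compact hK
  calc _ ≤ ∫ z in K, n * ∑ j, (cv (fun z => (ρ z : ℂ)) (fun ζ => (‖γ j ζ‖ : ℂ)) z).re ^ 2
        ∂(wt Ψ) := by
        refine integral_mono hi0 ((integrable_finsetSum _ fun j _ => hi j).const_mul _) fun z => ?_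
        simpa [cvSum] using sq_sum_le_card_mul_sum_sq (s := Finset.univ) (f := fun j =>
          (cv (fun z => (ρ z : ℂ)) (fun ζ => (‖γ j ζ‖ : ℂ)) z).re)
    _ ≤ _ := by
        rw [integral_const_mul, integral_finsetSum _ fun j _ => hi j, Finset.mul_sum Finset.univ _ (2 : ℝ)]
        refine mul_le_mul_of_nonneg_left (Finset.sum_le_sum fun j _ => ?_) (Nat.cast_nonneg _)
        exact integral_cv_norm_sq_le hΨ hρ (hγ j) (hγ2 j) hK hKδ

lemma theta_mul (χ : Cn n → ℂ) (hχ : ContDiff ℝ ∞ χ) (hγ : ∀ j, ContDiff ℝ ∞ (γ j)) (z : Cn n) :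
    theta Ψ (fun j z => χ z * γ j z) z = χ z * theta Ψ γ z - ∑ j, dz j χ z * γ j z := by
  simp only [theta, dl]
  rw [mul_neg, Finset.mul_sum, ← neg_add', ← Finset.sum_add_distrib]
  congr 1
  refine Finset.sum_congr rfl fun j _ => ?_
  rw [dz_mul hχ.differentiableAt_top (hγ j).differentiableAt_top]
  ring

lemma integral_sum_dzb_mul_conj (hΨ : ContDiff ℝ ∞ Ψ) (hg : IsTest g)
    (hγ : ∀ j, ContDiff ℝ ∞ (γ j)) :
    ∫ z, ∑ j, dzb j g z * conj (γ j z) ∂(wt Ψ) = ∫ z, g z * conj (theta Ψ γ z) ∂(wt Ψ) := by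
  have hc := hΨ.continuous
  have h1 : ∀ j, ∫ z, dzb j g z * conj (γ j z) ∂(wt Ψ)
      = -∫ z, g z * conj (dl Ψ j (γ j) z) ∂(wt Ψ) := by
    intro j
    have he := contDiff_exp_mul hΨ (-1)
    have ht : IsTest fun z => (γ j z * conj (g z)) * ((Real.exp ((-1) * Ψ z) : ℝ) : ℂ) :=
      (hg.conjugate.mul_left (hγ j)).mul_right he
    have h := ht.integral_dz_eq_zero j
    have hi1 : Integrable (fun z => γ j z * conj (dzb j g z)) (wt Ψ) :=
      ((hg.dzb j).conjugate.mul_left (hγ j)).integrable_wt hc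
    have hi2 : Integrable (fun z => dl Ψ j (γ j) z * conj (g z)) (wt Ψ) :=
      (hg.conjugate.mul_left (contDiff_dl hΨ (hγ j) j)).integrable_wt hc
    have h2 : ∫ z, γ j z * conj (dzb j g z) ∂(wt Ψ)
        = -∫ z, dl Ψ j (γ j) z * conj (g z) ∂(wt Ψ) := by
      rw [← add_eq_zero_iff_eq_neg, ← integral_add hi1 hi2, integral_wt hc, ← h]
      refine integral_congr_ae (Eventually.of_forall fun z => ?_)
      have hda := (hγ j).differentiableAt_top (z := z)
      have hdb := hg.conjugate.smooth.differentiableAt_top (z := z)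
      have hde := he.differentiableAt_top (z := z)
      simp only
      rw [dz_mul (hda.fun_mul hdb) hde, dz_mul hda hdb, dz_exp_mul hΨ,
        dz_conj hg.smooth.differentiableAt_top]
      simp [dl]
      ring
    have h3 := congrArg conj h2
    rw [map_neg, ← integral_conj, ← integral_conj] at h3
    simpa [mul_comm] using h3
  have hi1 : ∀ j, Integrable (fun z => dzb j g z * conj (γ j z)) (wt Ψ) := fun j =>
    ((hg.dzb j).mul_right (contDiff_conj (hγ j))).integrable_wt hc
  have hi2 : ∀ j, Integrable (fun z => g z * conj (dl Ψ j (γ j) z)) (wt Ψ) := fun j =>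
    (hg.mul_right (contDiff_conj (contDiff_dl hΨ (hγ j) j))).integrable_wt hc
  rw [integral_finsetSum _ fun j _ => hi1 j]
  simp_rw [h1, theta, map_neg, map_sum, mul_neg, Finset.mul_sum]
  rw [integral_neg, integral_finsetSum _ fun j _ => hi2 j, Finset.sum_neg_distrib]

end Friedrichs

section FriedrichsEstimate

open scoped ComplexConjugate

variable {Ψ : Cn n → ℝ} {γ : Fin n → Cn n → ℂ} {w g : Cn n → ℂ} {b : Cn n → ℝ}

lemma IsTest.integrable_norm_sq {a : Cn n → ℂ} (ha : IsTest a) (hΨ : Continuous Ψ) :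
    Integrable (fun z => ‖a z‖ ^ 2) (wt Ψ) := by
  have hs : HasCompactSupport fun z => ‖a z‖ ^ 2 := by
    refine ha.supp.mono fun z hz => ?_
    rw [Function.mem_support] at hz ⊢
    exact fun h => hz (by simp [h])
  exact (ha.continuous.norm.pow 2).integrable_wt hΨ hs

lemma exists_mollifier_scale (hΨ : ContDiff ℝ ∞ Ψ) (hw : Continuous w) {K : Set (Cn n)}
    (hK : IsCompact K) {κ : ℝ} (hκ : 0 < κ) :
    ∃ δ > 0, ∀ z ∈ K, ∀ ζ, dist ζ z ≤ δ → ‖w ζ - w z‖ ≤ κ ∧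
      (∀ j, ‖dPsi Ψ j ζ - dPsi Ψ j z‖ ≤ κ) ∧ Real.exp (-Ψ z) ≤ 2 * Real.exp (-Ψ ζ) := by
  have hc : Continuous fun z => (w z, (fun j => dPsi Ψ j z), Ψ z) :=
    hw.prodMk ((continuous_pi fun j => (contDiff_dPsi hΨ j).continuous).prodMk hΨ.continuous)
  obtain ⟨δ, hδ, h⟩ := exists_forall_dist_le hc hK (lt_min hκ (Real.log_pos one_lt_two))
  refine ⟨δ, hδ, fun z hz ζ hζ => ?_⟩
  have h1 := h z hz ζ hζ
  rw [Prod.dist_eq, Prod.dist_eq, max_le_iff, max_le_iff] at h1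
  obtain ⟨h2, h3, h4⟩ := h1
  refine ⟨by rw [← dist_eq_norm]; exact h2.trans (min_le_left _ _), fun j => ?_, ?_⟩
  · rw [← dist_eq_norm]
    exact (dist_le_pi_dist (fun j => dPsi Ψ j ζ) (fun j => dPsi Ψ j z) j).trans
      (h3.trans (min_le_left _ _))
  · have h5 := h4.trans (min_le_right _ _)
    rw [Real.dist_eq] at h5
    have h6 := (abs_le.1 h5).2
    calc Real.exp (-Ψ z) ≤ Real.exp (Real.log 2 + -Ψ ζ) := Real.exp_le_exp.2 (by linarith)
      _ = _ := by rw [Real.exp_add, Real.exp_log two_pos]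

lemma norm_integral_mul_conj_le_of_approx {μ : Measure (Cn n)} {K : Set (Cn n)} {S : Cn n → ℝ}
    {κ τ Γ : ℝ} (hK : MeasurableSet K) (h1K : IntegrableOn (fun _ => (1 : ℝ)) K μ)
    (hSi : IntegrableOn (fun z => S z ^ 2) K μ)
    (hκ : 0 < κ) (hκτ : κ ≤ τ) (hκm : κ * μ.real K ≤ τ)
    (hSΓ : ∫ z in K, S z ^ 2 ∂μ ≤ Γ)
    {θ : Cn n → ℂ} (hgw : Integrable (fun z => g z * conj (w z)) μ)
    (hgθ : Integrable (fun z => g z * conj (θ z)) μ) (hg2 : Integrable (fun z => ‖g z‖ ^ 2) μ)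
    (hg0 : ∀ z ∉ K, g z = 0) (hvw : ∀ z ∈ K, ‖θ z - w z‖ ≤ κ * (1 + S z)) :
    ‖∫ z, g z * conj (w z) ∂μ‖ ≤ ‖∫ z, g z * conj (θ z) ∂μ‖
        + τ * ((∫ z, ‖g z‖ ^ 2 ∂μ) + 1 + Γ) := by
  have hτ : 0 < τ := hκ.trans_le hκτ
  have hΓ0 : 0 ≤ Γ := (integral_nonneg fun z => by positivity).trans hSΓ
  have hone : ∫ _ in K, (1 : ℝ) ∂μ = μ.real K := by simp
  have hi : Integrable (K.indicator fun z => κ * (1 + S z ^ 2)) μ :=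
    IntegrableOn.integrable_indicator (Integrable.const_mul (h1K.add hSi) κ) hK
  have e1 : ‖∫ z, (g z * conj (w z) - g z * conj (θ z)) ∂μ‖
      ≤ ∫ z, (κ * ‖g z‖ ^ 2 + K.indicator (fun z => κ * (1 + S z ^ 2)) z) ∂μ := by
    refine norm_integral_le_of_norm_le (((hg2).const_mul κ).add
      hi)
      (Eventually.of_forall fun z => ?_)
    by_cases hz : z ∈ K
    · rw [Set.indicator_of_mem hz, ← mul_sub, ← map_sub, norm_mul, RCLike.norm_conj,
        norm_sub_rev]
      have := mul_le_mul_of_nonneg_left (hvw z hz) (norm_nonneg (g z))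
      have h3 : ‖g z‖ * (1 + S z) ≤ ‖g z‖ ^ 2 + (1 + S z ^ 2) := by
        nlinarith [sq_nonneg (‖g z‖ - (1 + S z) / 2), sq_nonneg (S z - 1)]
      nlinarith
    · have : g z = 0 := hg0 z hz
      simp [this, hz]
  rw [integral_sub hgw hgθ] at e1
  rw [integral_add ((hg2).const_mul κ)
    hi,
    integral_indicator hK, integral_const_mul, integral_const_mul] at e1
  erw [integral_add h1K hSi] at e1
  rw [hone] at e1
  have e2 := norm_le_norm_add_norm_sub' (∫ z, g z * conj (w z) ∂μ)
    (∫ z, g z * conj (θ z) ∂μ)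
  have e3 : κ * (∫ z, ‖g z‖ ^ 2 ∂μ) ≤ τ * ∫ z, ‖g z‖ ^ 2 ∂μ := mul_le_mul_of_nonneg_right hκτ (integral_nonneg fun z => by positivity)
  have e4 : κ * ∫ z in K, S z ^ 2 ∂μ ≤ τ * Γ :=
    mul_le_mul hκτ hSΓ (integral_nonneg fun z => by positivity) hτ.le
  have e5 : κ * (μ.real K + ∫ z in K, S z ^ 2 ∂μ) = κ * μ.real K + κ * ∫ z in K, S z ^ 2 ∂μ := by
    ring
  linarith

lemma integral_norm_sq_le_of_approx {μ : Measure (Cn n)} {K : Set (Cn n)} {S : Cn n → ℝ}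
    {κ τ Γ : ℝ} (hK : MeasurableSet K) (h1K : IntegrableOn (fun _ => (1 : ℝ)) K μ)
    (hSi : IntegrableOn (fun z => S z ^ 2) K μ)
    (hκ : 0 < κ) (hκτ : κ ≤ τ) (hτ1 : τ ≤ 1) (hκm : κ * μ.real K ≤ τ)
    (hSΓ : ∫ z in K, S z ^ 2 ∂μ ≤ Γ)
    {T : Cn n → ℂ} (hw2 : Integrable (fun z => ‖w z‖ ^ 2) μ)
    (hT2 : Integrable (fun z => ‖T z‖ ^ 2) μ)
    (hT : ∀ z ∈ K, ‖T z‖ ≤ ‖w z‖ + (κ + 2 * (τ * S z))) (hT0 : ∀ z ∉ K, T z = 0) :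
    ∫ z, ‖T z‖ ^ 2 ∂μ ≤ 3 / 2 * (∫ z, ‖w z‖ ^ 2 ∂μ) + τ * (6 + 24 * Γ) := by
  have hτ : 0 < τ := hκ.trans_le hκτ
  have hΓ0 : 0 ≤ Γ := (integral_nonneg fun z => by positivity).trans hSΓ
  have hone : ∫ _ in K, (1 : ℝ) ∂μ = μ.real K := by simp
  have hi : IntegrableOn (fun z => 6 * κ ^ 2 + 24 * τ ^ 2 * S z ^ 2) K μ := by
    have := (h1K.const_mul (6 * κ ^ 2)).add (hSi.const_mul (24 * τ ^ 2))
    simpa [IntegrableOn, Pi.add_def] using this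
  have e1 : ∫ z, ‖T z‖ ^ 2 ∂μ
      ≤ ∫ z, (3 / 2 * ‖w z‖ ^ 2
        + K.indicator (fun z => 6 * κ ^ 2 + 24 * τ ^ 2 * S z ^ 2) z) ∂μ := by
    refine integral_mono (hT2) (((hw2).const_mul _).add
      (hi.integrable_indicator hK)) fun z => ?_
    by_cases hz : z ∈ K
    · have a8 := pow_le_pow_left₀ (norm_nonneg _) (hT z hz) 2
      simp only [Set.indicator_of_mem hz]
      refine a8.trans ?_
      nlinarith [sq_nonneg (‖w z‖ - 2 * (κ + 2 * (τ * S z))), sq_nonneg (κ - 2 * (τ * S z))]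
    · simp only [Set.indicator_of_notMem hz, hT0 z hz, norm_zero, add_zero]
      have := sq_nonneg ‖w z‖
      linarith
  rw [integral_add ((hw2).const_mul _) (hi.integrable_indicator hK),
    integral_indicator hK, integral_const_mul] at e1
  have e2 : ∫ z in K, (6 * κ ^ 2 + 24 * τ ^ 2 * S z ^ 2) ∂μ
      = 6 * κ ^ 2 * μ.real K + 24 * τ ^ 2 * ∫ z in K, S z ^ 2 ∂μ := by
    have := integral_add (h1K.const_mul (6 * κ ^ 2)) (hSi.const_mul (24 * τ ^ 2))
    rw [integral_const_mul, integral_const_mul, hone] at this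
    simpa using this
  rw [e2] at e1
  have e3 : 6 * κ ^ 2 * μ.real K ≤ τ * 6 := by nlinarith
  have e4 : 24 * τ ^ 2 * ∫ z in K, S z ^ 2 ∂μ ≤ τ * (24 * Γ) := by
    have := mul_le_mul_of_nonneg_left hSΓ (show 0 ≤ 24 * τ ^ 2 by positivity)
    have : τ ^ 2 * Γ ≤ τ * Γ := mul_le_mul_of_nonneg_right (by nlinarith) hΓ0
    linarith
  linarith

lemma integral_sum_norm_sq_le_of_approx {μ : Measure (Cn n)} {K : Set (Cn n)} {S : Cn n → ℝ}
    {τ Γ : ℝ} (hK : MeasurableSet K)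
    (hSi : IntegrableOn (fun z => S z ^ 2) K μ)
    (hτ : 0 < τ) (hτ1 : τ ≤ 1)
    (hSΓ : ∫ z in K, S z ^ 2 ∂μ ≤ Γ) {A : Fin n → Fin n → Cn n → ℂ}
    (hA2 : ∀ j k, Integrable (fun z => ‖A j k z‖ ^ 2) μ)
    (hA : ∀ z ∈ K, ∀ j k, ‖A j k z‖ ≤ 2 * (τ * S z)) (hA0 : ∀ z ∉ K, ∀ j k, A j k z = 0) :
    ∫ z, ∑ j, ∑ k, ‖A j k z‖ ^ 2 ∂μ ≤ τ * (4 * n ^ 2 * Γ) := by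
  have hΓ0 : 0 ≤ Γ := (integral_nonneg fun z => by positivity).trans hSΓ
  have hi : IntegrableOn (fun z => 4 * n ^ 2 * τ ^ 2 * S z ^ 2) K μ := hSi.const_mul _
  have e1 : ∫ z, ∑ j, ∑ k, ‖A j k z‖ ^ 2 ∂μ
      ≤ ∫ z, K.indicator (fun z => 4 * n ^ 2 * τ ^ 2 * S z ^ 2) z ∂μ := by
    refine integral_mono (integrable_finsetSum _ fun j _ => integrable_finsetSum _ fun k _ =>
      hA2 j k) (hi.integrable_indicator hK) fun z => ?_
    by_cases hz : z ∈ K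
    · rw [Set.indicator_of_mem hz]
      calc _ ≤ ∑ _j : Fin n, ∑ _k : Fin n, (2 * (τ * S z)) ^ 2 :=
            Finset.sum_le_sum fun j _ => Finset.sum_le_sum fun k _ =>
              pow_le_pow_left₀ (norm_nonneg _) (hA z hz j k) 2
        _ = _ := by simp; ring
    · rw [Set.indicator_of_notMem hz]
      simp [hA0 z hz]
  rw [integral_indicator hK, integral_const_mul] at e1
  have b1 := mul_le_mul_of_nonneg_left hSΓ (show (0 : ℝ) ≤ 4 * n ^ 2 * τ ^ 2 by positivity)
  have b2 : τ ^ 2 * (4 * n ^ 2 * Γ) ≤ τ * (4 * n ^ 2 * Γ) :=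
    mul_le_mul_of_nonneg_right (by nlinarith) (by positivity)
  linarith

lemma friedrichs_estimate_aux
    (hΨ : ContDiff ℝ ∞ Ψ) (hg : IsTest g) (hw : IsTest w)
    (hb : Integrable b (wt Ψ))
    (h : ∀ z, ∀ v : Fin n → ℂ, 2 * ‖∑ j, dzb j g z * conj (v j)‖ ≤ b z + levi Ψ z v)
    (hγ : ∀ j, LocallyIntegrable (γ j)) (hγ2 : ∀ j, Integrable (fun z => ‖γ j z‖ ^ 2) (wt Ψ))
    (hadj : ∀ η, IsTest η → ∑ j, ∫ z, γ j z * conj (dzb j η z) ∂(wt Ψ)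
      = ∫ z, w z * conj (η z) ∂(wt Ψ))
    (hcl : ∀ η, IsTest η → ∀ j k, ∫ z, dzb j η z * γ k z = ∫ z, dzb k η z * γ j z)
    {τ : ℝ} (hτ : 0 < τ) (hτ1 : τ ≤ 1) :
    2 * ‖∫ z, g z * conj (w z) ∂(wt Ψ)‖
      ≤ (∫ z, b z ∂(wt Ψ)) + 3 / 2 * (∫ z, ‖w z‖ ^ 2 ∂(wt Ψ)) + τ * (6 + 24 * (n * (2 * ∑ j, ∫ z, ‖γ j z‖ ^ 2 ∂(wt Ψ)))
        + 4 * n ^ 2 * (n * (2 * ∑ j, ∫ z, ‖γ j z‖ ^ 2 ∂(wt Ψ)))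
        + 2 * ((∫ z, ‖g z‖ ^ 2 ∂(wt Ψ)) + 1
          + (n * (2 * ∑ j, ∫ z, ‖γ j z‖ ^ 2 ∂(wt Ψ))))) := by
  have hc := hΨ.continuous
  have hlf := isLocallyFinite_wt hc
  obtain ⟨χ, hχs, hχc, hχ0, hχ1, hχS, hχd⟩ := exists_cutoff (S := tsupport g) hg.supp hτ
  obtain ⟨K, hKdef⟩ : ∃ x, x = tsupport χ := ⟨_, rfl⟩
  have hK : IsCompact K := hKdef ▸ hχc
  obtain ⟨m, hm⟩ : ∃ x : ℝ, x = (wt Ψ).real K := ⟨_, rfl⟩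
  have hm0 : 0 ≤ m := hm ▸ measureReal_nonneg
  obtain ⟨κ, hκdef⟩ : ∃ x : ℝ, x = τ / (1 + m) := ⟨_, rfl⟩
  have hκ : 0 < κ := by rw [hκdef]; positivity
  have hκτ : κ ≤ τ := hκdef ▸ div_le_self hτ.le (by linarith)
  have hκm : κ * m ≤ τ := by
    rw [hκdef, div_mul_eq_mul_div, div_le_iff₀ (by positivity)]
    nlinarith
  obtain ⟨δ, hδ, hδK⟩ := exists_mollifier_scale hΨ hw.continuous hK hκ
  obtain ⟨ρ, hρ⟩ := exists_isMollifier n hδ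
  obtain ⟨S, hS⟩ : ∃ x, x = cvSum ρ γ := ⟨_, rfl⟩
  have hS0 : ∀ z, 0 ≤ S z := hS ▸ cvSum_nonneg hγ hρ
  have hSc : Continuous S := hS ▸ continuous_cvSum hγ hρ
  have hSi : IntegrableOn (fun z => S z ^ 2) K (wt Ψ) :=
    (hSc.pow 2).continuousOn.integrableOn_compact hK
  have hSΓ : ∫ z in K, S z ^ 2 ∂(wt Ψ) ≤ n * (2 * ∑ j, ∫ z, ‖γ j z‖ ^ 2 ∂(wt Ψ)) :=
    hS ▸ integral_cvSum_sq_le hc hρ hγ hγ2 hK fun z hz ζ hζ => (hδK z hz ζ hζ).2.2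
  obtain ⟨v, hv⟩ : ∃ x : Fin n → Cn n → ℂ, x = fun j => cv (fun z => (ρ z : ℂ)) (γ j) := ⟨_, rfl⟩
  have hvs : ∀ j, ContDiff ℝ ∞ (v j) := fun j => hv ▸ contDiff_cv hρ.isTest (hγ j)
  have hvS : ∀ j z, ‖v j z‖ ≤ S z := fun j z => hv ▸ hS ▸ norm_cv_le_cvSum hγ hρ j z
  have hvw : ∀ z ∈ K, ‖theta Ψ v z - w z‖ ≤ κ * (1 + S z) := fun z hz => hv ▸ hS ▸
    norm_theta_cv_sub_le hΨ hγ hw.continuous hadj hρ (fun ζ hζ => (hδK z hz ζ hζ).1)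
      (fun ζ hζ => (hδK z hz ζ hζ).2.1)
  have hχt : IsTest fun z => (χ z : ℂ) :=
    ⟨contDiff_ofReal hχs, hχc.comp_left Complex.ofReal_zero⟩
  have hα : ∀ j, IsTest fun z => (χ z : ℂ) * v j z := fun j => hχt.mul_right (hvs j)
  have hap := apriori_estimate hΨ hα hb h
  have hχK : ∀ z ∉ K, χ z = 0 := fun z hz => image_eq_zero_of_notMem_tsupport (hKdef ▸ hz)
  have hdK : ∀ z ∉ K, ∀ j, dz j (fun z => (χ z : ℂ)) z = 0 ∧ dzb j (fun z => (χ z : ℂ)) z = 0 := by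
    intro z hz j
    have hz' : z ∉ tsupport (fun z => (χ z : ℂ)) := fun hmem =>
      hz (hKdef ▸ tsupport_comp_subset Complex.ofReal_zero χ hmem)
    have : fderiv ℝ (fun z => (χ z : ℂ)) z = 0 := by
      by_contra hne
      exact hz' (support_fderiv_subset ℝ hne)
    simp [dz, dzb, this]
  have hgK : tsupport g ⊆ K := fun z hz => hKdef ▸ subset_tsupport _ (by simp [hχS z hz])
  -- the pairing
  have hpair : ∫ z, ∑ j, dzb j g z * conj ((χ z : ℂ) * v j z) ∂(wt Ψ)
      = ∫ z, g z * conj (theta Ψ v z) ∂(wt Ψ) := by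
    rw [← integral_sum_dzb_mul_conj hΨ hg hvs]
    refine integral_congr_ae (Eventually.of_forall fun z => ?_)
    refine Finset.sum_congr rfl fun j _ => ?_
    by_cases hz : z ∈ tsupport g
    · simp [hχS z hz]
    · have : fderiv ℝ g z = 0 := by
        by_contra hne
        exact hz (support_fderiv_subset ℝ hne)
      simp [dzb, this]
  have hgθ : Integrable (fun z => g z * conj (theta Ψ v z)) (wt Ψ) := by
    refine (hg.mul_right (contDiff_conj (a := theta Ψ v) ?_)).integrable_wt hc
    exact (ContDiff.sum fun j _ => contDiff_dl hΨ (hvs j) j).neg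
  have hgw : Integrable (fun z => g z * conj (w z)) (wt Ψ) :=
    (hg.mul_right (contDiff_conj hw.smooth)).integrable_wt hc
  have h1K : IntegrableOn (fun _ => (1 : ℝ)) K (wt Ψ) :=
    continuous_const.continuousOn.integrableOn_compact hK
  have hdχ : ∀ z, ‖∑ j, dz j (fun z => (χ z : ℂ)) z * v j z‖ ≤ τ * S z := by
    intro z
    rw [hS, cvSum, Finset.mul_sum]
    refine (norm_sum_le _ _).trans (Finset.sum_le_sum fun j _ => ?_)
    rw [norm_mul]
    have := norm_cv_le (κ := 1) (z := z) hρ (hγ j) (h := γ j) fun ζ _ => by rw [one_mul]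
    rw [one_mul] at this
    rw [hv]
    exact mul_le_mul (hχd j z).1 this (norm_nonneg _) hτ.le
  have herr := norm_integral_mul_conj_le_of_approx hK.measurableSet h1K hSi hκ hκτ (hm ▸ hκm) hSΓ
    hgw hgθ (hg.integrable_norm_sq hc) (fun z hz => image_eq_zero_of_notMem_tsupport fun hz' => hz (hgK hz')) hvw
  have hθ := integral_norm_sq_le_of_approx (T := theta Ψ fun j z => (χ z : ℂ) * v j z)
    hK.measurableSet h1K hSi hκ hκτ hτ1 (hm ▸ hκm) hSΓ (hw.integrable_norm_sq hc) ((IsTest.theta hΨ hα).integrable_norm_sq hc)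
    (fun z hz => by
      rw [theta_mul _ hχt.smooth hvs]
      have a1 := hvw z hz
      have a2 : ‖theta Ψ v z‖ ≤ ‖w z‖ + κ * (1 + S z) := by
        have := norm_le_norm_add_norm_sub' (theta Ψ v z) (w z)
        linarith
      have a3 := hdχ z
      have a4 : ‖(χ z : ℂ) * theta Ψ v z‖ ≤ ‖theta Ψ v z‖ := by
        rw [norm_mul, Complex.norm_real, Real.norm_of_nonneg (hχ0 z)]
        exact mul_le_of_le_one_left (norm_nonneg _) (hχ1 z)
      have a5 := norm_sub_le ((χ z : ℂ) * theta Ψ v z) (∑ j, dz j (fun z => (χ z : ℂ)) z * v j z)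
      have a6 : κ * S z ≤ τ * S z := mul_le_mul_of_nonneg_right hκτ (hS0 z)
      linarith)
    (fun z hz => by
      rw [theta_mul _ hχt.smooth hvs, hχK z hz]
      simp [(hdK z hz _).1])
  have a1 : ∀ j k z, dzb j (fun z => (χ z : ℂ) * v k z) z
      - dzb k (fun z => (χ z : ℂ) * v j z) z = dzb j (fun z => (χ z : ℂ)) z * v k z
        - dzb k (fun z => (χ z : ℂ)) z * v j z := by
    intro j k z
    rw [dzb_mul hχt.smooth.differentiableAt_top (hvs k).differentiableAt_top,
      dzb_mul hχt.smooth.differentiableAt_top (hvs j).differentiableAt_top,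
      hv, dzb_cv_comm hγ hcl hρ z j k]
    ring
  have hq := integral_sum_norm_sq_le_of_approx (A := fun j k z =>
      dzb j (fun z => (χ z : ℂ) * v k z) z - dzb k (fun z => (χ z : ℂ) * v j z) z)
    hK.measurableSet hSi hτ hτ1 hSΓ (fun j k => (((hα k).dzb j).sub ((hα j).dzb k)).integrable_norm_sq hc)
    (fun z _ j k => by
      rw [a1]
      refine (norm_sub_le _ _).trans ?_
      rw [norm_mul, norm_mul, two_mul]
      exact add_le_add
        (mul_le_mul (hχd j z).2 (hvS k z) (norm_nonneg _) hτ.le)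
        (mul_le_mul (hχd k z).2 (hvS j z) (norm_nonneg _) hτ.le))
    (fun z hz j k => by
      rw [a1]
      simp [(hdK z hz _).2])
  rw [hpair] at hap
  linarith

/-- The a priori estimate holds for `∂̄`-closed square integrable forms `γ` with `ϑγ = w`
in the weak sense. -/
lemma friedrichs_estimate
    (hΨ : ContDiff ℝ ∞ Ψ) (hg : IsTest g) (hw : IsTest w)
    (hb : Integrable b (wt Ψ))
    (h : ∀ z, ∀ v : Fin n → ℂ, 2 * ‖∑ j, dzb j g z * conj (v j)‖ ≤ b z + levi Ψ z v)
    (hγ : ∀ j, LocallyIntegrable (γ j)) (hγ2 : ∀ j, Integrable (fun z => ‖γ j z‖ ^ 2) (wt Ψ))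
    (hadj : ∀ η, IsTest η → ∑ j, ∫ z, γ j z * conj (dzb j η z) ∂(wt Ψ)
      = ∫ z, w z * conj (η z) ∂(wt Ψ))
    (hcl : ∀ η, IsTest η → ∀ j k, ∫ z, dzb j η z * γ k z = ∫ z, dzb k η z * γ j z) :
    2 * ‖∫ z, g z * conj (w z) ∂(wt Ψ)‖
      ≤ (∫ z, b z ∂(wt Ψ)) + 3 / 2 * ∫ z, ‖w z‖ ^ 2 ∂(wt Ψ) := by
  obtain ⟨D, hD⟩ : ∃ x : ℝ, x = (6 + 24 * (n * (2 * ∑ j, ∫ z, ‖γ j z‖ ^ 2 ∂(wt Ψ)))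
        + 4 * n ^ 2 * (n * (2 * ∑ j, ∫ z, ‖γ j z‖ ^ 2 ∂(wt Ψ)))
        + 2 * ((∫ z, ‖g z‖ ^ 2 ∂(wt Ψ)) + 1
          + (n * (2 * ∑ j, ∫ z, ‖γ j z‖ ^ 2 ∂(wt Ψ))))) := ⟨_, rfl⟩
  have hΓ0 : 0 ≤ (n * (2 * ∑ j, ∫ z, ‖γ j z‖ ^ 2 ∂(wt Ψ))) :=
    mul_nonneg (Nat.cast_nonneg _) (mul_nonneg zero_le_two
      (Finset.sum_nonneg fun j _ => integral_nonneg fun z => by positivity))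
  have hG0 : 0 ≤ (∫ z, ‖g z‖ ^ 2 ∂(wt Ψ)) := integral_nonneg fun z => by positivity
  have hD0 : 0 < D := by rw [hD]; positivity
  refine le_of_forall_pos_le_add fun ε hε => ?_
  have hτ : 0 < min 1 (ε / D) := lt_min one_pos (div_pos hε hD0)
  refine (friedrichs_estimate_aux hΨ hg hw hb h hγ hγ2 hadj hcl hτ (min_le_left _ _)).trans ?_
  rw [← hD]
  have : min 1 (ε / D) * D ≤ ε := by
    rw [← le_div_iff₀ hD0]; exact min_le_right _ _
  linarith

end FriedrichsEstimate

section Projection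

open scoped ComplexConjugate InnerProductSpace

lemma exists_proj_closure_span {H : Type*} [NormedAddCommGroup H] [InnerProductSpace ℂ H]
    [CompleteSpace H] (A : Submodule ℂ H) (x : H) :
    ∃ y ∈ closure (A : Set H), (∀ s ∈ A, ⟪s, y⟫_ℂ = ⟪s, x⟫_ℂ) ∧
      (∀ u, (∀ s ∈ A, ⟪u, s⟫_ℂ = 0) → ⟪u, y⟫_ℂ = 0) ∧ ⟪y, x⟫_ℂ = ⟪y, y⟫_ℂ := by
  have hcl : IsClosed (A.topologicalClosure : Set H) := A.isClosed_topologicalClosure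
  have : CompleteSpace A.topologicalClosure := hcl.completeSpace_coe
  have hy : A.topologicalClosure.starProjection x ∈ A.topologicalClosure :=
    Submodule.starProjection_apply_mem _ _
  have hs : ∀ s ∈ A.topologicalClosure,
      ⟪s, A.topologicalClosure.starProjection x⟫_ℂ = ⟪s, x⟫_ℂ := fun s hs => by
    have h := Submodule.starProjection_inner_eq_zero (K := A.topologicalClosure) x s hs
    rw [inner_sub_left, sub_eq_zero] at h
    rw [← inner_conj_symm s, ← inner_conj_symm s, h]
  refine ⟨_, hy, fun s h => hs s (A.le_topologicalClosure h), fun u hu => ?_, (hs _ hy).symm⟩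
  have hc : IsClosed {y : H | ⟪u, y⟫_ℂ = 0} :=
    isClosed_eq (continuous_const.inner continuous_id) continuous_const
  exact closure_minimal (fun s h => hu s h) hc hy

variable {Ψ : Cn n → ℝ} {a b g : Cn n → ℂ} {α : Fin n → Cn n → ℂ}

lemma IsTest.memLp_wt (ha : IsTest a) (hΨ : Continuous Ψ) : MemLp a 2 (wt Ψ) :=
  haveI := isLocallyFinite_wt hΨ
  ha.continuous.memLp_of_hasCompactSupport ha.supp

lemma inner_toLp_left (ha : MemLp a 2 (wt Ψ)) (y : Lp ℂ 2 (wt Ψ)) :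
    ⟪ha.toLp a, y⟫_ℂ = ∫ z, y z * conj (a z) ∂(wt Ψ) := by
  rw [L2.inner_def]
  refine integral_congr_ae ?_
  filter_upwards [ha.coeFn_toLp] with z hz
  rw [hz, RCLike.inner_apply]

lemma inner_toLp_toLp (ha : MemLp a 2 (wt Ψ)) (hb : MemLp b 2 (wt Ψ)) :
    ⟪ha.toLp a, hb.toLp b⟫_ℂ = ∫ z, b z * conj (a z) ∂(wt Ψ) := by
  rw [inner_toLp_left]
  refine integral_congr_ae ?_
  filter_upwards [hb.coeFn_toLp] with z hz
  rw [hz]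

lemma locallyIntegrable_of_memLp_wt (hΨ : Continuous Ψ) (ha : MemLp a 2 (wt Ψ)) :
    LocallyIntegrable a := by
  have := isLocallyFinite_wt hΨ
  have h1 : LocallyIntegrable a (wt Ψ) := ha.locallyIntegrable (by norm_num)
  have hd := continuous_wt_density hΨ
  have h2 : LocallyIntegrable (fun z => Real.exp (-Ψ z) • a z) := by
    rw [locallyIntegrable_iff] at h1 ⊢
    intro K hK
    have h3 := h1 K hK
    rw [IntegrableOn, wt, restrict_withDensity hK.measurableSet,
      integrable_withDensity_iff_integrable_smul' (by fun_prop) (by simp)] at h3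
    refine h3.congr (Eventually.of_forall fun z => ?_)
    simp [Real.exp_nonneg]
  have h4 := h2.continuous_smul (g := fun z => Real.exp (Ψ z)) (by fun_prop)
  refine h4.congr (Eventually.of_forall fun z => ?_)
  simp only [smul_smul, ← Real.exp_add]
  simp

lemma IsTest.integral_dzb_eq_zero (ha : IsTest a) (j : Fin n) : ∫ z, _root_.dzb j a z = 0 := by
  have h := ha.conjugate.integral_dz_eq_zero j
  simp_rw [dz_conj ha.smooth.differentiableAt_top] at h
  rw [integral_conj] at h
  simpa using h

lemma integral_dzb_mul_dzb_comm (ha : IsTest a) (hb : IsTest b) (j k : Fin n) :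
    ∫ z, dzb j a z * dzb k b z = ∫ z, dzb k a z * dzb j b z := by
  have key : ∀ j k, ∫ z, dzb j a z * dzb k b z = -∫ z, a z * dzb j (dzb k b) z := fun j k => by
    have h := (ha.mul_right (hb.dzb k).smooth).integral_dzb_eq_zero j
    simp_rw [dzb_mul ha.smooth.differentiableAt_top (hb.dzb k).smooth.differentiableAt_top] at h
    rw [integral_add] at h
    · exact eq_neg_of_add_eq_zero_left h
    · exact ((ha.dzb j).mul_right (hb.dzb k).smooth).integrable
    · exact (ha.mul_right ((hb.dzb k).dzb j).smooth).integrable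
  rw [key, key]
  simp_rw [dzb_dzb_comm (j := k) (k := j) hb.smooth]

lemma inner_single_left {H : Type*} [NormedAddCommGroup H] [InnerProductSpace ℂ H] (k : Fin n)
    (x : H) (y : PiLp 2 fun _ : Fin n => H) :
    ⟪(WithLp.toLp 2 (Pi.single k x) : PiLp 2 fun _ : Fin n => H), y⟫_ℂ = ⟪x, y k⟫_ℂ := by
  rw [PiLp.inner_apply, Finset.sum_eq_single k]
  · simp
  · intro j _ hj
    simp [hj]
  · simp

lemma integral_wt_mul_conj_exp (hΨ : Continuous Ψ) (f η : Cn n → ℂ) :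
    ∫ z, f z * conj (conj (η z) * ((Real.exp (1 * Ψ z) : ℝ) : ℂ)) ∂(wt Ψ) = ∫ z, η z * f z := by
  rw [integral_wt hΨ]
  refine integral_congr_ae (Eventually.of_forall fun z => ?_)
  simp only [map_mul, Complex.conj_conj, Complex.conj_ofReal, one_mul]
  have : ((Real.exp (-Ψ z) : ℝ) : ℂ) * ((Real.exp (Ψ z) : ℝ) : ℂ) = 1 := by
    rw [← Complex.ofReal_mul, ← Real.exp_add]; simp
  linear_combination (η z * f z) * this

/-- Square integrable `(0,1)`-forms. -/
abbrev FormL2 (Ψ : Cn n → ℝ) := PiLp 2 fun _ : Fin n => Lp ℂ 2 (wt Ψ)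

lemma theta_estimate (hΨ : ContDiff ℝ ∞ Ψ) (hg : IsTest g) {b : Cn n → ℝ}
    (hb : Integrable b (wt Ψ))
    (h : ∀ z, ∀ v : Fin n → ℂ, 2 * ‖∑ j, dzb j g z * conj (v j)‖ ≤ b z + levi Ψ z v)
    (hα : ∀ j, IsTest (α j)) :
    2 * ‖∫ z, g z * conj (theta Ψ α z) ∂(wt Ψ)‖
      ≤ (∫ z, b z ∂(wt Ψ)) + 3 / 2 * ∫ z, ‖theta Ψ α z‖ ^ 2 ∂(wt Ψ) := by
  have hc := hΨ.continuous
  let dbar : ∀ η : Cn n → ℂ, IsTest η → FormL2 Ψ := fun η hη =>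
    WithLp.toLp 2 fun j => ((hη.dzb j).memLp_wt hc).toLp _
  let αH : FormL2 Ψ := WithLp.toLp 2 fun j => ((hα j).memLp_wt hc).toLp _
  let A : Submodule ℂ (FormL2 Ψ) := Submodule.span ℂ {x | ∃ η, ∃ hη : IsTest η, x = dbar η hη}
  obtain ⟨γ, -, h1, h2, -⟩ := exists_proj_closure_span A αH
  have hm : ∀ j, MemLp (γ j) 2 (wt Ψ) := fun j => Lp.memLp _
  refine friedrichs_estimate (γ := fun j => γ j) hΨ hg (IsTest.theta hΨ hα) hb h
    (fun j => locallyIntegrable_of_memLp_wt hc (hm j)) (fun j => (hm j).integrable_norm_pow two_ne_zero)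
    (fun η hη => ?_) fun η hη j k => ?_
  · have h3 := h1 _ (Submodule.subset_span ⟨η, hη, rfl⟩)
    simp only [dbar, αH, PiLp.inner_apply, inner_toLp_toLp] at h3
    simp only [inner_toLp_left] at h3
    rw [h3]
    have h4 := integral_sum_dzb_mul_conj hΨ hη fun j => (hα j).smooth
    have h5 : ∀ j, Integrable (fun z => α j z * conj (dzb j η z)) (wt Ψ) := fun j =>
      ((hα j).mul_right (hη.dzb j).conjugate.smooth).integrable_wt hc
    rw [← integral_finsetSum _ fun j _ => h5 j]
    have h6 := congrArg conj h4
    rw [← integral_conj, ← integral_conj] at h6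
    simpa [mul_comm] using h6
  · have he := contDiff_exp_mul hΨ 1
    have ht : ∀ j, IsTest fun z => conj (dzb j η z) * ((Real.exp (1 * Ψ z) : ℝ) : ℂ) := fun j =>
      (hη.dzb j).conjugate.mul_right he
    let u : Fin n → Fin n → FormL2 Ψ := fun j k => WithLp.toLp 2 (Pi.single k (((ht j).memLp_wt hc).toLp _))
    have h3 := h2 (u j k - u k j) fun s hs => by
      induction hs using Submodule.span_induction with
      | mem x hx =>
        obtain ⟨ξ, hξ, rfl⟩ := hx
        rw [inner_sub_left, inner_single_left, inner_single_left]
        simp only [dbar, inner_toLp_toLp, integral_wt_mul_conj_exp hc]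
        rw [integral_dzb_mul_dzb_comm hη hξ, sub_self]
      | zero => simp
      | add x y _ _ hx hy => rw [inner_add_right, hx, hy, add_zero]
      | smul c x _ hx => rw [inner_smul_right, hx, mul_zero]
    rw [inner_sub_left, inner_single_left, inner_single_left, sub_eq_zero] at h3
    simpa only [inner_toLp_left, integral_wt_mul_conj_exp hc] using h3

end Projection

section Hormander

open scoped ComplexConjugate InnerProductSpace

variable {Ψ : Cn n → ℝ} {a g F : Cn n → ℂ}

lemma theta_add {α α' : Fin n → Cn n → ℂ} (hα : ∀ j, IsTest (α j)) (hα' : ∀ j, IsTest (α' j))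
    (z : Cn n) : theta Ψ (fun j z => α j z + α' j z) z = theta Ψ α z + theta Ψ α' z := by
  simp only [theta, dl]
  rw [← neg_add, ← Finset.sum_add_distrib]
  congr 1
  refine Finset.sum_congr rfl fun j _ => ?_
  have h : fderiv ℝ (fun z => α j z + α' j z) z = fderiv ℝ (α j) z + fderiv ℝ (α' j) z :=
    fderiv_add (hα j).smooth.differentiableAt_top (hα' j).smooth.differentiableAt_top
  simp only [dz, h, add_apply]
  ring

lemma theta_const_mul {α : Fin n → Cn n → ℂ} (hα : ∀ j, IsTest (α j)) (c : ℂ) (z : Cn n) :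
    theta Ψ (fun j z => c * α j z) z = c * theta Ψ α z := by
  rw [theta_mul (fun _ => c) contDiff_const fun j => (hα j).smooth]
  simp [dz]

lemma toLp_eq_zero_of_forall (ha : MemLp a 2 (wt Ψ)) (h : ∀ z, a z = 0) : ha.toLp a = 0 := by
  rw [Lp.eq_zero_iff_ae_eq_zero]
  filter_upwards [ha.coeFn_toLp] with z hz
  rw [hz, h z]; rfl

/-- The image of test forms under the formal adjoint of `∂̄`. -/
def thetaRange (hΨ : ContDiff ℝ ∞ Ψ) : Submodule ℂ (Lp ℂ 2 (wt Ψ)) where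
  carrier := {x | ∃ α : Fin n → Cn n → ℂ, ∃ hα : ∀ j, IsTest (α j),
    x = ((IsTest.theta hΨ hα).memLp_wt hΨ.continuous).toLp _}
  zero_mem' := ⟨fun _ _ => 0, fun _ => IsTest.zero, by
    refine (toLp_eq_zero_of_forall _ fun z => ?_).symm
    simp [theta, dl, dz]⟩
  add_mem' := by
    rintro x y ⟨α, hα, rfl⟩ ⟨α', hα', rfl⟩
    refine ⟨fun j z => α j z + α' j z, fun j => (hα j).add (hα' j), ?_⟩
    rw [← MemLp.toLp_add]
    exact (MemLp.toLp_eq_toLp_iff _ _).2 (Eventually.of_forall fun z =>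
      (theta_add hα hα' z).symm)
  smul_mem' := by
    rintro c x ⟨α, hα, rfl⟩
    refine ⟨fun j z => c * α j z, fun j => (hα j).mul_left contDiff_const, ?_⟩
    rw [← MemLp.toLp_const_smul]
    exact (MemLp.toLp_eq_toLp_iff _ _).2 (Eventually.of_forall fun z =>
      (theta_const_mul hα c z).symm)

lemma norm_toLp_sq (ha : MemLp a 2 (wt Ψ)) : ‖ha.toLp a‖ ^ 2 = ∫ z, ‖a z‖ ^ 2 ∂(wt Ψ) := by
  have h := inner_self_eq_norm_sq_to_K (𝕜 := ℂ) (ha.toLp a)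
  rw [inner_toLp_toLp] at h
  have h2 : ∫ z, a z * conj (a z) ∂(wt Ψ) = ((∫ z, ‖a z‖ ^ 2 ∂(wt Ψ) : ℝ) : ℂ) := by
    rw [← integral_complex_ofReal]
    refine integral_congr_ae (Eventually.of_forall fun z => ?_)
    simp [Complex.mul_conj, Complex.normSq_eq_norm_sq]
  rw [h2] at h
  exact Complex.ofReal_injective (by simpa using h.symm)

lemma theta_single_exp (hΨ : ContDiff ℝ ∞ Ψ) {η : Cn n → ℂ} (hη : IsTest η) (j : Fin n) (z : Cn n) :
    theta Ψ (fun k => if k = j then fun z => conj (η z) * ((Real.exp (1 * Ψ z) : ℝ) : ℂ)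
      else fun _ => 0) z = -(conj (dzb j η z) * ((Real.exp (1 * Ψ z) : ℝ) : ℂ)) := by
  rw [theta, Finset.sum_eq_single j]
  · simp only [if_true, dl]
    rw [dz_mul hη.conjugate.smooth.differentiableAt_top
      (contDiff_exp_mul hΨ 1).differentiableAt_top, dz_conj hη.smooth.differentiableAt_top,
      dz_exp_mul hΨ]
    push_cast
    ring
  · intro k _ hk
    simp [hk, dl, dz]
  · simp

lemma differentiable_of_dzb_eq_zero (hF : ContDiff ℝ ∞ F) (h : ∀ j z, dzb j F z = 0) :
    Differentiable ℂ F := by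
  intro z
  rw [differentiableAt_iff_restrictScalars ℝ hF.differentiableAt_top]
  refine ⟨∑ j, (ContinuousLinearMap.proj (R := ℂ) (φ := fun _ : Fin n => ℂ) j).smulRight
    (fderiv ℝ F z (Pi.single j 1)), ?_⟩
  ext v
  have hI : ∀ j, fderiv ℝ F z (Pi.single j Complex.I)
      = Complex.I * fderiv ℝ F z (Pi.single j 1) := fun j => by
    have := h j z
    rw [dzb, div_eq_zero_iff, or_iff_left two_ne_zero] at this
    linear_combination (-Complex.I) * this + fderiv ℝ F z (Pi.single j Complex.I) * Complex.I_sq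
  have hv : v = ∑ j, ((v j).re • (Pi.single j 1 : Cn n) + (v j).im • (Pi.single j Complex.I : Cn n)) := by
    ext k
    rw [Finset.sum_apply, Finset.sum_eq_single k]
    · simp
    · intro j _ hj
      simp [hj.symm]
    · simp
  conv_rhs => rw [hv]
  rw [map_sum, ContinuousLinearMap.coe_restrictScalars', sum_apply]
  refine Finset.sum_congr rfl fun j _ => ?_
  rw [map_add, map_smul, map_smul, hI]
  simp only [ContinuousLinearMap.smulRight_apply, ContinuousLinearMap.proj_apply, smul_eq_mul,
    Complex.real_smul]
  linear_combination (-fderiv ℝ F z (Pi.single j 1)) * Complex.re_add_im (v j)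

lemma differentiable_cv_of_weak {ρ : Cn n → ℝ} {δ : ℝ} (hρ : IsMollifier ρ δ)
    (ha : LocallyIntegrable a) (h : ∀ η, IsTest η → ∀ j, ∫ z, dzb j η z * a z = 0) :
    Differentiable ℂ (cv (fun z => (ρ z : ℂ)) a) := by
  refine differentiable_of_dzb_eq_zero (contDiff_cv hρ.isTest ha) fun j z => ?_
  rw [dzb_cv hρ.isTest ha, cv]
  have h1 := h _ (isTest_comp_sub hρ.isTest z) j
  simp_rw [dzb_comp_sub hρ.isTest.smooth, neg_mul, integral_neg, neg_eq_zero] at h1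
  exact h1

lemma exists_weak_solution (hΨ : ContDiff ℝ ∞ Ψ) (hg : IsTest g) {b : Cn n → ℝ}
    (hb : Integrable b (wt Ψ))
    (h : ∀ z, ∀ v : Fin n → ℂ, 2 * ‖∑ j, dzb j g z * conj (v j)‖ ≤ b z + levi Ψ z v) :
    ∃ u : Cn n → ℂ, MemLp u 2 (wt Ψ) ∧ ∫ z, ‖u z‖ ^ 2 ∂(wt Ψ) ≤ 2 * ∫ z, b z ∂(wt Ψ) ∧
      ∀ η, IsTest η → ∀ j, ∫ z, dzb j η z * (g z - u z) = 0 := by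
  have hc := hΨ.continuous
  obtain ⟨u, hu, h1, -, h2⟩ := exists_proj_closure_span (thetaRange hΨ) ((hg.memLp_wt hc).toLp g)
  have hest : ∀ x ∈ closure (thetaRange hΨ : Set (Lp ℂ 2 (wt Ψ))),
      2 * ‖⟪x, (hg.memLp_wt hc).toLp g⟫_ℂ‖ ≤ (∫ z, b z ∂(wt Ψ)) + 3 / 2 * ‖x‖ ^ 2 := by
    intro x hx
    have hcl : IsClosed {x : Lp ℂ 2 (wt Ψ) | 2 * ‖⟪x, (hg.memLp_wt hc).toLp g⟫_ℂ‖
        ≤ (∫ z, b z ∂(wt Ψ)) + 3 / 2 * ‖x‖ ^ 2} := by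
      refine isClosed_le ?_ ?_
      · exact continuous_const.mul (continuous_id.inner continuous_const).norm
      · fun_prop
    refine closure_minimal ?_ hcl hx
    rintro x ⟨α, hα, rfl⟩
    simp only [Set.mem_ofPred_eq]
    rw [inner_toLp_toLp, norm_toLp_sq]
    exact theta_estimate hΨ hg hb h hα
  have hm : MemLp u 2 (wt Ψ) := Lp.memLp u
  refine ⟨u, hm, ?_, fun η hη j => ?_⟩
  · have h3 := hest u hu
    rw [h2, inner_self_eq_norm_sq_to_K, norm_pow] at h3
    have h4 := norm_toLp_sq hm
    rw [Lp.toLp_coeFn] at h4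
    rw [← h4]
    simp at h3
    linarith
  · have hα : ∀ k, IsTest (if k = j then fun z => conj (η z) * ((Real.exp (1 * Ψ z) : ℝ) : ℂ)
        else fun _ => 0) := fun k => by
      split_ifs
      · exact hη.conjugate.mul_right (contDiff_exp_mul hΨ 1)
      · exact IsTest.zero
    have h3 := h1 _ ⟨_, hα, rfl⟩
    rw [inner_toLp_left, inner_toLp_toLp] at h3
    simp only [theta_single_exp hΨ hη, map_neg, mul_neg, integral_neg, neg_inj,
      integral_wt_mul_conj_exp hc] at h3
    simp_rw [mul_sub]
    rw [integral_sub, h3, sub_self]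
    · exact (hη.dzb j).integrable_mul hg.continuous.locallyIntegrable
    · exact (hη.dzb j).integrable_mul (locallyIntegrable_of_memLp_wt hc hm)

/-- Hörmander's `L²` estimate: a test function is approximated by an entire function with an
error controlled by its `∂̄`-derivative. -/
theorem exists_entire_approx (hΨ : ContDiff ℝ ∞ Ψ) (hg : IsTest g) {b : Cn n → ℝ}
    (hb : Integrable b (wt Ψ))
    (h : ∀ z, ∀ v : Fin n → ℂ, 2 * ‖∑ j, dzb j g z * conj (v j)‖ ≤ b z + levi Ψ z v)
    {K : Set (Cn n)} (hK : IsCompact K) {ε : ℝ} (hε : 0 < ε) :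
    ∃ F : Cn n → ℂ, Differentiable ℂ F ∧
      ∫ z in K, ‖g z - F z‖ ^ 2 ∂(wt Ψ) ≤ 8 * (∫ z, b z ∂(wt Ψ)) + ε := by
  have hc := hΨ.continuous
  have hlf := isLocallyFinite_wt hc
  obtain ⟨u, hu, hu2, hw⟩ := exists_weak_solution hΨ hg hb h
  obtain ⟨m, hm⟩ : ∃ m, m = (wt Ψ).real K := ⟨_, rfl⟩
  have hm0 : 0 ≤ m := hm ▸ measureReal_nonneg
  obtain ⟨κ, hκ⟩ : ∃ κ, κ = min 1 (ε / (2 * (1 + m))) := ⟨_, rfl⟩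
  have hκ0 : 0 < κ := by rw [hκ]; positivity
  have hκm : 2 * κ ^ 2 * m ≤ ε := by
    have h1 : κ ≤ 1 := hκ ▸ min_le_left _ _
    have h2 : κ ≤ ε / (2 * (1 + m)) := hκ ▸ min_le_right _ _
    rw [le_div_iff₀ (by positivity)] at h2
    nlinarith [mul_nonneg hm0 (mul_nonneg hκ0.le (sub_nonneg.2 h1))]
  obtain ⟨δ, hδ, hδK⟩ := exists_mollifier_scale hΨ hg.continuous hK hκ0
  obtain ⟨ρ, hρ⟩ := exists_isMollifier n hδ
  have hul := locallyIntegrable_of_memLp_wt hc hu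
  have hgl : LocallyIntegrable g := hg.continuous.locallyIntegrable
  obtain ⟨N, hN⟩ : ∃ N : Cn n → ℝ,
    N = fun z => (cv (fun z => (ρ z : ℂ)) (fun ζ => (‖u ζ‖ : ℂ)) z).re := ⟨_, rfl⟩
  have hNc : Continuous N := hN ▸ Complex.continuous_re.comp
    (contDiff_cv hρ.isTest (locallyIntegrable_ofReal_norm hul)).continuous
  have hNi : IntegrableOn (fun z => N z ^ 2) K (wt Ψ) :=
    (hNc.pow 2).continuousOn.integrableOn_compact hK
  have h1K : IntegrableOn (fun _ => (1 : ℝ)) K (wt Ψ) :=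
    continuous_const.continuousOn.integrableOn_compact hK
  have hNu : ∫ z in K, N z ^ 2 ∂(wt Ψ) ≤ 2 * ∫ z, ‖u z‖ ^ 2 ∂(wt Ψ) := by
    rw [hN]
    exact integral_cv_norm_sq_le hc hρ hul (hu.integrable_norm_pow two_ne_zero) hK
      fun z hz ζ hζ => (hδK z hz ζ hζ).2.2
  have hFd : Differentiable ℂ (cv (fun z => (ρ z : ℂ)) fun z => g z - u z) :=
    differentiable_cv_of_weak hρ (hgl.sub hul) hw
  refine ⟨_, hFd, ?_⟩
  have hpt : ∀ z ∈ K, ‖g z - cv (fun z => (ρ z : ℂ)) (fun z => g z - u z) z‖ ^ 2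
      ≤ 2 * κ ^ 2 * 1 + 2 * N z ^ 2 := by
    intro z hz
    have e1 : cv (fun z => (ρ z : ℂ)) (fun z => g z - u z) z
        = cv (fun z => (ρ z : ℂ)) g z - cv (fun z => (ρ z : ℂ)) u z := by
      simp only [cv, mul_sub]
      exact integral_sub (integrable_cv hρ.isTest hgl z) (integrable_cv hρ.isTest hul z)
    have e2 := norm_cv_sub_le hρ hg.continuous (fun ζ hζ => (hδK z hz ζ hζ).1)
    have e3 : ‖cv (fun z => (ρ z : ℂ)) u z‖ ≤ N z := by
      have := norm_cv_le (κ := 1) (z := z) hρ hul (h := u) fun ζ _ => by rw [one_mul]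
      rw [hN]
      simpa using this
    have e4 : ‖g z - cv (fun z => (ρ z : ℂ)) (fun z => g z - u z) z‖ ≤ κ + N z := by
      rw [e1, ← sub_add]
      refine (norm_add_le _ _).trans (add_le_add ?_ e3)
      rwa [norm_sub_rev]
    refine (pow_le_pow_left₀ (norm_nonneg _) e4 2).trans ?_
    nlinarith [sq_nonneg (κ - N z)]
  have hi := (h1K.const_mul (2 * κ ^ 2)).add (hNi.const_mul 2)
  calc _ ≤ ∫ z in K, (2 * κ ^ 2 * 1 + 2 * N z ^ 2) ∂(wt Ψ) := by
        refine setIntegral_mono_on ?_ hi hK.measurableSet hpt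
        exact (((hg.continuous.sub hFd.continuous).norm.pow 2).continuousOn.integrableOn_compact hK)
    _ = 2 * κ ^ 2 * m + 2 * ∫ z in K, N z ^ 2 ∂(wt Ψ) := by
        rw [integral_add (h1K.const_mul (2 * κ ^ 2)) (hNi.const_mul 2), integral_const_mul,
          integral_const_mul]
        simp [hm]
    _ ≤ _ := by linarith

end Hormander

section Subharmonic

open scoped ComplexConjugate
open Real (circleAverage)

/-- An integrable upper semicontinuous function is dominated by a continuous function with almost
the same integral. -/
lemma UpperSemicontinuous.exists_continuous_gt {X : Type*} [TopologicalSpace X] [MeasurableSpace X]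
    [BorelSpace X] [NormalSpace X] [ParacompactSpace X] [CompactSpace X] {μ : Measure X}
    [IsFiniteMeasure μ] [μ.WeaklyRegular] {H : X → ℝ} (hH : UpperSemicontinuous H)
    (hint : Integrable H μ) {ε : ℝ} (hε : 0 < ε) :
    ∃ c : C(X, ℝ), (∀ x, H x < c x) ∧ ∫ x, c x ∂μ < ∫ x, H x ∂μ + ε := by
  obtain ⟨g, hHg, hg, hgint, hgtop, hlt⟩ := exists_lt_lowerSemicontinuous_integral_lt H hint hε
  obtain ⟨c, hc⟩ := exists_continuous_forall_mem_convex_of_local_const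
    (t := fun x => {y : ℝ | H x < y ∧ (y : EReal) < g x})
    (fun x => by
      refine Set.OrdConnected.convex ⟨fun a ha b hb y hy => ⟨ha.1.trans_le hy.1, ?_⟩⟩
      exact lt_of_le_of_lt (by exact_mod_cast hy.2) hb.2)
    (fun x => by
      obtain ⟨q, hq1, hq2⟩ := EReal.exists_rat_btwn_of_lt (hHg x)
      refine ⟨(q : ℝ), ?_⟩
      have hq1 : H x < (q : ℝ) := by exact_mod_cast hq1
      filter_upwards [hH x _ hq1, hg x _ hq2] with y h1 h2
      exact ⟨h1, h2⟩)
  refine ⟨c, fun x => (hc x).1, lt_of_le_of_lt (integral_mono_ae ?_ hgint ?_) hlt⟩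
  · exact c.continuous.integrable_of_hasCompactSupport (HasCompactSupport.of_compactSpace _)
  · filter_upwards [hgtop] with x hx
    have := (hc x).2
    have h2 : ((g x).toReal : EReal) = g x := EReal.coe_toReal hx.ne (ne_bot_of_gt this)
    have h3 : ((c x : ℝ) : EReal) < ((g x).toReal : EReal) := by rw [h2]; exact this
    exact (by exact_mod_cast h3 : c x < (g x).toReal).le

/-- A trigonometric polynomial is the sum of a holomorphic and an antiholomorphic polynomial. -/
lemma exists_entire_of_mem_span_fourier {T : ℝ} {p : C(AddCircle T, ℂ)}
    (hp : p ∈ Submodule.span ℂ (Set.range (@fourier T))) :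
    ∃ P Q : ℂ → ℂ, Differentiable ℂ P ∧ Differentiable ℂ Q ∧
      ∀ x, p x = P (x.toCircle) + conj (Q (x.toCircle)) := by
  induction hp using Submodule.span_induction with
  | mem p hp =>
    obtain ⟨k, rfl⟩ := hp
    obtain ⟨m, rfl | rfl⟩ := k.eq_nat_or_neg
    · refine ⟨fun z => z ^ m, fun _ => 0, by fun_prop, by fun_prop, fun x => ?_⟩
      simp [fourier_apply, AddCircle.toCircle_nsmul]
    · refine ⟨fun _ => 0, fun z => z ^ m, by fun_prop, by fun_prop, fun x => ?_⟩
      rw [fourier_apply, AddCircle.toCircle_zsmul]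
      simp [← Circle.coe_inv_eq_conj]
  | zero => exact ⟨0, 0, by fun_prop, by fun_prop, by simp⟩
  | add p q _ _ hp hq =>
    obtain ⟨P, Q, hP, hQ, h⟩ := hp
    obtain ⟨P', Q', hP', hQ', h'⟩ := hq
    refine ⟨P + P', Q + Q', hP.add hP', hQ.add hQ', fun x => ?_⟩
    simp [h, h']; ring
  | smul a p _ hp =>
    obtain ⟨P, Q, hP, hQ, h⟩ := hp
    refine ⟨a • P, conj a • Q, hP.const_smul a, hQ.const_smul _, fun x => ?_⟩
    simp [h]; ring

lemma exists_entire_re_approx {T : ℝ} [Fact (0 < T)] (c : C(AddCircle T, ℝ)) {ε : ℝ}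
    (hε : 0 < ε) :
    ∃ P : ℂ → ℂ, Differentiable ℂ P ∧ ∀ x : AddCircle T, |(P x.toCircle).re - c x| < ε := by
  have hmem : (⟨fun x => (c x : ℂ), by fun_prop⟩ : C(AddCircle T, ℂ)) ∈
      closure (Submodule.span ℂ (Set.range (@fourier T)) : Set C(AddCircle T, ℂ)) := by
    rw [← Submodule.topologicalClosure_coe, span_fourier_closure_eq_top]; trivial
  obtain ⟨p, hp, hlt⟩ := Metric.mem_closure_iff.1 hmem ε hε
  obtain ⟨P, Q, hP, hQ, h⟩ := exists_entire_of_mem_span_fourier hp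
  refine ⟨P + Q, hP.add hQ, fun x => ?_⟩
  have h1 := (ContinuousMap.dist_lt_iff hε).1 hlt x
  rw [Complex.dist_eq] at h1
  refine lt_of_le_of_lt ?_ h1
  rw [norm_sub_rev]
  refine le_trans (le_of_eq ?_) (Complex.abs_re_le_norm _)
  simp [h]

lemma UpperSemicontinuous.circleIntegrable {h : ℂ → ℝ} (hh : UpperSemicontinuous h)
    (hb : ∀ R : ℝ, ∃ C, ∀ z, ‖z‖ ≤ R → |h z| ≤ C) (c : ℂ) (r : ℝ) : CircleIntegrable h c r := by
  obtain ⟨C, hC⟩ := hb (‖c‖ + |r|)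
  have hm : Measurable fun θ => h (circleMap c r θ) :=
    hh.measurable.comp (continuous_circleMap c r).measurable
  refine (intervalIntegrable_const (c := C)).mono_fun hm.aestronglyMeasurable ?_
  refine ae_of_all _ fun θ => ?_
  have h1 : ‖circleMap c r θ‖ ≤ ‖c‖ + |r| := by
    refine (norm_add_le _ _).trans ?_
    simp
  exact (hC _ h1).trans (le_abs_self _)

lemma circleAverage_re_of_differentiable {P : ℂ → ℂ} (hP : Differentiable ℂ P) (c : ℂ) (r : ℝ) :
    circleAverage (fun z => (P z).re) c r = (P c).re := by
  have h1 : circleAverage P c r = P c := DiffContOnCl.circleAverage hP.diffContOnCl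
  have h2 := Complex.reCLM.circleAverage_comp_comm (f := P) (c := c) (R := r)
    hP.continuous.continuousOn.circleIntegrable'
  rw [h1] at h2
  exact h2

/-- Comparison of a locally subharmonic function with a harmonic function on the unit disc. -/
lemma le_re_of_le_on_sphere {h : ℂ → ℝ} (hh : UpperSemicontinuous h)
    (hb : ∀ R : ℝ, ∃ C, ∀ z, ‖z‖ ≤ R → |h z| ≤ C)
    (hloc : ∀ z, ∃ ε > 0, ∀ r : ℝ, 0 < r → r < ε → h z ≤ circleAverage h z r)
    {P : ℂ → ℂ} (hP : Differentiable ℂ P) (hle : ∀ z, ‖z‖ = 1 → h z ≤ (P z).re) {η : ℝ}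
    (hη : 0 < η) : h 0 ≤ (P 0).re + η := by
  obtain ⟨a, ha, hmax⟩ := UpperSemicontinuousOn.exists_isMaxOn
    (f := fun z => h z + (-(P z).re + η * ‖z‖ ^ 2))
    (Metric.nonempty_closedBall.2 zero_le_one) (isCompact_closedBall (0 : ℂ) 1)
    ((hh.add (Continuous.upperSemicontinuous (by
      have := hP.continuous
      fun_prop))).upperSemicontinuousOn _)
  have ha' : ‖a‖ ≤ 1 := by simpa using ha
  rcases ha'.lt_or_eq with hlt | heq
  · exfalso
    obtain ⟨ε, hε, hsub⟩ := hloc a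
    obtain ⟨r, hr0, hr⟩ := exists_between (lt_min hε (sub_pos.2 hlt))
    have hr1 := hr.trans_le (min_le_left _ _)
    have hr2 := hr.trans_le (min_le_right _ _)
    have h1 := hsub r hr0 hr1
    have hQ : Differentiable ℂ fun z => P z - 2 * η * (conj a * (z - a)) +
        (h a - (P a).re - η * r ^ 2 : ℝ) := by fun_prop
    have h2 := circleAverage_re_of_differentiable hQ a r
    have h3 : circleAverage h a r ≤ circleAverage (fun z => (P z - 2 * η * (conj a * (z - a)) +
        (h a - (P a).re - η * r ^ 2 : ℝ)).re) a r := by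
      refine Real.circleAverage_mono (hh.circleIntegrable hb _ _)
        ((Complex.continuous_re.comp hQ.continuous).continuousOn.circleIntegrable') ?_
      intro z hz
      have hz' : ‖z - a‖ = r := by
        rw [abs_of_pos hr0] at hz; simpa [dist_eq_norm] using hz
      have hz1 : ‖z‖ ≤ 1 := by
        have := norm_le_norm_add_norm_sub a z
        rw [norm_sub_rev, hz'] at this
        linarith
      have hm := hmax (show z ∈ Metric.closedBall (0 : ℂ) 1 by simpa using hz1)
      simp only [Set.mem_ofPred_eq] at hm
      have hn : ‖z‖ ^ 2 = ‖a‖ ^ 2 + 2 * (conj a * (z - a)).re + r ^ 2 := by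
        rw [← hz']
        simp only [← Complex.normSq_eq_norm_sq, Complex.normSq_apply, Complex.sub_re,
          Complex.sub_im, Complex.mul_re, Complex.conj_re, Complex.conj_im]
        ring
      rw [hn] at hm
      have e1 : (P z - 2 * η * (conj a * (z - a)) + (h a - (P a).re - η * r ^ 2 : ℝ)).re =
          (P z).re - 2 * η * (conj a * (z - a)).re + (h a - (P a).re - η * r ^ 2) := by
        have : (2 * (η : ℂ) * (conj a * (z - a))).re = 2 * η * (conj a * (z - a)).re := by
          rw [show (2 * (η : ℂ)) = ((2 * η : ℝ) : ℂ) by push_cast; ring, Complex.re_ofReal_mul]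
        rw [Complex.add_re, Complex.sub_re, this, Complex.ofReal_re]
      rw [e1]
      linarith
    rw [h2, Complex.add_re, Complex.ofReal_re, sub_self, mul_zero, mul_zero, sub_zero] at h3
    have : 0 < η * r ^ 2 := by positivity
    linarith
  · have hm := hmax (show (0 : ℂ) ∈ Metric.closedBall (0 : ℂ) 1 by simp)
    simp only [Set.mem_ofPred_eq, norm_zero, heq] at hm
    have := hle a heq
    linarith

/-- A locally subharmonic function satisfies the sub-mean value inequality on the unit circle. -/
theorem le_circleAverage_of_local {h : ℂ → ℝ} (hh : UpperSemicontinuous h)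
    (hb : ∀ R : ℝ, ∃ C, ∀ z, ‖z‖ ≤ R → |h z| ≤ C)
    (hloc : ∀ z, ∃ ε > 0, ∀ r : ℝ, 0 < r → r < ε → h z ≤ circleAverage h z r) :
    h 0 ≤ circleAverage h 0 1 := by
  have hpi : Fact (0 < 2 * Real.pi) := ⟨Real.two_pi_pos⟩
  obtain ⟨C, hC⟩ := hb 1
  obtain ⟨H, hHdef⟩ : ∃ H : AddCircle (2 * Real.pi) → ℝ, H = fun x => h x.toCircle := ⟨_, rfl⟩
  have hcirc : Continuous fun x : AddCircle (2 * Real.pi) => (x.toCircle : ℂ) :=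
    continuous_subtype_val.comp AddCircle.continuous_toCircle
  have hH : UpperSemicontinuous H := by
    rw [hHdef]; exact hh.comp hcirc
  have hHint : Integrable H := by
    refine Integrable.of_bound hH.measurable.aestronglyMeasurable C (ae_of_all _ fun x => ?_)
    rw [hHdef]
    exact hC _ (Circle.norm_coe _).le
  have key (g : ℂ → ℝ) : circleAverage g 0 1 =
      (2 * Real.pi)⁻¹ * ∫ x : AddCircle (2 * Real.pi), g x.toCircle := by
    rw [← AddCircle.intervalIntegral_preimage (2 * Real.pi) 0
      (fun x : AddCircle (2 * Real.pi) => g x.toCircle), zero_add]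
    rw [Real.circleAverage, smul_eq_mul]
    congr 1
    refine intervalIntegral.integral_congr fun θ _ => ?_
    simp [AddCircle.toCircle_apply_mk, circleMap, Circle.coe_exp]
  refine le_of_forall_pos_le_add fun ε hε => ?_
  obtain ⟨c, hc, hlt⟩ := hH.exists_continuous_gt hHint (show 0 < ε / 4 * (2 * Real.pi) by positivity)
  obtain ⟨P, hP, hPc⟩ := exists_entire_re_approx c (show 0 < ε / 4 by positivity)
  have hsurj (z : ℂ) (hz : ‖z‖ = 1) : ∃ x : AddCircle (2 * Real.pi), (x.toCircle : ℂ) = z := by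
    refine ⟨(z.arg : ℝ), ?_⟩
    rw [AddCircle.toCircle_apply_mk, Circle.coe_exp]
    have := Complex.norm_mul_exp_arg_mul_I z
    rw [hz, Complex.ofReal_one, one_mul] at this
    rw [div_self (by positivity), one_mul, this]
  have h1 : h 0 ≤ (P 0 + (ε / 4 : ℝ)).re + ε / 4 := by
    refine le_re_of_le_on_sphere (P := fun z => P z + (ε / 4 : ℝ)) hh hb hloc (by fun_prop)
      (fun z hz => ?_) (by positivity)
    obtain ⟨x, rfl⟩ := hsurj z hz
    have e1 := abs_lt.1 (hPc x)
    have e2 := hc x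
    rw [hHdef] at e2
    rw [Complex.add_re, Complex.ofReal_re]
    linarith [e1.1]
  rw [Complex.add_re, Complex.ofReal_re, ← circleAverage_re_of_differentiable hP 0 1, key] at h1
  have h2 : ∫ x : AddCircle (2 * Real.pi), (P x.toCircle).re ≤
      ∫ x : AddCircle (2 * Real.pi), (c x + ε / 4) := by
    refine integral_mono ?_ ?_ fun x => ?_
    · exact (Complex.continuous_re.comp (hP.continuous.comp hcirc)).integrable_of_hasCompactSupport
        (HasCompactSupport.of_compactSpace _)
    · exact (c.continuous.add continuous_const).integrable_of_hasCompactSupport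
        (HasCompactSupport.of_compactSpace _)
    · have := abs_lt.1 (hPc x)
      change (P x.toCircle).re ≤ c x + ε / 4
      linarith [this.2]
  have h3 : ∫ x : AddCircle (2 * Real.pi), (c x + ε / 4) =
      (∫ x : AddCircle (2 * Real.pi), c x) + ε / 4 * (2 * Real.pi) := by
    rw [integral_add (c.continuous.integrable_of_hasCompactSupport
        (HasCompactSupport.of_compactSpace _)) (integrable_const _), integral_const]
    rw [measureReal_def, AddCircle.measure_univ, ENNReal.toReal_ofReal (by positivity), smul_eq_mul]
    ring
  have h4 : (2 * Real.pi)⁻¹ * ∫ x : AddCircle (2 * Real.pi), (P x.toCircle).re ≤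
      (2 * Real.pi)⁻¹ * ((∫ x : AddCircle (2 * Real.pi), H x) + ε / 2 * (2 * Real.pi)) := by
    refine mul_le_mul_of_nonneg_left ?_ (by positivity)
    linarith
  rw [mul_add, show (2 * Real.pi)⁻¹ * (ε / 2 * (2 * Real.pi)) = ε / 2 by
    field_simp] at h4
  have h5 : (2 * Real.pi)⁻¹ * ∫ x : AddCircle (2 * Real.pi), H x = circleAverage h 0 1 := by
    rw [key, hHdef]
  rw [h5] at h4
  linarith

lemma lineAvg_eq_circleAverage (v : Cn n → ℝ) (z w : Cn n) (a : ℂ) (r : ℝ) :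
    lineAvg v (z + a • w) ((r : ℂ) • w) = circleAverage (fun l : ℂ => v (z + l • w)) a r := by
  rw [lineAvg, Real.circleAverage]
  congr 1
  refine intervalIntegral.integral_congr fun θ _ => ?_
  simp only [circleMap, add_smul, smul_smul, mul_comm Complex.I, add_assoc,
    mul_comm (r : ℂ)]

/-- A bounded upper semicontinuous function which satisfies the sub-mean value inequality on small
circles in complex lines satisfies it on all circles in complex lines. -/
theorem le_lineAvg_of_local {v : Cn n → ℝ} (hv : UpperSemicontinuous v)
    (hb : ∀ R : ℝ, ∃ C, ∀ z, ‖z‖ ≤ R → |v z| ≤ C)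
    (hloc : ∀ z w, ∃ ε > 0, ∀ r : ℝ, 0 < r → r < ε → v z ≤ lineAvg v z ((r : ℂ) • w))
    (z w : Cn n) : v z ≤ lineAvg v z w := by
  have h := le_circleAverage_of_local (h := fun l : ℂ => v (z + l • w))
    (hv.comp (by fun_prop)) (fun R => ?_) (fun a => ?_)
  · have e := lineAvg_eq_circleAverage v z w 0 1
    simp only [zero_smul, add_zero, Complex.ofReal_one, one_smul] at e h
    rw [e]
    exact h
  · obtain ⟨C, hC⟩ := hb (‖z‖ + R * ‖w‖)
    refine ⟨C, fun l hl => hC _ ((norm_add_le _ _).trans ?_)⟩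
    rw [norm_smul]
    gcongr
  · obtain ⟨ε, hε, h⟩ := hloc (z + a • w) w
    refine ⟨ε, hε, fun r h0 h1 => ?_⟩
    rw [← lineAvg_eq_circleAverage]
    exact h r h0 h1

end Subharmonic

section LeviForm

open scoped ComplexConjugate

variable {Ψ V : Cn n → ℝ} {a : Cn n → ℂ} {z : Cn n}

lemma clm_apply_eq_sum (L : Cn n →L[ℝ] ℂ) (α : Cn n) :
    L α = ∑ j, ((α j).re * L (Pi.single j 1) + (α j).im * L (Pi.single j Complex.I)) := by
  have h : α = ∑ j, ((α j).re • (Pi.single j 1 : Cn n) + (α j).im • (Pi.single j Complex.I : Cn n)) := by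
    ext k
    simp only [Finset.sum_apply, Pi.add_apply, Pi.smul_apply]
    rw [Finset.sum_eq_single k]
    · simp only [Pi.single_eq_same, Complex.real_smul, mul_one]
      exact (Complex.re_add_im (α k)).symm
    · intro j _ hj
      simp [Pi.single_eq_of_ne hj.symm]
    · simp
  conv_lhs => rw [h]
  simp only [map_sum, map_add, map_smul, Complex.real_smul]

lemma sum_dz_mul (α : Cn n) : ∑ j, dz j a z * α j =
    (fderiv ℝ a z α - Complex.I * fderiv ℝ a z (Complex.I • α)) / 2 := by
  rw [clm_apply_eq_sum _ α, clm_apply_eq_sum _ (Complex.I • α), Finset.mul_sum,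
    ← Finset.sum_sub_distrib, Finset.sum_div]
  refine Finset.sum_congr rfl fun j _ => ?_
  simp only [dz, Pi.smul_apply, smul_eq_mul, Complex.I_mul_re, Complex.I_mul_im,
    Complex.ofReal_neg]
  conv_lhs => rw [← Complex.re_add_im (α j)]
  linear_combination (-
    (α j).im * fderiv ℝ a z (Pi.single j Complex.I) / 2) * Complex.I_sq

lemma sum_dzb_mul_conj (α : Cn n) : ∑ j, dzb j a z * conj (α j) =
    (fderiv ℝ a z α + Complex.I * fderiv ℝ a z (Complex.I • α)) / 2 := by
  rw [clm_apply_eq_sum _ α, clm_apply_eq_sum _ (Complex.I • α), Finset.mul_sum,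
    ← Finset.sum_add_distrib, Finset.sum_div]
  refine Finset.sum_congr rfl fun j _ => ?_
  simp only [dzb, Pi.smul_apply, smul_eq_mul, Complex.I_mul_re, Complex.I_mul_im,
    Complex.ofReal_neg]
  conv_lhs => rw [← Complex.re_add_im (α j)]
  simp only [map_add, map_mul, Complex.conj_ofReal, Complex.conj_I]
  linear_combination (-
    (α j).im * fderiv ℝ a z (Pi.single j Complex.I) / 2) * Complex.I_sq

lemma fderiv_ofReal_apply (hV : DifferentiableAt ℝ V z) (v : Cn n) :
    fderiv ℝ (fun z => (V z : ℂ)) z v = (fderiv ℝ V z v : ℂ) := by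
  have h := (Complex.ofRealCLM.hasFDerivAt.comp z hV.hasFDerivAt).fderiv
  change fderiv ℝ (fun z => (V z : ℂ)) z = _ at h
  rw [h]; rfl

/-- The Levi form in terms of the real Hessian. -/
lemma levi_eq (hV : ContDiff ℝ ∞ V) (z : Cn n) (α : Cn n) :
    levi V z α = (fderiv ℝ (fderiv ℝ V) z α α +
      fderiv ℝ (fderiv ℝ V) z (Complex.I • α) (Complex.I • α)) / 4 := by
  have hd : Differentiable ℝ V := hV.differentiable (by simp)
  have hd2 : DifferentiableAt ℝ (fderiv ℝ V) z :=
    (hV.fderiv_right (m := ∞) (by simp)).differentiable (by simp) z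
  obtain ⟨A, hA⟩ : ∃ A : Cn n → ℂ, A = fun z => ∑ j, dPsi V j z * α j := ⟨_, rfl⟩
  have hA' : A = fun z => ((fderiv ℝ V z α : ℂ) - Complex.I * fderiv ℝ V z (Complex.I • α)) / 2 := by
    rw [hA]; funext z
    simp only [dPsi]
    rw [sum_dz_mul, fderiv_ofReal_apply (hd z), fderiv_ofReal_apply (hd z)]
  have hfd (v : Cn n) : HasFDerivAt (fun z => (fderiv ℝ V z v : ℂ))
      (Complex.ofRealCLM.comp ((fderiv ℝ (fderiv ℝ V) z).flip v)) z := by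
    have := hd2.hasFDerivAt.clm_apply (hasFDerivAt_const v z)
    refine (Complex.ofRealCLM.hasFDerivAt.comp z this).congr_fderiv ?_
    ext w; simp
  have hAd (w : Cn n) : fderiv ℝ A z w = ((fderiv ℝ (fderiv ℝ V) z w α : ℂ) -
      Complex.I * fderiv ℝ (fderiv ℝ V) z w (Complex.I • α)) / 2 := by
    have h1 := ((hfd α).sub ((hfd (Complex.I • α)).const_mul Complex.I)).mul_const (2⁻¹ : ℂ)
    have h2 : HasFDerivAt A _ z := h1.congr_of_eventuallyEq (Eventually.of_forall fun x => by
      rw [hA']; simp [div_eq_mul_inv])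
    rw [h2.fderiv]
    simp [div_eq_mul_inv, mul_comm]
  have hs : (∑ j, ∑ k, dzb k (dPsi V j) z * α j * conj (α k)) = ∑ k, dzb k A z * conj (α k) := by
    rw [Finset.sum_comm]
    refine Finset.sum_congr rfl fun k _ => ?_
    rw [← Finset.sum_mul]
    congr 1
    have h3 (w : Cn n) : fderiv ℝ A z w = ∑ j, fderiv ℝ (dPsi V j) z w * α j := by
      have : HasFDerivAt A (∑ j, (α j) • fderiv ℝ (dPsi V j) z) z := by
        rw [hA]
        refine HasFDerivAt.fun_sum fun j _ => ?_
        exact ((contDiff_dPsi hV j).differentiableAt_top.hasFDerivAt).mul_const _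
      rw [this.fderiv]
      simp [mul_comm]
    simp only [dzb, h3, Finset.mul_sum, ← Finset.sum_add_distrib, Finset.sum_div]
    refine Finset.sum_congr rfl fun j _ => by ring
  rw [levi, hs, sum_dzb_mul_conj, hAd, hAd]
  simp
  ring

lemma second_order_bound {E : Type*} [NormedAddCommGroup E] [NormedSpace ℝ E] {V : E → ℝ}
    (hV : ContDiff ℝ ∞ V) (z : E) {ε : ℝ} (hε : 0 < ε) : ∃ δ > 0, ∀ h : E, ‖h‖ < δ →
      |V (z + h) - V z - fderiv ℝ V z h - fderiv ℝ (fderiv ℝ V) z h h / 2| ≤ ε * ‖h‖ ^ 2 := by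
  have hd : Differentiable ℝ V := hV.differentiable (by simp)
  have hd2 : DifferentiableAt ℝ (fderiv ℝ V) z :=
    (hV.fderiv_right (m := ∞) (by simp)).differentiable (by simp) z
  have hsymm : ∀ v w, fderiv ℝ (fderiv ℝ V) z v w = fderiv ℝ (fderiv ℝ V) z w v :=
    second_derivative_symmetric (f' := fderiv ℝ V) (fun y => (hd y).hasFDerivAt) hd2.hasFDerivAt
  have hlo := hasFDerivAt_iff_isLittleO_nhds_zero.1 hd2.hasFDerivAt
  obtain ⟨δ, hδ, hball⟩ := Metric.eventually_nhds_iff.1 (hlo.def hε)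
  refine ⟨δ, hδ, fun h hh => ?_⟩
  obtain ⟨R, hR⟩ : ∃ R : E → ℝ, R = fun h => V (z + h) - V z - fderiv ℝ V z h -
    fderiv ℝ (fderiv ℝ V) z h h / 2 := ⟨_, rfl⟩
  have hRd (x : E) : HasFDerivAt R (fderiv ℝ V (z + x) - fderiv ℝ V z -
      fderiv ℝ (fderiv ℝ V) z x) x := by
    have h1 : HasFDerivAt (fun h => V (z + h)) (fderiv ℝ V (z + x)) x := by
      have := (hd (z + x)).hasFDerivAt.comp x ((hasFDerivAt_id x).const_add z)
      rw [ContinuousLinearMap.comp_id] at this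
      exact this
    have h2 := ((fderiv ℝ (fderiv ℝ V) z).hasFDerivAt (x := x)).clm_apply (hasFDerivAt_id x)
    rw [hR]
    refine (((h1.sub_const (V z)).sub ((fderiv ℝ V z).hasFDerivAt)).sub
      (h2.mul_const (2⁻¹ : ℝ))).congr_fderiv ?_ |>.congr_of_eventuallyEq ?_
    · ext w
      simp [hsymm w x]; ring
    · exact Eventually.of_forall fun y => by simp [div_eq_mul_inv]
  have hmv := Convex.norm_image_sub_le_of_norm_hasFDerivWithin_le (f := R)
    (s := Metric.closedBall (0 : E) ‖h‖) (C := ε * ‖h‖) (x := 0) (y := h)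
    (fun x _ => (hRd x).hasFDerivWithinAt) (fun x hx => ?_) (convex_closedBall _ _)
    (by simp) (by simp)
  · have e0 : R 0 = 0 := by rw [hR]; simp
    rw [e0, sub_zero, sub_zero, hR] at hmv
    rw [Real.norm_eq_abs] at hmv
    linarith [hmv]
  · have hx' : ‖x‖ ≤ ‖h‖ := by simpa using hx
    have := hball (y := x) (by simpa using hx'.trans_lt hh)
    refine this.trans ?_
    gcongr

/-- A smooth function with the sub-mean value property has nonnegative Levi form. -/
lemma levi_nonneg (hV : ContDiff ℝ ∞ V) (hsub : ∀ w, V z ≤ lineAvg V z w) (α : Cn n) :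
    0 ≤ levi V z α := by
  rw [levi_eq hV]
  by_contra hneg
  push Not at hneg
  obtain ⟨B, hB⟩ : ∃ B, B = fderiv ℝ (fderiv ℝ V) z := ⟨_, rfl⟩
  obtain ⟨L, hL⟩ : ∃ L, L = fderiv ℝ V z := ⟨_, rfl⟩
  rw [← hB] at hneg
  obtain ⟨s, hs⟩ : ∃ s, s = B α α + B (Complex.I • α) (Complex.I • α) := ⟨_, rfl⟩
  rw [← hs] at hneg
  have hs0 : s < 0 := by linarith
  obtain ⟨δ, hδ, hbd⟩ := second_order_bound hV z
    (show 0 < -s / (8 * (‖α‖ + 1) ^ 2) by have := norm_nonneg α; apply div_pos <;> [linarith; positivity])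
  rw [← hB, ← hL] at hbd
  obtain ⟨t, ht0, ht⟩ : ∃ t : ℝ, 0 < t ∧ t * (‖α‖ + 1) < δ := by
    refine ⟨δ / 2 / (‖α‖ + 1), by positivity, ?_⟩
    rw [div_mul_cancel₀ _ (by positivity)]; linarith
  have hpt (θ : ℝ) : V (z + Complex.exp (Complex.I * θ) • ((t : ℂ) • α)) ≤
      V z + (t * L α) * Real.cos θ + (t * L (Complex.I • α)) * Real.sin θ +
        (t ^ 2 * B α α / 2) * Real.cos θ ^ 2 +
        (t ^ 2 * B (Complex.I • α) (Complex.I • α) / 2) * Real.sin θ ^ 2 +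
        (t ^ 2 * (B α (Complex.I • α) + B (Complex.I • α) α) / 2) * (Real.sin θ * Real.cos θ) +
        t ^ 2 * (-s / 8) := by
    have hh : Complex.exp (Complex.I * θ) • ((t : ℂ) • α) =
        (t * Real.cos θ) • α + (t * Real.sin θ) • (Complex.I • α) := by
      rw [mul_comm Complex.I, Complex.exp_mul_I]
      ext j
      simp only [Pi.smul_apply, Pi.add_apply, smul_eq_mul, Complex.real_smul]
      push_cast
      ring
    have hn : ‖Complex.exp (Complex.I * θ) • ((t : ℂ) • α)‖ = t * ‖α‖ := by
      rw [norm_smul, norm_exp_I_mul, one_mul, norm_smul, Complex.norm_real, Real.norm_of_nonneg ht0.le]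
    have h1 := hbd (Complex.exp (Complex.I * θ) • ((t : ℂ) • α)) (by
      rw [hn]; nlinarith [norm_nonneg α])
    rw [hn] at h1
    have h2 : -s / (8 * (‖α‖ + 1) ^ 2) * (t * ‖α‖) ^ 2 ≤ t ^ 2 * (-s / 8) := by
      have h3 : ‖α‖ ^ 2 / (‖α‖ + 1) ^ 2 ≤ 1 := by
        rw [div_le_one (by positivity)]
        have := norm_nonneg α
        gcongr; linarith
      calc -s / (8 * (‖α‖ + 1) ^ 2) * (t * ‖α‖) ^ 2
          = t ^ 2 * (-s / 8) * (‖α‖ ^ 2 / (‖α‖ + 1) ^ 2) := by field_simp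
        _ ≤ t ^ 2 * (-s / 8) * 1 := by
          have : 0 ≤ t ^ 2 * (-s / 8) := by
            apply mul_nonneg <;> [positivity; linarith]
          gcongr
        _ = _ := mul_one _
    have h4 := (abs_le.1 (h1.trans h2)).2
    have h5 : L (Complex.exp (Complex.I * θ) • ((t : ℂ) • α)) =
        t * Real.cos θ * L α + t * Real.sin θ * L (Complex.I • α) := by
      rw [hh, map_add, map_smul, map_smul, smul_eq_mul, smul_eq_mul]
    have h6 : B (Complex.exp (Complex.I * θ) • ((t : ℂ) • α))
        (Complex.exp (Complex.I * θ) • ((t : ℂ) • α)) =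
        t ^ 2 * (Real.cos θ ^ 2 * B α α + Real.sin θ ^ 2 * B (Complex.I • α) (Complex.I • α) +
          Real.sin θ * Real.cos θ * (B α (Complex.I • α) + B (Complex.I • α) α)) := by
      rw [hh]
      simp only [map_add, map_smul, add_apply, smul_apply, smul_eq_mul]
      ring
    rw [h5, h6] at h4
    linarith
  have hcont : Continuous fun θ : ℝ => V (z + Complex.exp (Complex.I * θ) • ((t : ℂ) • α)) :=
    hV.continuous.comp (by fun_prop)
  have hint := intervalIntegral.integral_mono_on (μ := volume) (a := 0) (b := 2 * Real.pi) (by positivity)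
    (hcont.intervalIntegrable _ _) (Continuous.intervalIntegrable (by fun_prop) _ _)
    (fun θ _ => hpt θ)
  have hz := hsub ((t : ℂ) • α)
  rw [lineAvg, smul_eq_mul] at hz
  have hpi := Real.pi_pos
  have hz' : 2 * Real.pi * V z ≤
      ∫ θ in (0 : ℝ)..(2 * Real.pi), V (z + Complex.exp (Complex.I * θ) • ((t : ℂ) • α)) := by
    have := mul_le_mul_of_nonneg_left hz (show 0 ≤ 2 * Real.pi by positivity)
    rwa [mul_inv_cancel_left₀ (by positivity)] at this
  have hI : (∫ θ in (0 : ℝ)..(2 * Real.pi), (V z + (t * L α) * Real.cos θ +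
        (t * L (Complex.I • α)) * Real.sin θ +
        (t ^ 2 * B α α / 2) * Real.cos θ ^ 2 +
        (t ^ 2 * B (Complex.I • α) (Complex.I • α) / 2) * Real.sin θ ^ 2 +
        (t ^ 2 * (B α (Complex.I • α) + B (Complex.I • α) α) / 2) * (Real.sin θ * Real.cos θ) +
        t ^ 2 * (-s / 8))) = 2 * Real.pi * V z + Real.pi * t ^ 2 * s / 2 +
        2 * Real.pi * (t ^ 2 * (-s / 8)) := by
    rw [intervalIntegral.integral_add, intervalIntegral.integral_add, intervalIntegral.integral_add,
      intervalIntegral.integral_add, intervalIntegral.integral_add, intervalIntegral.integral_add]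
    · simp only [intervalIntegral.integral_const_mul, intervalIntegral.integral_const, integral_cos,
        integral_sin, integral_cos_sq, integral_sin_sq, integral_sin_mul_cos₁]
      simp
      rw [hs]; ring
    all_goals exact Continuous.intervalIntegrable (by fun_prop) _ _
  have := hz'.trans hint
  rw [hI] at this
  have : 0 < Real.pi * t ^ 2 * (-s) := by
    have : 0 < -s := by linarith
    positivity
  nlinarith

lemma levi_add {V W : Cn n → ℝ} (hV : ContDiff ℝ ∞ V) (hW : ContDiff ℝ ∞ W) (z α : Cn n) :
    levi (fun z => V z + W z) z α = levi V z α + levi W z α := by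
  have h1 : fderiv ℝ (fun z => V z + W z) = fun z => fderiv ℝ V z + fderiv ℝ W z := by
    funext z
    exact fderiv_add (hV.differentiable (by simp) z) (hW.differentiable (by simp) z)
  have h2 : fderiv ℝ (fun z => fderiv ℝ V z + fderiv ℝ W z) z =
      fderiv ℝ (fderiv ℝ V) z + fderiv ℝ (fderiv ℝ W) z :=
    fderiv_add ((hV.fderiv_right (m := ∞) (by simp)).differentiable (by simp) z)
      ((hW.fderiv_right (m := ∞) (by simp)).differentiable (by simp) z)
  rw [levi_eq hV, levi_eq hW, levi_eq (hV.add hW), h1, h2]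
  simp only [add_apply]
  ring

lemma dzb_ofReal (hV : ContDiff ℝ ∞ V) (k : Fin n) (z : Cn n) :
    dzb k (fun z => (V z : ℂ)) z = conj (dPsi V k z) := by
  rw [dPsi, ← dzb_conj (contDiff_ofReal hV).differentiableAt_top]
  simp

lemma levi_exp_mul (hV : ContDiff ℝ ∞ V) (γ : ℝ) (z α : Cn n) :
    levi (fun z => Real.exp (γ * V z)) z α = Real.exp (γ * V z) *
      (γ ^ 2 * ‖∑ j, dPsi V j z * α j‖ ^ 2 + γ * levi V z α) := by
  have h1 (j : Fin n) : dPsi (fun z => Real.exp (γ * V z)) j =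
      fun z => (γ * dPsi V j z) * (Real.exp (γ * V z) : ℂ) := by
    funext z
    exact dz_exp_mul hV z γ
  have h2 (j k : Fin n) : dzb k (dPsi (fun z => Real.exp (γ * V z)) j) z =
      (Real.exp (γ * V z) : ℂ) * (γ ^ 2 * (dPsi V j z * conj (dPsi V k z)) +
        γ * dzb k (dPsi V j) z) := by
    rw [h1, dzb_mul ((contDiff_const.mul (contDiff_dPsi hV j)).differentiableAt_top)
      (contDiff_exp_mul hV γ).differentiableAt_top,
      dzb_mul contDiff_const.differentiableAt_top (contDiff_dPsi hV j).differentiableAt_top]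
    have e1 : dzb k (fun z => ((Real.exp (γ * V z) : ℝ) : ℂ)) z =
        γ * conj (dPsi V k z) * (Real.exp (γ * V z) : ℂ) := by
      rw [← dzb_ofReal hV]
      simp only [dzb, fderiv_exp_neg hV]
      ring
    have e2 : dzb k (fun _ : Cn n => (γ : ℂ)) z = 0 := by simp [dzb]
    rw [e1, e2]
    ring
  have h3 : (‖∑ j, dPsi V j z * α j‖ ^ 2 : ℝ) =
      (∑ j, ∑ k, (dPsi V j z * conj (dPsi V k z)) * α j * conj (α k)).re := by
    have : ((‖∑ j, dPsi V j z * α j‖ ^ 2 : ℝ) : ℂ) =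
        ∑ j, ∑ k, (dPsi V j z * conj (dPsi V k z)) * α j * conj (α k) := by
      rw [Complex.ofReal_pow, ← Complex.mul_conj', map_sum, Finset.sum_mul_sum]
      refine Finset.sum_congr rfl fun j _ => Finset.sum_congr rfl fun k _ => ?_
      rw [map_mul]; ring
    rw [← this, Complex.ofReal_re]
  rw [h3, levi, levi]
  have h4 : (∑ j, ∑ k, dzb k (dPsi (fun z => Real.exp (γ * V z)) j) z * α j * conj (α k)) =
      ((Real.exp (γ * V z) * γ ^ 2 : ℝ) : ℂ) *
        (∑ j, ∑ k, (dPsi V j z * conj (dPsi V k z)) * α j * conj (α k)) +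
      ((Real.exp (γ * V z) * γ : ℝ) : ℂ) * (∑ j, ∑ k, dzb k (dPsi V j) z * α j * conj (α k)) := by
    simp only [h2, Finset.mul_sum, ← Finset.sum_add_distrib]
    refine Finset.sum_congr rfl fun j _ => Finset.sum_congr rfl fun k _ => ?_
    push_cast; ring
  rw [h4, Complex.add_re, Complex.re_ofReal_mul, Complex.re_ofReal_mul]
  ring

end LeviForm

section Regularization

open scoped ComplexConjugate

/-- Locally bounded plurisubharmonic functions on `ℂⁿ`. -/
structure IsPsh (v : Cn n → ℝ) : Prop where
  usc : UpperSemicontinuous v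
  bdd : ∀ R : ℝ, ∃ C, ∀ z, ‖z‖ ≤ R → |v z| ≤ C
  sub : ∀ z w, v z ≤ lineAvg v z w

/-- The mollification of `v` by the kernel `ρ`. -/
def mollify (ρ v : Cn n → ℝ) (z : Cn n) : ℝ := ∫ w, ρ w • v (z + w)

variable {ρ v : Cn n → ℝ} {δ : ℝ}

lemma exists_bound_add (hb : ∀ R : ℝ, ∃ C, ∀ z, ‖z‖ ≤ R → |v z| ≤ C) (z : Cn n) (δ : ℝ) :
    ∃ C, ∀ w, ‖w‖ ≤ δ → ‖v (z + w)‖ ≤ C := by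
  obtain ⟨C, hC⟩ := hb (‖z‖ + δ)
  exact ⟨C, fun w hw => hC _ ((norm_add_le _ _).trans (by gcongr))⟩

lemma contDiff_mollify (hρ : IsMollifier ρ δ) (hv : Measurable v)
    (hb : ∀ R : ℝ, ∃ C, ∀ z, ‖z‖ ≤ R → |v z| ≤ C) : ContDiff ℝ ∞ (mollify ρ v) := by
  have hloc : LocallyIntegrable v := by
    intro z
    obtain ⟨C, hC⟩ := hb (‖z‖ + 1)
    refine ⟨Metric.closedBall z 1, Metric.closedBall_mem_nhds z one_pos, ?_⟩
    refine Measure.integrableOn_of_bounded (M := C) (measure_closedBall_lt_top).ne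
      hv.aestronglyMeasurable ?_
    refine (ae_restrict_mem measurableSet_closedBall).mono fun x hx => hC x ?_
    have h1 : ‖x - z‖ ≤ 1 := by simpa [dist_eq_norm] using hx
    have h2 := norm_add_le z (x - z)
    rw [add_sub_cancel] at h2
    linarith
  have h := hρ.hasCompactSupport.contDiff_convolution_left (n := (⊤ : ℕ∞)) (μ := volume)
    (ContinuousLinearMap.lsmul ℝ ℝ) hρ.smooth hloc
  convert h using 1
  funext z
  rw [mollify, convolution, ← integral_neg_eq_self]
  refine integral_congr_ae (ae_of_all _ fun w => ?_)
  simp [hρ.neg, sub_eq_add_neg]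

lemma mollify_le (hρ : IsMollifier ρ δ) (hv : Measurable v)
    (hb : ∀ R : ℝ, ∃ C, ∀ z, ‖z‖ ≤ R → |v z| ≤ C) {z : Cn n} {c : ℝ}
    (hc : ∀ w, ‖w‖ ≤ δ → v (z + w) ≤ c) : mollify ρ v z ≤ c := by
  obtain ⟨C, hC⟩ := exists_bound_add hb z δ
  calc mollify ρ v z ≤ ∫ w, ρ w • c := by
        refine integral_mono (integrable_mollifier hρ hv.stronglyMeasurable hC)
          (hρ.integrable.smul_const c) fun w => ?_
        by_cases h0 : ρ w = 0
        · simp [h0]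
        · exact mul_le_mul_of_nonneg_left (hc w (hρ.supp w h0)) (hρ.nonneg w)
    _ = c := by rw [integral_smul_const, hρ.integral_eq, one_smul]

namespace IsPsh

lemma le_mollify (hv : IsPsh v) (hρ : IsMollifier ρ δ) (z : Cn n) : v z ≤ mollify ρ v z := by
  obtain ⟨C, hC⟩ := exists_bound_add hv.bdd z δ
  exact le_integral_mollifier hρ hv.usc.measurable.stronglyMeasurable hC (hv.sub z)

lemma mollify_le_lineAvg (hv : IsPsh v) (hρ : IsMollifier ρ δ) (z w : Cn n) :
    mollify ρ v z ≤ lineAvg (mollify ρ v) z w := by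
  obtain ⟨C, hC⟩ := hv.bdd (‖z‖ + ‖w‖ + δ)
  have hm : Measurable v := hv.usc.measurable
  have hint : Integrable (fun p : ℝ × Cn n =>
      ρ p.2 • v (z + Complex.exp (Complex.I * p.1) • w + p.2))
      ((volume.restrict (Set.Ioc 0 (2 * Real.pi))).prod volume) := by
    have hi : Integrable (fun p : ℝ × Cn n => C * ρ p.2)
        ((volume.restrict (Set.Ioc 0 (2 * Real.pi))).prod volume) :=
      (hρ.integrable.comp_snd _).const_mul _
    refine hi.mono (Measurable.aestronglyMeasurable ?_) (Eventually.of_forall fun p => ?_)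
    · exact (hρ.continuous.measurable.comp measurable_snd).smul
        (hm.comp (Continuous.measurable (by fun_prop)))
    · rw [norm_smul, mul_comm, norm_mul]
      by_cases h0 : ρ p.2 = 0
      · simp [h0]
      · gcongr
        refine (hC _ ?_).trans (le_abs_self C)
        refine (norm_add_le _ _).trans (add_le_add ((norm_add_le _ _).trans ?_) (hρ.supp _ h0))
        rw [norm_smul, norm_exp_I_mul, one_mul]
  have hform : lineAvg (mollify ρ v) z w = ∫ u, ρ u • lineAvg v (z + u) w := by
    have hpi : 0 < 2 * Real.pi := by positivity
    rw [lineAvg, intervalIntegral.integral_of_le hpi.le]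
    simp only [mollify]
    rw [integral_integral_swap hint, ← integral_smul]
    refine integral_congr_ae (ae_of_all _ fun u => ?_)
    simp only [lineAvg]
    rw [intervalIntegral.integral_of_le hpi.le, integral_smul, smul_comm]
    simp only [add_right_comm]
  have hint2 : Integrable fun u => ρ u • lineAvg v (z + u) w := by
    refine (hint.integral_prod_right.smul (2 * Real.pi)⁻¹).congr (ae_of_all _ fun u => ?_)
    have hpi : 0 < 2 * Real.pi := by positivity
    simp only [lineAvg, Pi.smul_apply]
    rw [intervalIntegral.integral_of_le hpi.le, integral_smul, smul_comm]
    simp only [add_right_comm]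
  obtain ⟨C', hC'⟩ := exists_bound_add hv.bdd z δ
  rw [hform]
  refine integral_mono (integrable_mollifier hρ hm.stronglyMeasurable hC') hint2 fun u => ?_
  exact mul_le_mul_of_nonneg_left (hv.sub _ _) (hρ.nonneg u)

lemma contDiff_mollify (hv : IsPsh v) (hρ : IsMollifier ρ δ) : ContDiff ℝ ∞ (mollify ρ v) :=
  _root_.contDiff_mollify hρ hv.usc.measurable hv.bdd

lemma levi_mollify_nonneg (hv : IsPsh v) (hρ : IsMollifier ρ δ) (z α : Cn n) :
    0 ≤ levi (mollify ρ v) z α :=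
  levi_nonneg (hv.contDiff_mollify hρ) (hv.mollify_le_lineAvg hρ z) α

end IsPsh

lemma lineAvg_euclSq (z w : Cn n) : lineAvg euclSq z w = euclSq z + euclSq w := by
  have hP : Differentiable ℂ fun l : ℂ => ((euclSq z + euclSq w : ℝ) : ℂ) +
      2 * l * ∑ j, w j * conj (z j) := by fun_prop
  have h1 := circleAverage_re_of_differentiable hP 0 1
  have h2 := lineAvg_eq_circleAverage euclSq z w 0 1
  simp only [zero_smul, add_zero, Complex.ofReal_one, one_smul] at h2
  rw [h2]
  rw [Real.circleAverage_congr_sphere (f₂ := fun l : ℂ => (((euclSq z + euclSq w : ℝ) : ℂ) +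
      2 * l * ∑ j, w j * conj (z j)).re), h1]
  · simp
  · intro l hl
    have hl : ‖l‖ = 1 := by simpa using hl
    have hq : Complex.normSq l = 1 := by rw [Complex.normSq_eq_norm_sq, hl, one_pow]
    simp only [euclSq, Complex.add_re, Complex.ofReal_re, Finset.mul_sum, Complex.re_sum,
      ← Finset.sum_add_distrib]
    refine Finset.sum_congr rfl fun j _ => ?_
    simp only [Pi.add_apply, Pi.smul_apply, smul_eq_mul, ← Complex.normSq_eq_norm_sq]
    rw [Complex.normSq_add, Complex.normSq_mul, hq, one_mul, mul_assoc 2,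
      show (2 : ℂ) = ((2 : ℝ) : ℂ) by simp, Complex.re_ofReal_mul]
    congr 2
    rw [← Complex.conj_re]
    simp only [map_mul, Complex.conj_conj]
    ring_nf

/-- The maximum of `φ` and the quadratic function `A (|z|² - s) + M` inside the ball `|z|² < s`,
extended by the quadratic function. -/
def glue (φ : Cn n → EReal) (A M s : ℝ) (z : Cn n) : ℝ :=
  if euclSq z < s then (max (φ z) ((A * (euclSq z - s) + M : ℝ) : EReal)).toReal
  else A * (euclSq z - s) + M

variable {φ : Cn n → EReal} {A M s : ℝ} {z : Cn n}

lemma coe_glue (hM : ∀ z, euclSq z < s → φ z ≤ M) (hz : euclSq z < s) :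
    (glue φ A M s z : EReal) = max (φ z) ((A * (euclSq z - s) + M : ℝ) : EReal) := by
  rw [glue, if_pos hz, EReal.coe_toReal]
  · exact (max_lt (lt_of_le_of_lt (hM z hz) (EReal.coe_lt_top M)) (EReal.coe_lt_top _)).ne
  · exact (lt_of_lt_of_le (EReal.bot_lt_coe _) (le_max_right _ _)).ne'

lemma glue_of_le (hz : s ≤ euclSq z) : glue φ A M s z = A * (euclSq z - s) + M :=
  if_neg hz.not_gt

lemma le_glue (hM : ∀ z, euclSq z < s → φ z ≤ M) (z : Cn n) :
    A * (euclSq z - s) + M ≤ glue φ A M s z := by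
  by_cases hz : euclSq z < s
  · rw [← EReal.coe_le_coe_iff, coe_glue hM hz]
    exact le_max_right _ _
  · rw [glue_of_le (not_lt.1 hz)]

lemma glue_le (hM : ∀ z, euclSq z < s → φ z ≤ M) (z : Cn n) :
    glue φ A M s z ≤ max M (A * (euclSq z - s) + M) := by
  by_cases hz : euclSq z < s
  · rw [← EReal.coe_le_coe_iff, coe_glue hM hz, max_le_iff]
    refine ⟨(hM z hz).trans ?_, ?_⟩ <;> rw [EReal.coe_le_coe_iff]
    · exact le_max_left _ _
    · exact le_max_right _ _
  · rw [glue_of_le (not_lt.1 hz)]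
    exact le_max_right _ _

lemma isOpen_euclSq_lt (s : ℝ) : IsOpen {z : Cn n | euclSq z < s} :=
  isOpen_lt contDiff_euclSq.continuous continuous_const

lemma upperSemicontinuous_glue (hA : 0 ≤ A) (hM : ∀ z, euclSq z < s → φ z ≤ M)
    (hφ : UpperSemicontinuousOn φ {z | euclSq z < s}) : UpperSemicontinuous (glue φ A M s) := by
  have hq : Continuous (euclSq : Cn n → ℝ) := contDiff_euclSq.continuous
  have hLc : Continuous fun z : Cn n => A * (euclSq z - s) + M := by fun_prop
  intro z y hy
  by_cases hz : euclSq z < s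
  · have hnhds : {z : Cn n | euclSq z < s} ∈ 𝓝 z := (isOpen_euclSq_lt s).mem_nhds hz
    rw [← EReal.coe_lt_coe_iff, coe_glue hM hz, max_lt_iff] at hy
    have h1 := hφ z hz y hy.1
    rw [nhdsWithin_eq_nhds.2 hnhds] at h1
    have h2 : ∀ᶠ x in 𝓝 z, A * (euclSq x - s) + M < y :=
      hLc.continuousAt.eventually_lt continuousAt_const (by exact_mod_cast hy.2)
    filter_upwards [h1, h2, hnhds] with x hx1 hx2 hx3
    rw [← EReal.coe_lt_coe_iff, coe_glue hM hx3]
    exact max_lt hx1 (by exact_mod_cast hx2)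
  · rw [glue_of_le (not_lt.1 hz)] at hy
    have h2 : ∀ᶠ x in 𝓝 z, max M (A * (euclSq x - s) + M) < y := by
      refine (continuous_const.max hLc).continuousAt.eventually_lt continuousAt_const ?_
      refine max_lt (lt_of_le_of_lt ?_ hy) hy
      have : 0 ≤ A * (euclSq z - s) := mul_nonneg hA (by linarith)
      linarith
    filter_upwards [h2] with x hx
    exact lt_of_le_of_lt (glue_le hM x) hx

lemma glue_bdd (hM : ∀ z, euclSq z < s → φ z ≤ M) (R : ℝ) :
    ∃ C, ∀ z, ‖z‖ ≤ R → |glue φ A M s z| ≤ C := by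
  have hq : Continuous (euclSq : Cn n → ℝ) := contDiff_euclSq.continuous
  have hLc : Continuous fun z : Cn n => |A * (euclSq z - s) + M| + |M| := by fun_prop
  obtain ⟨C, hC⟩ := (isCompact_closedBall (0 : Cn n) R).exists_bound_of_continuousOn hLc.continuousOn
  refine ⟨C, fun z hz => le_trans ?_ ((le_abs_self _).trans (hC z (by simpa using hz)))⟩
  have h1 := le_glue (A := A) hM z
  have h2 := glue_le (A := A) hM z
  rw [abs_le]
  constructor
  · have := neg_abs_le (A * (euclSq z - s) + M)
    have := abs_nonneg M
    linarith
  · refine h2.trans (max_le ?_ ?_)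
    · have := le_abs_self M
      have := abs_nonneg (A * (euclSq z - s) + M)
      linarith
    · have := le_abs_self (A * (euclSq z - s) + M)
      have := abs_nonneg M
      linarith

lemma lineAvg_mono {u v : Cn n → ℝ} {z w : Cn n}
    (hu : IntervalIntegrable (fun θ : ℝ => u (z + Complex.exp (Complex.I * θ) • w)) volume
      0 (2 * Real.pi))
    (hv : IntervalIntegrable (fun θ : ℝ => v (z + Complex.exp (Complex.I * θ) • w)) volume
      0 (2 * Real.pi))
    (h : ∀ θ : ℝ, u (z + Complex.exp (Complex.I * θ) • w) ≤
      v (z + Complex.exp (Complex.I * θ) • w)) : lineAvg u z w ≤ lineAvg v z w := by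
  refine mul_le_mul_of_nonneg_left ?_ (by positivity)
  exact intervalIntegral.integral_mono_on (by positivity) hu hv fun θ _ => h θ

lemma intervalIntegrable_line (hv : Measurable v)
    (hb : ∀ R : ℝ, ∃ C, ∀ z, ‖z‖ ≤ R → |v z| ≤ C) (z w : Cn n) :
    IntervalIntegrable (fun θ : ℝ => v (z + Complex.exp (Complex.I * θ) • w)) volume
      0 (2 * Real.pi) := by
  obtain ⟨C, hC⟩ := hb (‖z‖ + ‖w‖)
  refine (intervalIntegrable_const (c := C)).mono_fun
    (hv.comp (Continuous.measurable (by fun_prop))).aestronglyMeasurable (ae_of_all _ fun θ => ?_)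
  refine (hC _ ((norm_add_le _ _).trans ?_)).trans (le_abs_self _)
  rw [norm_smul, norm_exp_I_mul, one_mul]

lemma quad_le_lineAvg_glue (hA : 0 ≤ A) (hM : ∀ z, euclSq z < s → φ z ≤ M)
    (hφ : UpperSemicontinuousOn φ {z | euclSq z < s}) (z w : Cn n) :
    A * (euclSq z - s) + M ≤ lineAvg (glue φ A M s) z w := by
  have hq : Continuous (euclSq : Cn n → ℝ) := contDiff_euclSq.continuous
  have h1 : lineAvg (fun z => A * (euclSq z - s) + M) z w = A * (euclSq z + euclSq w - s) + M := by
    rw [← lineAvg_euclSq]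
    simp only [lineAvg, smul_eq_mul]
    rw [intervalIntegral.integral_add (Continuous.intervalIntegrable (by fun_prop) _ _)
      (Continuous.intervalIntegrable (by fun_prop) _ _), intervalIntegral.integral_const_mul,
      intervalIntegral.integral_sub (Continuous.intervalIntegrable (by fun_prop) _ _)
      (Continuous.intervalIntegrable (by fun_prop) _ _)]
    simp only [intervalIntegral.integral_const, sub_zero, smul_eq_mul]
    have := Real.pi_pos
    field_simp
  calc A * (euclSq z - s) + M ≤ A * (euclSq z + euclSq w - s) + M := by
        have := euclSq_nonneg w
        gcongr; linarith
    _ = _ := h1.symm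
    _ ≤ _ := lineAvg_mono (Continuous.intervalIntegrable (by fun_prop) _ _)
        (intervalIntegrable_line (upperSemicontinuous_glue hA hM hφ).measurable
          (glue_bdd hM) z w) fun θ => le_glue hM _

/-- The glued function is plurisubharmonic on `ℂⁿ`. -/
theorem isPsh_glue {Ω : Set (Cn n)} (hφ : PSHOn φ Ω) (hΩ : {z | euclSq z < s} ⊆ Ω) (hA : 0 ≤ A)
    (hM : ∀ z, euclSq z < s → φ z ≤ M) : IsPsh (glue φ A M s) := by
  have husc := hφ.usc.mono hΩ
  have hg := upperSemicontinuous_glue hA hM husc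
  have hbd := glue_bdd (A := A) hM
  refine ⟨hg, hbd, le_lineAvg_of_local hg hbd fun z w => ?_⟩
  by_cases hz : euclSq z < s
  · rcases le_total (φ z) ((A * (euclSq z - s) + M : ℝ) : EReal) with hle | hle
    · refine ⟨1, one_pos, fun r _ _ => ?_⟩
      have := coe_glue (A := A) hM hz
      rw [max_eq_right hle, EReal.coe_eq_coe_iff] at this
      rw [this]
      exact quad_le_lineAvg_glue hA hM husc z _
    · obtain ⟨ε, hε, hsub⟩ := hφ.submean z (hΩ hz) w
      obtain ⟨δ, hδ, hball⟩ := Metric.isOpen_iff.1 (isOpen_euclSq_lt s) z hz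
      refine ⟨min ε (δ / (‖w‖ + 1)), by positivity, fun r hr0 hr => ?_⟩
      obtain ⟨m, hm⟩ := exists_nat_ge (A * s - M)
      have h1 := (hsub r hr0 (hr.trans_le (min_le_left _ _))).trans (iInf_le _ m)
      have hgz := coe_glue (A := A) hM hz
      rw [max_eq_left hle] at hgz
      rw [← hgz, EReal.coe_le_coe_iff] at h1
      refine h1.trans ?_
      rw [circleAvg, lineAvg, smul_eq_mul]
      refine mul_le_mul_of_nonneg_left ?_ (by positivity)
      have hin (θ : ℝ) : euclSq (z + ((r : ℂ) * Complex.exp (Complex.I * θ)) • w) < s := by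
        refine hball ?_
        rw [mem_ball_iff_norm, add_sub_cancel_left, norm_smul, norm_mul, norm_exp_I_mul, mul_one,
          Complex.norm_real, Real.norm_of_nonneg hr0.le]
        have h2 := hr.trans_le (min_le_right _ _)
        rw [lt_div_iff₀ (by positivity)] at h2
        nlinarith [norm_nonneg w]
      have hpt (θ : ℝ) : (max (φ (z + ((r : ℂ) * Complex.exp (Complex.I * (θ : ℂ))) • w))
          ((-(m : ℝ) : ℝ) : EReal)).toReal ≤
          glue φ A M s (z + Complex.exp (Complex.I * θ) • ((r : ℂ) • w)) := by
        rw [smul_smul, mul_comm (Complex.exp _)]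
        have h3 := hin θ
        have h4 : ((max (φ (z + ((r : ℂ) * Complex.exp (Complex.I * (θ : ℂ))) • w))
          ((-(m : ℝ) : ℝ) : EReal)).toReal : EReal) = _ := EReal.coe_toReal
          ((max_lt (lt_of_le_of_lt (hM _ h3) (EReal.coe_lt_top M)) (EReal.coe_lt_top _)).ne)
          (lt_of_lt_of_le (EReal.bot_lt_coe _) (le_max_right _ _)).ne'
        rw [← EReal.coe_le_coe_iff, h4, coe_glue hM h3]
        refine max_le_max le_rfl ?_
        rw [EReal.coe_le_coe_iff]
        have := mul_nonneg hA (euclSq_nonneg (z + ((r : ℂ) * Complex.exp (Complex.I * θ)) • w))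
        linarith
      refine intervalIntegral.integral_mono_on (by positivity) ?_
        (intervalIntegrable_line hg.measurable hbd _ _) fun θ _ => hpt θ
      have husc2 : UpperSemicontinuous fun θ : ℝ =>
          φ (z + ((r : ℂ) * Complex.exp (Complex.I * (θ : ℂ))) • w) := by
        have : UpperSemicontinuousOn (fun θ : ℝ =>
          φ (z + ((r : ℂ) * Complex.exp (Complex.I * (θ : ℂ))) • w)) Set.univ :=
          husc.comp (Continuous.continuousOn (by fun_prop)) fun θ _ => hin θ
        exact upperSemicontinuousOn_univ_iff.1 this
      refine (intervalIntegrable_const (c := |M| + m)).mono_fun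
        (husc2.measurable.max measurable_const).ereal_toReal.aestronglyMeasurable
        (ae_of_all _ fun θ => ?_)
      beta_reduce
      rw [Real.norm_eq_abs, Real.norm_of_nonneg (by positivity)]
      have h3 := hin θ
      have h4 : ((max (φ (z + ((r : ℂ) * Complex.exp (Complex.I * (θ : ℂ))) • w))
          ((-(m : ℝ) : ℝ) : EReal)).toReal : EReal) = _ := EReal.coe_toReal
          ((max_lt (lt_of_le_of_lt (hM _ h3) (EReal.coe_lt_top M)) (EReal.coe_lt_top _)).ne)
          (lt_of_lt_of_le (EReal.bot_lt_coe _) (le_max_right _ _)).ne'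
      rw [abs_le]
      constructor
      · rw [← EReal.coe_le_coe_iff, h4]
        refine le_trans ?_ (le_max_right _ _)
        rw [EReal.coe_le_coe_iff]
        linarith [abs_nonneg M]
      · rw [← EReal.coe_le_coe_iff, h4]
        refine max_le ((hM _ h3).trans ?_) ?_ <;> rw [EReal.coe_le_coe_iff]
        · have : (0 : ℝ) ≤ m := by positivity
          linarith [le_abs_self M]
        · have : (0 : ℝ) ≤ m := by positivity
          linarith [abs_nonneg M]
  · refine ⟨1, one_pos, fun r _ _ => ?_⟩
    rw [glue_of_le (not_lt.1 hz)]
    exact quad_le_lineAvg_glue hA hM husc z _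

end Regularization

section SmoothApproximation

variable {φ φ₀ : Cn n → EReal} {M s : ℝ} {Ω : Set (Cn n)}

lemma expE_eq_exp (x : EReal) : expE x = EReal.exp x := by
  induction x with
  | bot => simp [expE]
  | coe x => simp [expE]
  | top => simp [expE]

lemma wexp_neg_two (φ : Cn n → EReal) (z : Cn n) :
    wexp (-2) φ z = (EReal.exp (φ z))⁻¹ ^ 2 := by
  rw [wexp, expE_eq_exp]
  generalize φ z = x
  induction x with
  | bot =>
    rw [EReal.coe_mul_bot_of_neg (by norm_num)]
    simp
  | coe x =>
    rw [← EReal.coe_mul, EReal.exp_coe, EReal.exp_coe, ← ENNReal.ofReal_inv_of_pos (Real.exp_pos _),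
      ← Real.exp_neg, ← ENNReal.ofReal_pow (Real.exp_pos _).le, ← Real.exp_nat_mul]
    norm_num
  | top =>
    rw [EReal.coe_mul_top_of_neg (by norm_num)]
    simp

lemma wexp_neg_two_coe (V : Cn n → ℝ) (z : Cn n) :
    wexp (-2) (fun z => (V z : EReal)) z = ENNReal.ofReal (Real.exp (-2 * V z)) := by
  rw [wexp, expE_eq_exp, ← EReal.coe_mul, EReal.exp_coe]

lemma wexp_neg_two_add {z : Cn n} (h : φ z < ⊤) (h₀ : φ₀ z < ⊤) :
    wexp (-2) (fun w => φ w + φ₀ w) z = wexp (-2) φ z * wexp (-2) φ₀ z := by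
  simp only [wexp_neg_two]
  rw [EReal.exp_add, ENNReal.mul_inv, mul_pow]
  · right; simpa using h₀.ne
  · left; simpa using h.ne

lemma wexp_neg_two_anti {ψ : Cn n → EReal} {z w : Cn n} (h : φ z ≤ ψ w) :
    wexp (-2) ψ w ≤ wexp (-2) φ z := by
  rw [wexp_neg_two, wexp_neg_two]
  gcongr

lemma wexp_neg_two_ne_zero {z : Cn n} (h : φ z < ⊤) : wexp (-2) φ z ≠ 0 := by
  rw [wexp_neg_two]
  simpa using h.ne

lemma tendsto_wexp_neg_two {V : ℕ → Cn n → ℝ} {z : Cn n}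
    (h : Tendsto (fun k => (V k z : EReal)) atTop (𝓝 (φ z))) :
    Tendsto (fun k => ENNReal.ofReal (Real.exp (-2 * V k z))) atTop (𝓝 (wexp (-2) φ z)) := by
  simp only [← wexp_neg_two_coe, wexp_neg_two]
  have h1 : Continuous fun x : EReal => (EReal.exp x)⁻¹ ^ 2 :=
    (ENNReal.continuous_pow 2).comp (continuous_inv.comp ENNReal.continuous_exp)
  exact (h1.tendsto _).comp h

lemma euclSq_add_le (z w : Cn n) :
    euclSq (z + w) ≤ euclSq z + n * (2 * ‖z‖ * ‖w‖ + ‖w‖ ^ 2) := by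
  calc euclSq (z + w) ≤ ∑ j, (‖z j‖ ^ 2 + (2 * ‖z‖ * ‖w‖ + ‖w‖ ^ 2)) := by
        refine Finset.sum_le_sum fun j _ => ?_
        have h1 : ‖(z + w) j‖ ≤ ‖z j‖ + ‖w j‖ := norm_add_le _ _
        have h2 := norm_le_pi_norm z j
        have h3 := norm_le_pi_norm w j
        calc ‖(z + w) j‖ ^ 2 ≤ (‖z j‖ + ‖w j‖) ^ 2 := by gcongr
          _ = ‖z j‖ ^ 2 + (2 * ‖z j‖ * ‖w j‖ + ‖w j‖ ^ 2) := by ring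
          _ ≤ _ := by gcongr
    _ = _ := by simp [Finset.sum_add_distrib, euclSq]; ring

/-- Smooth plurisubharmonic functions on `ℂⁿ` approximating `φ` from above in the ball `|z|² < s`. -/
structure IsRegularization (φ : Cn n → EReal) (M M' s : ℝ) (V : ℕ → Cn n → ℝ) : Prop where
  smooth : ∀ k, ContDiff ℝ ∞ (V k)
  levi_nonneg : ∀ k z α, 0 ≤ levi (V k) z α
  quad_le : ∀ k z, k * (euclSq z - s) + M ≤ V k z
  le : ∀ k z, euclSq z < s → φ z ≤ V k z
  le_const : ∀ k z, euclSq z < s → V k z ≤ M'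
  tendsto : ∀ z, euclSq z < s → Tendsto (fun k => (V k z : EReal)) atTop (𝓝 (φ z))

lemma eventually_mollify_le (hφ : UpperSemicontinuousOn φ {z | euclSq z < s})
    (hM : ∀ z, euclSq z < s → φ z ≤ M)
    (hv : ∀ k : ℕ, IsPsh (glue φ k M s)) {ρ : ℕ → Cn n → ℝ}
    (hρ : ∀ k : ℕ, IsMollifier (ρ k) (1 / ((k : ℝ) + 1))) {z : Cn n} (hz : euclSq z < s) {y : ℝ}
    (hy : φ z < y) : ∀ᶠ k : ℕ in atTop, mollify (ρ k) (glue φ k M s) z ≤ y := by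
  obtain ⟨s', hs', hs's⟩ := exists_between hz
  have h1 : ∀ᶠ x in 𝓝 z, φ x < y := by
    have := hφ z hz y hy
    rwa [(isOpen_euclSq_lt s).nhdsWithin_eq hz] at this
  have h2 : ∀ᶠ x in 𝓝 z, euclSq x < s' := (isOpen_euclSq_lt s').mem_nhds hs'
  obtain ⟨ε, hε, hball⟩ := Metric.eventually_nhds_iff.1 (h1.and h2)
  have h3 : ∀ᶠ k : ℕ in atTop, 1 / ((k : ℝ) + 1) < ε :=
    tendsto_one_div_add_atTop_nhds_zero_nat.eventually_lt_const hε
  have h4 : ∀ᶠ k : ℕ in atTop, (M - y) / (s - s') ≤ k :=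
    tendsto_natCast_atTop_atTop.eventually_ge_atTop _
  filter_upwards [h3, h4] with k hk3 hk4
  refine mollify_le (hρ k) (hv k).usc.measurable (hv k).bdd fun w hw => ?_
  obtain ⟨ha, hb⟩ := hball (y := z + w) (by simpa using hw.trans_lt hk3)
  rw [← EReal.coe_le_coe_iff, coe_glue hM (hb.trans hs's)]
  refine max_le ha.le ?_
  rw [EReal.coe_le_coe_iff]
  rw [div_le_iff₀ (by linarith)] at hk4
  nlinarith [(Nat.cast_nonneg k : (0 : ℝ) ≤ k)]

lemma exists_isRegularization (hφ : PSHOn φ Ω) (hΩ : {z | euclSq z < s} ⊆ Ω)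
    (hM : ∀ z, euclSq z < s → φ z ≤ M) : ∃ M' V, IsRegularization φ M M' s V := by
  choose ρ hρ using fun k : ℕ => exists_isMollifier n (δ := 1 / ((k : ℝ) + 1)) (by positivity)
  have hv (k : ℕ) : IsPsh (glue φ k M s) := isPsh_glue hφ hΩ (Nat.cast_nonneg k) hM
  have hle : ∀ (k : ℕ) z, euclSq z < s → φ z ≤ mollify (ρ k) (glue φ k M s) z := fun k z hz => by
    refine le_trans ?_ (EReal.coe_le_coe_iff.2 ((hv k).le_mollify (hρ k) z))
    rw [coe_glue hM hz]
    exact le_max_left _ _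
  refine ⟨n * (2 * Real.sqrt s + 1) + M, fun k => mollify (ρ k) (glue φ k M s),
    fun k => (hv k).contDiff_mollify (hρ k), fun k => (hv k).levi_mollify_nonneg (hρ k),
    fun k z => (le_glue hM z).trans ((hv k).le_mollify (hρ k) z), hle, fun k z hz => ?_,
    fun z hz => ?_⟩
  · refine mollify_le (hρ k) (hv k).usc.measurable (hv k).bdd fun w hw => ?_
    refine (glue_le hM _).trans (max_le ?_ ?_)
    · have : (0 : ℝ) ≤ n * (2 * Real.sqrt s + 1) := by positivity
      linarith
    · have h1 := euclSq_add_le z w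
      have h2 : ‖z‖ ≤ Real.sqrt s := Real.le_sqrt_of_sq_le ((norm_sq_le_euclSq z).trans hz.le)
      have hk : (0 : ℝ) ≤ k := Nat.cast_nonneg k
      have h3 : k * ‖w‖ ≤ 1 := by
        rw [le_div_iff₀ (by positivity)] at hw
        nlinarith [norm_nonneg w]
      have h4 : ‖w‖ ≤ 1 := hw.trans (by rw [div_le_one (by positivity)]; linarith)
      have h5 : k * (euclSq (z + w) - s) ≤ n * (2 * ‖z‖ * (k * ‖w‖) + (k * ‖w‖) * ‖w‖) := by
        calc k * (euclSq (z + w) - s) ≤ k * (n * (2 * ‖z‖ * ‖w‖ + ‖w‖ ^ 2)) := by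
              gcongr; linarith
          _ = _ := by ring
      have h6 : (n : ℝ) * (2 * ‖z‖ * (k * ‖w‖) + (k * ‖w‖) * ‖w‖) ≤
          n * (2 * Real.sqrt s * 1 + 1 * 1) := by gcongr
      linarith
  · refine tendsto_order.2 ⟨fun a ha => Eventually.of_forall fun k => ha.trans_le (hle k z hz),
      fun a ha => ?_⟩
    obtain ⟨y, hy1, hy2⟩ := EReal.lt_iff_exists_real_btwn.1 ha
    filter_upwards [eventually_mollify_le (hφ.usc.mono hΩ) hM hv hρ hz hy1] with k hk
    exact lt_of_le_of_lt (EReal.coe_le_coe_iff.2 hk) hy2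

end SmoothApproximation

section Cutoff

open scoped ComplexConjugate

/-- `χ` is a smooth cutoff function equal to `1` on `(-∞, -t-1]` and to `0` on `[-t, ∞)`. -/
structure IsCutoff (χ : ℝ → ℝ) (t C : ℝ) : Prop where
  smooth : ContDiff ℝ ∞ χ
  nonneg : ∀ x, 0 ≤ χ x
  le_one : ∀ x, χ x ≤ 1
  eq_one : ∀ x, x ≤ -t - 1 → χ x = 1
  eq_zero : ∀ x, -t ≤ x → χ x = 0
  deriv_le : ∀ x, |deriv χ x| ≤ C

lemma exists_isCutoff : ∃ C, 0 ≤ C ∧ ∀ t, ∃ χ, IsCutoff χ t C := by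
  have hsm : ContDiff ℝ ∞ Real.smoothTransition := Real.smoothTransition.contDiff
  have hd : Continuous (deriv Real.smoothTransition) := hsm.continuous_deriv (by simp)
  have hcs : HasCompactSupport (deriv Real.smoothTransition) := by
    refine HasCompactSupport.intro (K := Set.Icc 0 1) isCompact_Icc fun x hx => ?_
    rcases lt_or_ge x 0 with h | h
    · refine IsLocalMin.deriv_eq_zero (Eventually.of_forall fun y => ?_)
      rw [Real.smoothTransition.zero_of_nonpos h.le]
      exact Real.smoothTransition.nonneg y
    · refine IsLocalMax.deriv_eq_zero (Eventually.of_forall fun y => ?_)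
      rw [Real.smoothTransition.one_of_one_le (x := x) (by by_contra h1; exact hx ⟨h, by linarith⟩)]
      exact Real.smoothTransition.le_one y
  obtain ⟨C, hC⟩ := hd.bounded_above_of_compact_support hcs
  refine ⟨C, (norm_nonneg _).trans (hC 0), fun t => ⟨fun x => Real.smoothTransition (-t - x),
    hsm.comp (contDiff_const.sub contDiff_id), fun x => Real.smoothTransition.nonneg _,
    fun x => Real.smoothTransition.le_one _,
    fun x hx => Real.smoothTransition.one_of_one_le (by linarith),
    fun x hx => Real.smoothTransition.zero_of_nonpos (by linarith), fun x => ?_⟩⟩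
  rw [deriv_comp_const_sub, abs_neg]
  exact hC _

namespace IsCutoff

variable {χ : ℝ → ℝ} {t C : ℝ}

lemma deriv_eq_zero (h : IsCutoff χ t C) {x : ℝ} (hx : -t ≤ x) : deriv χ x = 0 := by
  refine IsLocalMin.deriv_eq_zero (Eventually.of_forall fun y => ?_)
  rw [h.eq_zero x hx]
  exact h.nonneg y

lemma deriv_eq_zero_of_le (h : IsCutoff χ t C) {x : ℝ} (hx : x ≤ -t - 1) : deriv χ x = 0 := by
  refine IsLocalMax.deriv_eq_zero (Eventually.of_forall fun y => ?_)
  rw [h.eq_one x hx]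
  exact h.le_one y

end IsCutoff

/-- The function `η(V) f` on the ball `|z|² < s`, extended by zero. -/
def cut (η : ℝ → ℝ) (V : Cn n → ℝ) (f : Cn n → ℂ) (s : ℝ) (z : Cn n) : ℂ :=
  if euclSq z < s then (η (V z) : ℂ) * f z else 0

variable {η : ℝ → ℝ} {V : Cn n → ℝ} {f : Cn n → ℂ} {s t A M : ℝ}

lemma cut_of_lt {z : Cn n} (hz : euclSq z < s) : cut η V f s z = (η (V z) : ℂ) * f z := if_pos hz

lemma cut_eq_zero (hη : ∀ x, -t ≤ x → η x = 0) {z : Cn n} (hz : -t ≤ V z) :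
    cut η V f s z = 0 := by
  rw [cut, hη _ hz]
  simp

lemma neg_lt_of_le_euclSq (hA : 0 ≤ A) (hV : ∀ z, A * (euclSq z - s) + M ≤ V z) (ht : 0 < t + M)
    {z : Cn n} (hz : s ≤ euclSq z) : -t < V z := by
  have := hV z
  have : 0 ≤ A * (euclSq z - s) := mul_nonneg hA (by linarith)
  linarith

lemma cut_eventuallyEq_zero (hη : ∀ x, -t ≤ x → η x = 0) (hVc : Continuous V) {z : Cn n}
    (hz : -t < V z) : cut η V f s =ᶠ[𝓝 z] fun _ => 0 := by
  filter_upwards [(isOpen_lt continuous_const hVc).mem_nhds hz] with w hw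
  exact cut_eq_zero hη (le_of_lt hw)

lemma isTest_cut (hη : ContDiff ℝ ∞ η) (h0 : ∀ x, -t ≤ x → η x = 0) (hVs : ContDiff ℝ ∞ V)
    (hA : 0 ≤ A) (hV : ∀ z, A * (euclSq z - s) + M ≤ V z) (ht : 0 < t + M)
    (hf : DifferentiableOn ℂ f {z | euclSq z < s}) : IsTest (cut η V f s) := by
  constructor
  · rw [contDiff_iff_contDiffAt]
    intro z
    rcases lt_or_ge (euclSq z) s with hz | hz
    · have hn := (isOpen_euclSq_lt s).mem_nhds hz
      have h1 : ContDiffAt ℝ ∞ (fun z => (η (V z) : ℂ) * f z) z :=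
        (contDiff_ofReal (hη.comp hVs)).contDiffAt.mul
          ((contDiffOn_real_of_differentiableOn (isOpen_euclSq_lt s) hf).contDiffAt hn)
      refine h1.congr_of_eventuallyEq ?_
      filter_upwards [hn] with w hw using cut_of_lt hw
    · exact contDiffAt_const.congr_of_eventuallyEq
        (cut_eventuallyEq_zero h0 hVs.continuous (neg_lt_of_le_euclSq hA hV ht hz))
  · refine HasCompactSupport.intro (isCompact_closedBall (0 : Cn n) (Real.sqrt s)) fun z hz => ?_
    refine if_neg fun h => hz ?_
    simpa using Real.le_sqrt_of_sq_le ((norm_sq_le_euclSq z).trans h.le)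

lemma dzb_of_differentiableAt {z : Cn n} (hf : DifferentiableAt ℂ f z) (j : Fin n) :
    dzb j f z = 0 := by
  have h : fderiv ℝ f z = (fderiv ℂ f z).restrictScalars ℝ := hf.fderiv_restrictScalars ℝ
  have h2 : (Pi.single j Complex.I : Cn n) = Complex.I • Pi.single j 1 := by
    rw [← Pi.single_smul]; simp
  simp only [dzb, h, ContinuousLinearMap.coe_restrictScalars', h2, map_smul, smul_eq_mul,
    ← mul_assoc, Complex.I_mul_I]
  ring

lemma dzb_comp_ofReal (hη : ContDiff ℝ ∞ η) (hVs : ContDiff ℝ ∞ V) (j : Fin n) (z : Cn n) :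
    dzb j (fun z => (η (V z) : ℂ)) z = deriv η (V z) * conj (dPsi V j z) := by
  have hd := hVs.differentiable (by simp) z
  have hη' := hη.differentiable (by simp) (V z)
  have h1 (v : Cn n) : fderiv ℝ (fun z => (η (V z) : ℂ)) z v =
      deriv η (V z) * fderiv ℝ (fun z => (V z : ℂ)) z v := by
    have h2 := hη'.hasDerivAt.comp_hasFDerivAt z hd.hasFDerivAt
    change HasFDerivAt (fun z => η (V z)) _ z at h2
    rw [fderiv_ofReal_apply h2.differentiableAt, fderiv_ofReal_apply hd, h2.fderiv]
    simp
  rw [← dzb_ofReal hVs]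
  simp only [dzb, h1]
  ring

lemma dzb_cut (hη : ContDiff ℝ ∞ η) (h0 : ∀ x, -t ≤ x → η x = 0) (hVs : ContDiff ℝ ∞ V)
    (hA : 0 ≤ A) (hV : ∀ z, A * (euclSq z - s) + M ≤ V z) (ht : 0 < t + M)
    (hf : DifferentiableOn ℂ f {z | euclSq z < s}) (j : Fin n) (z : Cn n) :
    dzb j (cut η V f s) z = cut (deriv η) V f s z * conj (dPsi V j z) := by
  rcases lt_or_ge (euclSq z) s with hz | hz
  · have hn := (isOpen_euclSq_lt s).mem_nhds hz
    have he : cut η V f s =ᶠ[𝓝 z] fun z => (η (V z) : ℂ) * f z := by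
      filter_upwards [hn] with w hw using cut_of_lt hw
    have hfz := hf.differentiableAt hn
    have h1 : dzb j (cut η V f s) z = dzb j (fun z => (η (V z) : ℂ) * f z) z := by
      simp only [dzb, he.fderiv_eq]
    have h2 : DifferentiableAt ℝ (fun z => (η (V z) : ℂ)) z :=
      (contDiff_ofReal (hη.comp hVs)).differentiableAt_top
    rw [h1, dzb_mul h2 (hfz.restrictScalars ℝ), dzb_of_differentiableAt hfz, cut_of_lt hz,
      dzb_comp_ofReal hη hVs j z]
    ring
  · have he := cut_eventuallyEq_zero (f := f) (s := s) h0 hVs.continuous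
      (neg_lt_of_le_euclSq hA hV ht hz)
    rw [cut, if_neg hz.not_gt]
    simp [dzb, he.fderiv_eq]

end Cutoff

section HormanderStep

open scoped ComplexConjugate

/-- The weight `2 V₀ + 2 V + e^{γ V}`. -/
def hWeight (V V₀ : Cn n → ℝ) (γ : ℝ) (z : Cn n) : ℝ :=
  ((V₀ z + V₀ z) + (V z + V z)) + Real.exp (γ * V z)

variable {V V₀ : Cn n → ℝ} {f : Cn n → ℂ} {χ : ℝ → ℝ} {s t A M C γ ε : ℝ} {Ψ : Cn n → ℝ}

lemma contDiff_hWeight (hV : ContDiff ℝ ∞ V) (hV₀ : ContDiff ℝ ∞ V₀) :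
    ContDiff ℝ ∞ (hWeight V V₀ γ) :=
  ((hV₀.add hV₀).add (hV.add hV)).add (contDiff_const.mul hV).exp

lemma le_levi_hWeight (hV : ContDiff ℝ ∞ V) (hV₀ : ContDiff ℝ ∞ V₀) (hL : ∀ z α, 0 ≤ levi V z α)
    (hL₀ : ∀ z α, 0 ≤ levi V₀ z α) (hγ : 0 ≤ γ) (z α : Cn n) :
    γ ^ 2 * Real.exp (γ * V z) * ‖∑ j, dPsi V j z * α j‖ ^ 2 ≤ levi (hWeight V V₀ γ) z α := by
  unfold hWeight
  rw [levi_add ((hV₀.add hV₀).add (hV.add hV)) (contDiff_const.mul hV).exp,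
    levi_add (hV₀.add hV₀) (hV.add hV), levi_add hV₀ hV₀, levi_add hV hV, levi_exp_mul hV]
  have h1 := hL z α
  have h2 := hL₀ z α
  have h3 : 0 ≤ Real.exp (γ * V z) * (γ * levi V z α) := by positivity
  nlinarith

lemma ofReal_integral_wt (hΨ : Continuous Ψ) {f : Cn n → ℝ} (h0 : ∀ z, 0 ≤ f z)
    (hf : Continuous f) {K : Set (Cn n)} (hK : MeasurableSet K) (hi : IntegrableOn f K (wt Ψ)) :
    ENNReal.ofReal (∫ z in K, f z ∂(wt Ψ)) =
      ∫⁻ z in K, ENNReal.ofReal (f z) * ENNReal.ofReal (Real.exp (-Ψ z)) := by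
  rw [ofReal_integral_eq_lintegral_ofReal hi (ae_of_all _ h0), wt, restrict_withDensity hK,
    lintegral_withDensity_eq_lintegral_mul _
      (continuous_wt_density hΨ).measurable.ennreal_ofReal hf.measurable.ennreal_ofReal]
  simp only [Pi.mul_apply, mul_comm]

lemma two_mul_mul_le_div_add {a p e : ℝ} (he : 0 < e) : 2 * (a * p) ≤ a ^ 2 / e + e * p ^ 2 := by
  have h : 0 ≤ (a - e * p) ^ 2 / e := by positivity
  have h2 : (a - e * p) ^ 2 / e = a ^ 2 / e + e * p ^ 2 - 2 * (a * p) := by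
    field_simp
    ring
  linarith

lemma error_density_le (hχ : IsCutoff χ t C) (hγ : 0 < γ) (z : Cn n) :
    ENNReal.ofReal (‖cut (deriv χ) V f s z‖ ^ 2 / (γ ^ 2 * Real.exp (γ * V z))) *
        ENNReal.ofReal (Real.exp (-hWeight V V₀ γ z)) ≤
      Set.indicator {z | euclSq z < s ∧ V z < -t} (fun z =>
        ENNReal.ofReal (C ^ 2 / γ ^ 2 * Real.exp ((γ + 2) * (t + 1))) *
          (‖f z‖ₑ ^ 2 * ENNReal.ofReal (Real.exp (-2 * V₀ z)))) z := by
  by_cases h : cut (deriv χ) V f s z = 0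
  · simp [h]
  have hz : euclSq z < s := by
    by_contra hz
    exact h (if_neg hz)
  have hVt : V z < -t := by
    by_contra hV
    exact h (cut_eq_zero (fun x hx => hχ.deriv_eq_zero hx) (not_lt.1 hV))
  have hVt' : -t - 1 < V z := by
    by_contra hV
    refine h ?_
    rw [cut_of_lt hz, hχ.deriv_eq_zero_of_le (not_lt.1 hV)]
    simp
  rw [Set.indicator_of_mem (show z ∈ {z | euclSq z < s ∧ V z < -t} from ⟨hz, hVt⟩),
    cut_of_lt hz, ← ofReal_norm, ← ENNReal.ofReal_pow (norm_nonneg _),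
    ← ENNReal.ofReal_mul (by positivity), ← ENNReal.ofReal_mul (by positivity),
    ← ENNReal.ofReal_mul (by positivity)]
  refine ENNReal.ofReal_le_ofReal ?_
  have h1 : ‖((deriv χ (V z) : ℝ) : ℂ) * f z‖ ^ 2 ≤ C ^ 2 * ‖f z‖ ^ 2 := by
    rw [norm_mul, mul_pow, Complex.norm_real]
    have := hχ.deriv_le (V z)
    gcongr
    exact this
  have h2 : Real.exp (-hWeight V V₀ γ z) ≤
      Real.exp (-2 * V₀ z) * (Real.exp ((γ + 2) * (t + 1)) * Real.exp (γ * V z)) := by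
    rw [← Real.exp_add, ← Real.exp_add, Real.exp_le_exp, hWeight]
    have := Real.exp_pos (γ * V z)
    nlinarith
  calc _ ≤ C ^ 2 * ‖f z‖ ^ 2 / (γ ^ 2 * Real.exp (γ * V z)) *
        (Real.exp (-2 * V₀ z) * (Real.exp ((γ + 2) * (t + 1)) * Real.exp (γ * V z))) := by gcongr
    _ = _ := by
      have := Real.exp_pos (γ * V z)
      field_simp

lemma exists_entire_step (hχ : IsCutoff χ t C) (hV : ContDiff ℝ ∞ V) (hV₀ : ContDiff ℝ ∞ V₀)
    (hL : ∀ z α, 0 ≤ levi V z α) (hL₀ : ∀ z α, 0 ≤ levi V₀ z α) (hA : 0 ≤ A)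
    (hq : ∀ z, A * (euclSq z - s) + M ≤ V z) (ht : 0 < t + M)
    (hf : DifferentiableOn ℂ f {z | euclSq z < s}) (hγ : 0 < γ) (hε : 0 < ε) :
    ∃ F : Cn n → ℂ, Differentiable ℂ F ∧
      ∫⁻ z in {z | euclSq z < s}, ‖cut χ V f s z - F z‖ₑ ^ 2 *
          ENNReal.ofReal (Real.exp (-hWeight V V₀ γ z)) ≤
        ENNReal.ofReal (8 * (C ^ 2 / γ ^ 2 * Real.exp ((γ + 2) * (t + 1)))) *
          (∫⁻ z in {z | euclSq z < s ∧ V z < -t}, ‖f z‖ₑ ^ 2 *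
            ENNReal.ofReal (Real.exp (-2 * V₀ z))) + ENNReal.ofReal ε := by
  have hg := isTest_cut hχ.smooth hχ.eq_zero hV hA hq ht hf
  have hdχ : ContDiff ℝ ∞ (deriv χ) := (contDiff_infty_iff_deriv.1 hχ.smooth).2
  have hh := isTest_cut hdχ (fun x hx => hχ.deriv_eq_zero hx) hV hA hq ht hf
  obtain ⟨Ψ, hΨ⟩ : ∃ Ψ, Ψ = hWeight V V₀ γ := ⟨_, rfl⟩
  have hΨs : ContDiff ℝ ∞ Ψ := hΨ ▸ contDiff_hWeight hV hV₀
  have hΨc := hΨs.continuous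
  have hVc := hV.continuous
  have hlf := isLocallyFinite_wt hΨc
  obtain ⟨b, hb⟩ : ∃ b : Cn n → ℝ, b = fun z =>
    ‖cut (deriv χ) V f s z‖ ^ 2 / (γ ^ 2 * Real.exp (γ * V z)) := ⟨_, rfl⟩
  have hbc : Continuous b := by
    rw [hb]
    exact (hh.continuous.norm.pow 2).div (by fun_prop) fun z => by positivity
  have hbs : HasCompactSupport b := by
    refine hh.supp.mono fun z hz => ?_
    contrapose! hz
    simp only [Function.mem_support, not_not] at hz
    simp [hb, hz]
  have hb0 : ∀ z, 0 ≤ b z := fun z => by rw [hb]; positivity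
  have hbi := hbc.integrable_wt hΨc hbs
  have hlev : ∀ z, ∀ v : Fin n → ℂ,
      2 * ‖∑ j, dzb j (cut χ V f s) z * conj (v j)‖ ≤ b z + levi Ψ z v := by
    intro z v
    have h1 : ∑ j, dzb j (cut χ V f s) z * conj (v j) =
        cut (deriv χ) V f s z * conj (∑ j, dPsi V j z * v j) := by
      rw [map_sum, Finset.mul_sum]
      refine Finset.sum_congr rfl fun j _ => ?_
      rw [dzb_cut hχ.smooth hχ.eq_zero hV hA hq ht hf, map_mul, mul_assoc]
    rw [h1, norm_mul, RCLike.norm_conj, hb, hΨ]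
    refine (two_mul_mul_le_div_add (e := γ ^ 2 * Real.exp (γ * V z)) (by positivity)).trans ?_
    have := le_levi_hWeight hV hV₀ hL hL₀ hγ.le z v
    gcongr
  obtain ⟨F, hF, hle⟩ := exists_entire_approx hΨs hg hbi hlev
    (isCompact_closedBall (0 : Cn n) (Real.sqrt s)) hε
  refine ⟨F, hF, ?_⟩
  have hcF : Continuous fun z => ‖cut χ V f s z - F z‖ ^ 2 :=
    (hg.continuous.sub hF.continuous).norm.pow 2
  have h1 := ofReal_integral_wt hΨc (fun z => by positivity) hcF
    (measurableSet_closedBall (x := (0 : Cn n)) (ε := Real.sqrt s))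
    (hcF.continuousOn.integrableOn_compact (isCompact_closedBall _ _))
  have h2 := ofReal_integral_wt hΨc hb0 hbc MeasurableSet.univ hbi.integrableOn
  rw [Measure.restrict_univ, Measure.restrict_univ] at h2
  have hsub : {z : Cn n | euclSq z < s} ⊆ Metric.closedBall 0 (Real.sqrt s) := fun z hz => by
    simpa using Real.le_sqrt_of_sq_le ((norm_sq_le_euclSq z).trans (le_of_lt hz))
  have hmeas : MeasurableSet {z : Cn n | euclSq z < s ∧ V z < -t} :=
    (isOpen_euclSq_lt s).measurableSet.inter (isOpen_lt hVc continuous_const).measurableSet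
  calc _ ≤ ∫⁻ z in Metric.closedBall 0 (Real.sqrt s), ‖cut χ V f s z - F z‖ₑ ^ 2 *
        ENNReal.ofReal (Real.exp (-hWeight V V₀ γ z)) := lintegral_mono_set hsub
    _ = ENNReal.ofReal (∫ z in Metric.closedBall 0 (Real.sqrt s),
        ‖cut χ V f s z - F z‖ ^ 2 ∂(wt Ψ)) := by
      rw [h1, hΨ]
      simp only [ENNReal.ofReal_pow (norm_nonneg _), ofReal_norm]
    _ ≤ ENNReal.ofReal (8 * (∫ z, b z ∂(wt Ψ)) + ε) := ENNReal.ofReal_le_ofReal hle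
    _ ≤ ENNReal.ofReal 8 * (∫⁻ z, ENNReal.ofReal (b z) * ENNReal.ofReal (Real.exp (-Ψ z)))
        + ENNReal.ofReal ε := by
      rw [← h2, ← ENNReal.ofReal_mul (by norm_num)]
      exact ENNReal.ofReal_add_le
    _ ≤ _ := by
      rw [ENNReal.ofReal_mul (by norm_num), mul_assoc]
      gcongr
      rw [← lintegral_const_mul' _ _ ENNReal.ofReal_ne_top, ← lintegral_indicator hmeas, hb, hΨ]
      exact lintegral_mono fun z => error_density_le hχ hγ z

end HormanderStep

section StepBounds

variable {V V₀ : Cn n → ℝ} {φ φ₀ : Cn n → EReal} {f : Cn n → ℂ} {χ : ℝ → ℝ}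
  {s t M M' M₀' C γ ε : ℝ} {z : Cn n}

lemma enorm_add_sq_le (a b : ℂ) : ‖a + b‖ₑ ^ 2 ≤ 2 * ‖a‖ₑ ^ 2 + 2 * ‖b‖ₑ ^ 2 := by
  have h : ‖a + b‖ ^ 2 ≤ 2 * ‖a‖ ^ 2 + 2 * ‖b‖ ^ 2 := by
    have h1 := norm_add_le a b
    have h2 : ‖a + b‖ ^ 2 ≤ (‖a‖ + ‖b‖) ^ 2 := by gcongr
    nlinarith [sq_nonneg (‖a‖ - ‖b‖)]
  have h2 := ENNReal.ofReal_le_ofReal h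
  rwa [ENNReal.ofReal_add (by positivity) (by positivity), ENNReal.ofReal_mul (by norm_num),
    ENNReal.ofReal_mul (by norm_num), ENNReal.ofReal_pow (norm_nonneg _),
    ENNReal.ofReal_pow (norm_nonneg _), ENNReal.ofReal_pow (norm_nonneg _), ofReal_norm,
    ofReal_norm, ofReal_norm, ENNReal.ofReal_ofNat] at h2

lemma ofReal_exp_le_wexp (h : φ z ≤ V z) :
    ENNReal.ofReal (Real.exp (-2 * V z)) ≤ wexp (-2) φ z := by
  rw [← wexp_neg_two_coe]
  exact wexp_neg_two_anti h

lemma enorm_sub_cut_sq_le (hχ : IsCutoff χ t C) (hz : euclSq z < s) (hφ₀ : φ₀ z ≤ V₀ z) :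
    ‖f z - cut χ V f s z‖ₑ ^ 2 *
        (ENNReal.ofReal (Real.exp (-2 * V z)) * ENNReal.ofReal (Real.exp (-2 * V₀ z))) ≤
      ENNReal.ofReal (Real.exp (2 * (t + 1))) * (‖f z‖ₑ ^ 2 * wexp (-2) φ₀ z) := by
  rw [cut_of_lt hz]
  rcases le_total (V z) (-t - 1) with h | h
  · simp [hχ.eq_one _ h]
  · have h1 : ‖f z - (χ (V z) : ℂ) * f z‖ₑ ≤ ‖f z‖ₑ := by
      have : f z - (χ (V z) : ℂ) * f z = ((1 - χ (V z) : ℝ) : ℂ) * f z := by push_cast; ring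
      rw [this, enorm_mul]
      refine mul_le_of_le_one_left' ?_
      rw [← ofReal_norm, Complex.norm_real, Real.norm_of_nonneg (by linarith [hχ.le_one (V z)])]
      exact ENNReal.ofReal_le_one.2 (by linarith [hχ.nonneg (V z)])
    have h2 : ENNReal.ofReal (Real.exp (-2 * V z)) ≤ ENNReal.ofReal (Real.exp (2 * (t + 1))) :=
      ENNReal.ofReal_le_ofReal (Real.exp_le_exp.2 (by linarith))
    calc _ ≤ ‖f z‖ₑ ^ 2 * (ENNReal.ofReal (Real.exp (2 * (t + 1))) * wexp (-2) φ₀ z) := by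
          gcongr
          exact ofReal_exp_le_wexp hφ₀
      _ = _ := by ring

lemma exp_mul_exp_le_hWeight (hγ : 0 ≤ γ) (h : V z ≤ M') :
    ENNReal.ofReal (Real.exp (-2 * V z)) * ENNReal.ofReal (Real.exp (-2 * V₀ z)) ≤
      ENNReal.ofReal (Real.exp (Real.exp (γ * M'))) *
        ENNReal.ofReal (Real.exp (-hWeight V V₀ γ z)) := by
  rw [← ENNReal.ofReal_mul (by positivity), ← ENNReal.ofReal_mul (by positivity),
    ← Real.exp_add, ← Real.exp_add]
  refine ENNReal.ofReal_le_ofReal (Real.exp_le_exp.2 ?_)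
  have : Real.exp (γ * V z) ≤ Real.exp (γ * M') := by gcongr
  rw [hWeight]
  linarith

lemma one_le_hWeight (hγ : 0 ≤ γ) (h : V z ≤ M') (h₀ : V₀ z ≤ M₀') :
    1 ≤ ENNReal.ofReal (Real.exp (2 * M' + 2 * M₀' + Real.exp (γ * M'))) *
        ENNReal.ofReal (Real.exp (-hWeight V V₀ γ z)) := by
  rw [← ENNReal.ofReal_mul (by positivity), ← Real.exp_add, ENNReal.one_le_ofReal,
    Real.one_le_exp_iff]
  have : Real.exp (γ * V z) ≤ Real.exp (γ * M') := by gcongr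
  rw [hWeight]
  linarith

lemma enorm_cut_sq_le (hχ : IsCutoff χ t C) (hM : φ₀ z ≤ M) :
    ‖cut χ V f s z‖ₑ ^ 2 ≤ Set.indicator {z | V z < -t} (fun z =>
      ENNReal.ofReal (Real.exp (2 * M)) * (‖f z‖ₑ ^ 2 * wexp (-2) φ₀ z)) z := by
  by_cases h : cut χ V f s z = 0
  · simp [h]
  have hz : euclSq z < s := by
    by_contra hz
    exact h (if_neg hz)
  have hVt : V z < -t := by
    by_contra hV
    exact h (cut_eq_zero hχ.eq_zero (not_lt.1 hV))
  rw [Set.indicator_of_mem (show z ∈ {z | V z < -t} from hVt), cut_of_lt hz, enorm_mul]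
  have h1 : ‖(χ (V z) : ℂ)‖ₑ ≤ 1 := by
    rw [← ofReal_norm, Complex.norm_real, Real.norm_of_nonneg (hχ.nonneg _)]
    exact ENNReal.ofReal_le_one.2 (hχ.le_one _)
  have h2 : 1 ≤ ENNReal.ofReal (Real.exp (2 * M)) * wexp (-2) φ₀ z := by
    have h3 := ofReal_exp_le_wexp (V := fun _ => M) hM
    refine le_trans ?_ (mul_le_mul_right h3 _)
    rw [← ENNReal.ofReal_mul (by positivity), ← Real.exp_add]
    simp
  calc (‖(χ (V z) : ℂ)‖ₑ * ‖f z‖ₑ) ^ 2 ≤ (1 * ‖f z‖ₑ) ^ 2 := by gcongr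
    _ = ‖f z‖ₑ ^ 2 * 1 := by ring
    _ ≤ ‖f z‖ₑ ^ 2 * (ENNReal.ofReal (Real.exp (2 * M)) * wexp (-2) φ₀ z) := by gcongr
    _ = _ := by ring

end StepBounds

section StepIntegrals

variable {V V₀ : ℕ → Cn n → ℝ} {φ φ₀ : Cn n → EReal} {f : Cn n → ℂ} {χ : ℝ → ℝ}
  {s t M M' M₀' C γ ε : ℝ} {z : Cn n}

lemma exists_entire_bounds (hR : IsRegularization φ M M' s V)
    (hR₀ : IsRegularization φ₀ M M₀' s V₀) (hM₀ : ∀ z, euclSq z < s → φ₀ z ≤ M)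
    (hχ : IsCutoff χ t C) (ht : 0 < t + M) (hf : DifferentiableOn ℂ f {z | euclSq z < s})
    (hγ : 0 < γ) (hε : 0 < ε) (k : ℕ) {N I E : ℝ≥0∞}
    (hN : N = ∫⁻ z in {z | euclSq z < s}, ‖f z‖ₑ ^ 2 * wexp (-2) φ₀ z)
    (hI : I = ∫⁻ z in {z | euclSq z < s ∧ φ z < ((-t : ℝ) : EReal)}, ‖f z‖ₑ ^ 2 * wexp (-2) φ₀ z)
    (hE : E = ENNReal.ofReal (8 * (C ^ 2 / γ ^ 2 * Real.exp ((γ + 2) * (t + 1)))) * I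
      + ENNReal.ofReal ε) :
    ∃ F : Cn n → ℂ, Differentiable ℂ F ∧
      (∫⁻ z in {z | euclSq z < s}, ‖f z - F z‖ₑ ^ 2 *
        (ENNReal.ofReal (Real.exp (-2 * V k z)) * ENNReal.ofReal (Real.exp (-2 * V₀ k z))) ≤
        2 * (ENNReal.ofReal (Real.exp (2 * (t + 1))) * N) +
          2 * (ENNReal.ofReal (Real.exp (Real.exp (γ * M'))) * E)) ∧
      ∫⁻ z in {z | euclSq z < s}, ‖F z‖ₑ ^ 2 ≤ 2 * (ENNReal.ofReal (Real.exp (2 * M)) * I) +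
        2 * (ENNReal.ofReal (Real.exp (2 * M' + 2 * M₀' + Real.exp (γ * M'))) * E) := by
  have hVs := hR.smooth k
  have hV₀s := hR₀.smooth k
  have hVc := hVs.continuous
  have hms := (isOpen_euclSq_lt (n := n) s).measurableSet
  have hmV : MeasurableSet {z | V k z < -t} := (isOpen_lt hVc continuous_const).measurableSet
  obtain ⟨F, hF, hle⟩ := exists_entire_step hχ hVs hV₀s (hR.levi_nonneg k) (hR₀.levi_nonneg k)
    (Nat.cast_nonneg k) (hR.quad_le k) ht hf hγ hε
  have hg := (isTest_cut hχ.smooth hχ.eq_zero hVs (Nat.cast_nonneg k) (hR.quad_le k) ht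
    hf).continuous
  have hVI : ∫⁻ z in {z | euclSq z < s ∧ V k z < -t}, ‖f z‖ₑ ^ 2 * wexp (-2) φ₀ z ≤ I := by
    rw [hI]
    refine lintegral_mono_set fun z hz => ⟨hz.1, ?_⟩
    exact (hR.le k z hz.1).trans_lt (EReal.coe_lt_coe_iff.2 hz.2)
  have hmeas2 : MeasurableSet {z | euclSq z < s ∧ V k z < -t} := hms.inter hmV
  have hEle : ∫⁻ z in {z | euclSq z < s}, ‖cut χ (V k) f s z - F z‖ₑ ^ 2 *
      ENNReal.ofReal (Real.exp (-hWeight (V k) (V₀ k) γ z)) ≤ E := by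
    refine hle.trans ?_
    rw [hE]
    gcongr
    refine le_trans (setLIntegral_mono' hmeas2 fun z hz => ?_) hVI
    gcongr
    exact ofReal_exp_le_wexp (hR₀.le k z hz.1)
  have hwc : Continuous (hWeight (V k) (V₀ k) γ) := (contDiff_hWeight hVs hV₀s).continuous
  have hme : Measurable fun z => ‖cut χ (V k) f s z - F z‖ₑ ^ 2 *
      ENNReal.ofReal (Real.exp (-hWeight (V k) (V₀ k) γ z)) :=
    ((hg.sub hF.continuous).enorm.measurable.pow_const 2).mul
      (continuous_wt_density hwc).measurable.ennreal_ofReal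
  refine ⟨F, hF, ?_, ?_⟩
  · calc _ ≤ ∫⁻ z in {z | euclSq z < s},
          (2 * (ENNReal.ofReal (Real.exp (2 * (t + 1))) * (‖f z‖ₑ ^ 2 * wexp (-2) φ₀ z)) +
          2 * (ENNReal.ofReal (Real.exp (Real.exp (γ * M'))) * (‖cut χ (V k) f s z - F z‖ₑ ^ 2 *
            ENNReal.ofReal (Real.exp (-hWeight (V k) (V₀ k) γ z))))) := by
          refine setLIntegral_mono' hms fun z hz => ?_
          have h1 := enorm_add_sq_le (f z - cut χ (V k) f s z) (cut χ (V k) f s z - F z)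
          rw [sub_add_sub_cancel] at h1
          have h2 := enorm_sub_cut_sq_le (f := f) (V := V k) hχ hz (hR₀.le k z hz)
          have h3 := exp_mul_exp_le_hWeight (V₀ := V₀ k) hγ.le (hR.le_const k z hz)
          refine (mul_le_mul_left h1 _).trans ?_
          rw [add_mul, mul_assoc, mul_assoc]
          refine add_le_add (by gcongr) ?_
          rw [mul_left_comm (ENNReal.ofReal (Real.exp (Real.exp (γ * M'))))]
          gcongr
      _ = 2 * (ENNReal.ofReal (Real.exp (2 * (t + 1))) * N) +
          2 * (ENNReal.ofReal (Real.exp (Real.exp (γ * M'))) *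
          ∫⁻ z in {z | euclSq z < s}, ‖cut χ (V k) f s z - F z‖ₑ ^ 2 *
            ENNReal.ofReal (Real.exp (-hWeight (V k) (V₀ k) γ z))) := by
        rw [lintegral_add_right _ ((hme.const_mul _).const_mul _),
          lintegral_const_mul' _ _ (by simp), lintegral_const_mul' _ _ ENNReal.ofReal_ne_top,
          lintegral_const_mul' _ _ (by simp), lintegral_const_mul' _ _ ENNReal.ofReal_ne_top, hN]
      _ ≤ _ := by gcongr
  · calc _ ≤ ∫⁻ z in {z | euclSq z < s}, (2 * Set.indicator {z | V k z < -t} (fun z =>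
          ENNReal.ofReal (Real.exp (2 * M)) * (‖f z‖ₑ ^ 2 * wexp (-2) φ₀ z)) z +
          2 * (ENNReal.ofReal (Real.exp (2 * M' + 2 * M₀' + Real.exp (γ * M'))) *
            (‖cut χ (V k) f s z - F z‖ₑ ^ 2 *
            ENNReal.ofReal (Real.exp (-hWeight (V k) (V₀ k) γ z))))) := by
          refine setLIntegral_mono' hms fun z hz => ?_
          have h1 := enorm_add_sq_le (cut χ (V k) f s z) (F z - cut χ (V k) f s z)
          rw [add_sub_cancel, enorm_sub_rev] at h1
          have h2 := enorm_cut_sq_le (f := f) (s := s) (V := V k) hχ (hM₀ z hz)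
          have h3 := one_le_hWeight hγ.le (hR.le_const k z hz) (hR₀.le_const k z hz)
          refine h1.trans ?_
          refine add_le_add (by gcongr) ?_
          rw [mul_left_comm (ENNReal.ofReal (Real.exp _))]
          gcongr
          exact le_mul_of_one_le_right' h3
      _ = 2 * (ENNReal.ofReal (Real.exp (2 * M)) *
          ∫⁻ z in {z | euclSq z < s ∧ V k z < -t}, ‖f z‖ₑ ^ 2 * wexp (-2) φ₀ z) +
          2 * (ENNReal.ofReal (Real.exp (2 * M' + 2 * M₀' + Real.exp (γ * M'))) *
          ∫⁻ z in {z | euclSq z < s}, ‖cut χ (V k) f s z - F z‖ₑ ^ 2 *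
            ENNReal.ofReal (Real.exp (-hWeight (V k) (V₀ k) γ z))) := by
        rw [lintegral_add_right _ ((hme.const_mul _).const_mul _),
          lintegral_const_mul' _ _ (by simp), lintegral_indicator hmV,
          lintegral_const_mul' _ _ ENNReal.ofReal_ne_top,
          lintegral_const_mul' _ _ (by simp), lintegral_const_mul' _ _ ENNReal.ofReal_ne_top,
          Measure.restrict_restrict hmV, Set.inter_comm]
        rfl
      _ ≤ _ := by gcongr

end StepIntegrals

section GermLimit

variable {ρ s m : ℝ} {d : (Fin n → ℕ) → ℂ}

lemma summable_half_pow (n : ℕ) : Summable fun a : Fin n → ℕ => (1 / 2 : ℝ) ^ (∑ j, a j) := by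
  simpa only [Finset.prod_pow_eq_pow_sum] using
    summable_prod_pow (n := n) (x := fun _ => 1 / 2) (fun _ => by norm_num) (fun _ => by norm_num)

lemma mul_pow_le_half_pow {x : ℝ} {N : ℕ} (h : x * (2 * ρ) ^ N ≤ m) :
    x * ρ ^ N ≤ m * (1 / 2) ^ N := by
  have h1 : x * ρ ^ N = x * (2 * ρ) ^ N * (1 / 2) ^ N := by
    rw [mul_assoc, ← mul_pow]
    congr 2
    ring
  rw [h1]
  gcongr

lemma norm_mul_mono_le {z : Cn n} (hz : ‖z‖ < ρ) {c : ℂ} {a : Fin n → ℕ}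
    (h : ‖c‖ * (2 * ρ) ^ (∑ j, a j) ≤ m) : ‖c * mono a z‖ ≤ m * (1 / 2) ^ (∑ j, a j) := by
  refine le_trans ?_ (mul_pow_le_half_pow h)
  rw [norm_mul]
  gcongr
  rw [← Finset.prod_pow_eq_pow_sum]
  exact norm_mono_le fun j => (norm_le_pi_norm z j).trans hz.le

lemma summable_of_coeff_le (hρ : 0 < ρ) (hd : ∀ a, ‖d a‖ * (2 * ρ) ^ (∑ j, a j) ≤ m) :
    Summable fun a => ‖d a‖ * ρ ^ (∑ j, a j) :=
  ((summable_half_pow n).mul_left m).of_nonneg_of_le (fun a => by positivity)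
    fun a => mul_pow_le_half_pow (hd a)

lemma tsum_le_of_coeff_le (hρ : 0 < ρ) (hd : ∀ a, ‖d a‖ * (2 * ρ) ^ (∑ j, a j) ≤ m) :
    ∑' a, ‖d a‖ * ρ ^ (∑ j, a j) ≤ m * ∑' a : Fin n → ℕ, (1 / 2 : ℝ) ^ (∑ j, a j) := by
  rw [← tsum_mul_left]
  exact (summable_of_coeff_le hρ hd).tsum_le_tsum (fun a => mul_pow_le_half_pow (hd a))
    ((summable_half_pow n).mul_left m)

/-- Montel's theorem: a bounded sequence of holomorphic functions has a convergent subsequence. -/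
lemma exists_subseq_tendsto_germ (hρ : 0 < ρ) {F : ℕ → Cn n → ℂ}
    (hF : ∀ k, Differentiable ℂ (F k)) (hm : ∀ k z, ‖z‖ ≤ 2 * ρ → ‖F k z‖ ≤ m) :
    ∃ (d : (Fin n → ℕ) → ℂ) (θ : ℕ → ℕ), StrictMono θ ∧
      (∀ a, ‖d a‖ * (2 * ρ) ^ (∑ j, a j) ≤ m) ∧
      ∀ z, ‖z‖ < ρ → Tendsto (fun k => F (θ k) z) atTop (𝓝 (germ d z)) := by
  choose c hc hsum using fun k => exists_powerSeries (R := 2 * ρ) (R' := 3 * ρ) (by positivity)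
    (by linarith) (hF k).differentiableOn (hm k)
  have hK : IsCompact (Set.pi Set.univ fun a : Fin n → ℕ =>
      Metric.closedBall (0 : ℂ) (m / (2 * ρ) ^ (∑ j, a j))) :=
    isCompact_univ_pi fun a => isCompact_closedBall _ _
  obtain ⟨d, hd, θ, hθ, hlim⟩ := hK.tendsto_subseq (x := c) fun k a _ => by
    rw [mem_closedBall_zero_iff, le_div_iff₀ (by positivity)]
    exact hc k a
  refine ⟨d, θ, hθ, fun a => ?_, fun z hz => ?_⟩
  · have := hd a trivial
    rwa [mem_closedBall_zero_iff, le_div_iff₀ (by positivity)] at this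
  · have h1 (k : ℕ) : F (θ k) z = ∑' a, c (θ k) a * mono a z :=
      ((hsum (θ k) z (by linarith)).tsum_eq).symm
    simp only [h1]
    refine tendsto_tsum_of_dominated_convergence ((summable_half_pow n).mul_left m) (fun a => ?_)
      (Eventually.of_forall fun k a => norm_mul_mono_le hz (hc (θ k) a))
    exact ((tendsto_pi_nhds.1 hlim) a).mul_const _

end GermLimit

section WeightLimit

variable {V V₀ : ℕ → Cn n → ℝ} {φ φ₀ : Cn n → EReal} {f : Cn n → ℂ}
  {s ρ : ℝ}

lemma le_liminf_density {F : ℕ → Cn n → ℂ} {g : Cn n → ℂ} {z : Cn n}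
    (hF : Tendsto (fun k => F k z) atTop (𝓝 (g z)))
    (hV : Tendsto (fun k => (V k z : EReal)) atTop (𝓝 (φ z)))
    (hV₀ : Tendsto (fun k => (V₀ k z : EReal)) atTop (𝓝 (φ₀ z))) (h : φ z < ⊤) (h₀ : φ₀ z < ⊤) :
    ‖f z - g z‖ₑ ^ 2 * (wexp (-2) φ z * wexp (-2) φ₀ z) ≤
      liminf (fun k => ‖f z - F k z‖ₑ ^ 2 * (ENNReal.ofReal (Real.exp (-2 * V k z)) *
        ENNReal.ofReal (Real.exp (-2 * V₀ k z)))) atTop := by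
  by_cases hz : f z - g z = 0
  · simp [hz]
  have h1 := wexp_neg_two_ne_zero h
  have h2 := wexp_neg_two_ne_zero h₀
  have h3 : Tendsto (fun k => ‖f z - F k z‖ₑ ^ 2) atTop (𝓝 (‖f z - g z‖ₑ ^ 2)) :=
    ((ENNReal.continuous_pow 2).tendsto _).comp ((tendsto_const_nhds.sub hF).enorm)
  refine (ENNReal.Tendsto.mul h3 (Or.inl (by simpa using hz))
    (ENNReal.Tendsto.mul (tendsto_wexp_neg_two hV) (Or.inl h1) (tendsto_wexp_neg_two hV₀)
      (Or.inl h2)) (Or.inl (mul_ne_zero h1 h2))).liminf_eq.ge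

/-- The weight `e^{-2φ - 2φ₀}` on the ball `|z|² < s`, extended by zero. -/
def ballWeight (φ φ₀ : Cn n → EReal) (s : ℝ) : Cn n → ℝ≥0∞ :=
  Set.indicator {z | euclSq z < s} fun z => wexp (-2) φ z * wexp (-2) φ₀ z

lemma measurable_indicator_wexp (hφ : UpperSemicontinuousOn φ {z | euclSq z < s}) :
    Measurable (Set.indicator {z | euclSq z < s} (wexp (-2) φ)) := by
  have hm := (isOpen_euclSq_lt (n := n) s).measurableSet
  have h1 : Measurable (Set.domRestrict {z | euclSq z < s} φ) :=
    (upperSemicontinuousOn_iff_restrict.2 hφ).measurable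
  refine measurable_of_restrict_of_restrict_compl hm ?_ ?_
  · have h2 : Set.domRestrict {z | euclSq z < s} (Set.indicator {z | euclSq z < s} (wexp (-2) φ)) =
        fun z => (EReal.exp (Set.domRestrict {z | euclSq z < s} φ z))⁻¹ ^ 2 := by
      funext z
      rw [Set.domRestrict_apply, Set.indicator_of_mem z.2, wexp_neg_two, Set.domRestrict_apply]
    rw [h2]
    exact ((EReal.measurable_exp.comp h1).inv).pow_const 2
  · have h2 : Set.domRestrict {z | euclSq z < s}ᶜ
        (Set.indicator {z | euclSq z < s} (wexp (-2) φ)) = fun _ => 0 := by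
      funext z
      rw [Set.domRestrict_apply, Set.indicator_of_notMem z.2]
    rw [h2]
    exact measurable_const

lemma measurable_ballWeight (hφ : UpperSemicontinuousOn φ {z | euclSq z < s})
    (hφ₀ : UpperSemicontinuousOn φ₀ {z | euclSq z < s}) : Measurable (ballWeight φ φ₀ s) := by
  have := (measurable_indicator_wexp hφ).mul (measurable_indicator_wexp hφ₀)
  convert this using 1
  funext z
  by_cases hz : z ∈ {z : Cn n | euclSq z < s} <;> simp [ballWeight, hz]

lemma euclSq_lt_of_norm_le (hs : n * (3 * ρ) ^ 2 < s) {z : Cn n} (hz : ‖z‖ ≤ 3 * ρ) :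
    euclSq z < s := by
  refine lt_of_le_of_lt (euclSq_le_norm_sq z) (lt_of_le_of_lt ?_ hs)
  gcongr

lemma exists_germ_of_bounds (hρ : 0 < ρ) (hs : n * (3 * ρ) ^ 2 < s) :
    ∃ B : ℝ, 0 ≤ B ∧ ∀ {V V₀ : ℕ → Cn n → ℝ} {φ φ₀ : Cn n → EReal} {f : Cn n → ℂ}
      {M M' M₀' : ℝ}, IsRegularization φ M M' s V → IsRegularization φ₀ M M₀' s V₀ →
      (∀ z, euclSq z < s → φ z ≤ M) → (∀ z, euclSq z < s → φ₀ z ≤ M) →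
      DifferentiableOn ℂ f {z | euclSq z < s} → ∀ {F : ℕ → Cn n → ℂ} {D K : ℝ≥0∞},
      D ≠ ⊤ → K ≠ ⊤ → (∀ k, Differentiable ℂ (F k)) →
      (∀ k, ∫⁻ z in {z | euclSq z < s}, ‖F k z‖ₑ ^ 2 ≤ D) →
      (∀ k, ∫⁻ z in {z | euclSq z < s}, ‖f z - F k z‖ₑ ^ 2 *
        (ENNReal.ofReal (Real.exp (-2 * V k z)) * ENNReal.ofReal (Real.exp (-2 * V₀ k z))) ≤ K) →
      ∃ d : (Fin n → ℕ) → ℂ, (Summable fun b => ‖d b‖ * ρ ^ (∑ j, b j)) ∧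
        ∑' b, ‖d b‖ * ρ ^ (∑ j, b j) ≤ B * Real.sqrt D.toReal ∧
        SqIntNear (ballWeight φ φ₀ s) (fun z => f z - germ d z) := by
  obtain ⟨B, hB⟩ := exists_enorm_sq_le_lintegral n hρ
  obtain ⟨S, hS⟩ : ∃ S, S = ∑' a : Fin n → ℕ, (1 / 2 : ℝ) ^ (∑ j, a j) := ⟨_, rfl⟩
  have hS0 : 0 ≤ S := hS ▸ tsum_nonneg fun a => by positivity
  refine ⟨Real.sqrt B * S, by positivity, ?_⟩
  intro V V₀ φ φ₀ f M M' M₀' hR hR₀ hM hM₀ hf F D K hD hK hF hFD hFK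
  have hbd : ∀ k z, ‖z‖ ≤ 2 * ρ → ‖F k z‖ ≤ Real.sqrt B * Real.sqrt D.toReal := by
    intro k z hz
    have h1 : ‖F k z‖ₑ ^ 2 ≤ B * D := by
      refine (hB (F k) z (hF k).differentiableOn).trans (mul_le_mul_right ?_ _)
      refine (lintegral_mono_set fun x hx => euclSq_lt_of_norm_le hs ?_).trans (hFD k)
      have h2 : ‖x - z‖ ≤ ρ := by simpa [dist_eq_norm] using hx
      have h3 := norm_add_le z (x - z)
      rw [add_sub_cancel] at h3
      linarith
    have h2 := ENNReal.toReal_mono (ENNReal.mul_ne_top ENNReal.coe_ne_top hD) h1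
    rw [ENNReal.toReal_pow, toReal_enorm, ENNReal.toReal_mul, ENNReal.coe_toReal] at h2
    rw [← Real.sqrt_mul (NNReal.coe_nonneg B)]
    exact Real.le_sqrt_of_sq_le h2
  obtain ⟨d, θ, hθ, hd, hlim⟩ := exists_subseq_tendsto_germ hρ hF hbd
  refine ⟨d, summable_of_coeff_le hρ hd, (tsum_le_of_coeff_le hρ hd).trans (le_of_eq ?_),
    Metric.ball 0 ρ, Metric.ball_mem_nhds 0 hρ, lt_of_le_of_lt ?_ hK.lt_top⟩
  · rw [hS]; ring
  have hin : ∀ z ∈ Metric.ball (0 : Cn n) ρ, euclSq z < s := fun z hz =>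
    euclSq_lt_of_norm_le hs (by have := mem_ball_zero_iff.1 hz; linarith)
  have hmb : MeasurableSet (Metric.ball (0 : Cn n) ρ) := measurableSet_ball
  calc ∫⁻ z in Metric.ball 0 ρ, ‖f z - germ d z‖ₑ ^ 2 * ballWeight φ φ₀ s z
      ≤ ∫⁻ z in Metric.ball 0 ρ, liminf (fun k => ‖f z - F (θ k) z‖ₑ ^ 2 *
        (ENNReal.ofReal (Real.exp (-2 * V (θ k) z)) *
          ENNReal.ofReal (Real.exp (-2 * V₀ (θ k) z)))) atTop := by
        refine setLIntegral_mono' hmb fun z hz => ?_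
        have hzs := hin z hz
        rw [ballWeight, Set.indicator_of_mem (show z ∈ {z | euclSq z < s} from hzs)]
        exact le_liminf_density (F := fun k => F (θ k)) (V := fun k => V (θ k))
          (V₀ := fun k => V₀ (θ k)) (hlim z (mem_ball_zero_iff.1 hz))
          ((hR.tendsto z hzs).comp hθ.tendsto_atTop) ((hR₀.tendsto z hzs).comp hθ.tendsto_atTop)
          ((hM z hzs).trans_lt (EReal.coe_lt_top M)) ((hM₀ z hzs).trans_lt (EReal.coe_lt_top M))
    _ ≤ liminf (fun k => ∫⁻ z in Metric.ball 0 ρ, ‖f z - F (θ k) z‖ₑ ^ 2 *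
        (ENNReal.ofReal (Real.exp (-2 * V (θ k) z)) *
          ENNReal.ofReal (Real.exp (-2 * V₀ (θ k) z)))) atTop := by
        refine lintegral_liminf_le' fun k => ?_
        have hc1 := (hR.smooth (θ k)).continuous
        have hc2 := (hR₀.smooth (θ k)).continuous
        have hc3 : AEMeasurable (fun z => f z - F (θ k) z)
            (volume.restrict (Metric.ball (0 : Cn n) ρ)) :=
          ((hf.continuousOn.mono hin).sub (hF (θ k)).continuous.continuousOn).aemeasurable hmb
        have hc4 : Continuous fun z => Real.exp (-2 * V (θ k) z) := by fun_prop
        have hc5 : Continuous fun z => Real.exp (-2 * V₀ (θ k) z) := by fun_prop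
        exact (hc3.enorm.pow_const 2).mul
          (hc4.measurable.ennreal_ofReal.mul hc5.measurable.ennreal_ofReal).aemeasurable
    _ ≤ K := by
        refine liminf_le_of_le (by isBoundedDefault) fun b hb => ?_
        obtain ⟨k, hk⟩ := hb.exists
        exact (hk.trans (lintegral_mono_set hin)).trans (hFK (θ k))

end WeightLimit

section Criterion

variable {φ φ₀ : Cn n → EReal} {f : Cn n → ℂ} {s M : ℝ}

lemma exists_pos_mul_sq_lt (n : ℕ) (hs : 0 < s) : ∃ ρ : ℝ, 0 < ρ ∧ n * (3 * ρ) ^ 2 < s := by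
  refine ⟨Real.sqrt (s / (9 * (n + 1))), by positivity, ?_⟩
  rw [mul_pow, Real.sq_sqrt (by positivity)]
  have h : (n : ℝ) * (3 ^ 2 * (s / (9 * (n + 1)))) = s * (n / (n + 1)) := by
    field_simp
    norm_num
  rw [h]
  refine mul_lt_of_lt_one_right hs ?_
  rw [div_lt_one (by positivity)]
  linarith

lemma exists_germ_eqOn {ρ : ℝ} (hρ : 0 < ρ) (hf : DifferentiableOn ℂ f (Metric.ball 0 (3 * ρ))) :
    ∃ c : (Fin n → ℕ) → ℂ, (Summable fun b => ‖c b‖ * ρ ^ (∑ j, b j)) ∧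
      ∀ z, ‖z‖ < ρ → HasSum (fun a => c a * mono a z) (f z) := by
  have hsub : Metric.closedBall (0 : Cn n) (2 * ρ) ⊆ Metric.ball 0 (3 * ρ) :=
    Metric.closedBall_subset_ball (by linarith)
  obtain ⟨m, hm⟩ := (isCompact_closedBall (0 : Cn n) (2 * ρ)).exists_bound_of_continuousOn
    (hf.continuousOn.mono hsub)
  obtain ⟨c, hc, hsum⟩ := exists_powerSeries (R := 2 * ρ) (R' := 3 * ρ) (by positivity)
    (by linarith) hf fun z hz => hm z (mem_closedBall_zero_iff.2 hz)
  exact ⟨c, summable_of_coeff_le hρ hc, fun z hz => hsum z (by linarith)⟩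

lemma summable_coeff_mul_mono {ρ : ℝ} {d : (Fin n → ℕ) → ℂ}
    (hd : Summable fun b => ‖d b‖ * ρ ^ (∑ j, b j)) {z : Cn n} (hz : ‖z‖ < ρ) :
    Summable fun a => d a * mono a z := by
  refine Summable.of_norm_bounded hd fun a => ?_
  rw [norm_mul, ← Finset.prod_pow_eq_pow_sum]
  gcongr
  exact norm_mono_le fun j => (norm_le_pi_norm z j).trans hz.le

lemma tendsto_exp_neg_mul {γ : ℝ} (hγ : 0 < γ) :
    Tendsto (fun t : ℝ => Real.exp (-(γ * t))) atTop (𝓝 0) :=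
  Real.tendsto_exp_neg_atTop_nhds_zero.comp (tendsto_id.const_mul_atTop hγ)

lemma tendsto_decayBound {γ : ℝ} (hγ : 0 < γ) (a b κ : ℝ) :
    Tendsto (fun t : ℝ => 2 * (a * Real.exp (-(2 * (γ + 1) * t))) +
      2 * (b * (κ * Real.exp ((γ + 2) * (t + 1)) * Real.exp (-(2 * (γ + 1) * t)) +
        Real.exp (-(1 * t))))) atTop (𝓝 0) := by
  have h1 (t : ℝ) : κ * Real.exp ((γ + 2) * (t + 1)) * Real.exp (-(2 * (γ + 1) * t)) =
      κ * Real.exp (γ + 2) * Real.exp (-(γ * t)) := by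
    rw [mul_assoc κ, mul_assoc κ, ← Real.exp_add, ← Real.exp_add]
    ring_nf
  simp only [h1]
  have h2 := tendsto_exp_neg_mul (γ := 2 * (γ + 1)) (by positivity)
  have h3 := tendsto_exp_neg_mul hγ
  have h4 := tendsto_exp_neg_mul one_pos
  simpa using ((h2.const_mul a).const_mul 2).add
    ((((h3.const_mul (κ * Real.exp (γ + 2))).add h4).const_mul b).const_mul 2)

/-- If the mass of `|f|² e^{-2φ₀}` on `{φ < -t}` is at most `e^{-2ct}` with `c > 1` for arbitrarily
large `t`, then `|f|² e^{-2φ - 2φ₀}` is integrable near the origin. -/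
theorem sqIntNear_of_frequently_le {Ω : Set (Cn n)} (hφ : PSHOn φ Ω) (hφ₀ : PSHOn φ₀ Ω)
    (hs : 0 < s) (hΩ : {z | euclSq z < s} ⊆ Ω) (hM : ∀ z, euclSq z < s → φ z ≤ M)
    (hM₀ : ∀ z, euclSq z < s → φ₀ z ≤ M) (hf : DifferentiableOn ℂ f {z | euclSq z < s})
    (hN : ∫⁻ z in {z | euclSq z < s}, ‖f z‖ₑ ^ 2 * wexp (-2) φ₀ z ≠ ⊤) {γ : ℝ} (hγ : 0 < γ)
    (hI : ∃ᶠ t : ℝ in atTop, ∫⁻ z in {z | euclSq z < s ∧ φ z < ((-t : ℝ) : EReal)},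
      ‖f z‖ₑ ^ 2 * wexp (-2) φ₀ z ≤ ENNReal.ofReal (Real.exp (-(2 * (γ + 1) * t)))) :
    SqIntNear (ballWeight φ φ₀ s) f := by
  obtain ⟨ρ, hρ, hρs⟩ := exists_pos_mul_sq_lt n hs
  obtain ⟨M', V, hR⟩ := exists_isRegularization hφ hΩ hM
  obtain ⟨M₀', V₀, hR₀⟩ := exists_isRegularization hφ₀ hΩ hM₀
  obtain ⟨C, hC, hχ⟩ := exists_isCutoff
  obtain ⟨B, hB, hgerm⟩ := exists_germ_of_bounds hρ hρs
  obtain ⟨c, hc, hfc⟩ := exists_germ_eqOn hρ (hf.mono fun z hz =>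
    euclSq_lt_of_norm_le hρs (mem_ball_zero_iff.1 hz).le)
  refine SqIntNear.congr hρ (fun z hz => (hfc z (mem_ball_zero_iff.1 hz)).tsum_eq.symm)
    (SqIntNear.of_approx (measurable_ballWeight (hφ.usc.mono hΩ) (hφ₀.usc.mono hΩ)) hρ hc
      fun ε hε => ?_)
  obtain ⟨a, ha⟩ : ∃ a, a = Real.exp (2 * M) := ⟨_, rfl⟩
  obtain ⟨b, hb⟩ : ∃ b, b = Real.exp (2 * M' + 2 * M₀' + Real.exp (γ * M')) := ⟨_, rfl⟩
  have ha0 : 0 ≤ a := ha ▸ (Real.exp_pos _).le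
  have hb0 : 0 ≤ b := hb ▸ (Real.exp_pos _).le
  have hlim : Tendsto (fun t : ℝ => B * Real.sqrt (2 * (a * Real.exp (-(2 * (γ + 1) * t))) +
      2 * (b * (8 * (C ^ 2 / γ ^ 2) * Real.exp ((γ + 2) * (t + 1)) *
        Real.exp (-(2 * (γ + 1) * t)) + Real.exp (-(1 * t)))))) atTop (𝓝 0) := by
    simpa using ((tendsto_decayBound hγ a b (8 * (C ^ 2 / γ ^ 2))).sqrt).const_mul B
  obtain ⟨t, htI, htε, htM⟩ := (hI.and_eventually ((hlim.eventually_le_const hε).and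
    (eventually_gt_atTop (-M)))).exists
  obtain ⟨χ, hχt⟩ := hχ t
  choose F hF hFK hFD using fun k => exists_entire_bounds hR hR₀ hM₀ hχt (by linarith) hf hγ
    (Real.exp_pos (-(1 * t))) k rfl rfl rfl
  obtain ⟨I, hIdef⟩ : ∃ I, I = ∫⁻ z in {z | euclSq z < s ∧ φ z < ((-t : ℝ) : EReal)},
      ‖f z‖ₑ ^ 2 * wexp (-2) φ₀ z := ⟨_, rfl⟩
  rw [← hIdef] at htI
  simp only [← hIdef] at hFK hFD
  have hItop : I ≠ ⊤ := ne_top_of_le_ne_top ENNReal.ofReal_ne_top htI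
  have hDle : 2 * (ENNReal.ofReal (Real.exp (2 * M)) * I) +
      2 * (ENNReal.ofReal (Real.exp (2 * M' + 2 * M₀' + Real.exp (γ * M'))) *
        (ENNReal.ofReal (8 * (C ^ 2 / γ ^ 2 * Real.exp ((γ + 2) * (t + 1)))) * I +
          ENNReal.ofReal (Real.exp (-(1 * t))))) ≤
      ENNReal.ofReal (2 * (a * Real.exp (-(2 * (γ + 1) * t))) +
      2 * (b * (8 * (C ^ 2 / γ ^ 2) * Real.exp ((γ + 2) * (t + 1)) *
        Real.exp (-(2 * (γ + 1) * t)) + Real.exp (-(1 * t))))) := by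
    rw [← ha, ← hb, ← mul_assoc (8 : ℝ), ENNReal.ofReal_add (by positivity) (by positivity),
      ENNReal.ofReal_mul zero_le_two, ENNReal.ofReal_mul ha0, ENNReal.ofReal_mul zero_le_two,
      ENNReal.ofReal_mul hb0, ENNReal.ofReal_add (by positivity) (by positivity),
      ENNReal.ofReal_mul (q := Real.exp (-(2 * (γ + 1) * t))) (by positivity),
      ENNReal.ofReal_ofNat]
    gcongr
  obtain ⟨d, hd, hdε, hdW⟩ := hgerm hR hR₀ hM hM₀ hf
    (ne_top_of_le_ne_top ENNReal.ofReal_ne_top hDle)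
    (by finiteness) hF hFD hFK
  have hcd : Summable fun b => ‖c b - d b‖ * ρ ^ (∑ j, b j) := by
    refine (hc.add hd).of_nonneg_of_le (fun b => by positivity) fun b => ?_
    rw [← add_mul]
    gcongr
    exact norm_sub_le _ _
  refine ⟨fun b => c b - d b, SqIntNear.congr hρ (fun z hz => ?_) hdW, hcd, ?_⟩
  · have hz' := mem_ball_zero_iff.1 hz
    rw [germ, germ, ← (hfc z hz').tsum_eq,
      ← (hfc z hz').summable.tsum_sub (summable_coeff_mul_mono hd hz')]
    simp only [sub_mul]
  · simp only [sub_sub_cancel]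
    refine hdε.trans (le_trans ?_ htε)
    gcongr
    refine (ENNReal.toReal_mono ENNReal.ofReal_ne_top hDle).trans_eq ?_
    exact ENNReal.toReal_ofReal (by positivity)

end Criterion

section LimsupBound

lemma frequently_lt_of_lt_limsup {g : ℝ → ℝ} {c : ℝ} (hc : 0 ≤ c) (h : c < limsup g atTop) :
    ∃ᶠ t in atTop, c < g t := by
  by_contra hcon
  rw [not_frequently] at hcon
  refine h.not_ge ?_
  rw [limsup_eq]
  by_cases hb : BddBelow {a | ∀ᶠ t in atTop, g t ≤ a}
  · exact csInf_le hb (hcon.mono fun t ht => not_lt.1 ht)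
  · rw [Real.sInf_of_not_bddBelow hb]
    exact hc

lemma lt_ofReal_exp_of_lt_neg_log {x : ℝ≥0∞} {y : ℝ} (hy : 0 < y)
    (h : y < -Real.log x.toReal) : x ≤ ENNReal.ofReal (Real.exp (-y)) := by
  have hx : 0 < x.toReal := by
    refine lt_of_le_of_ne ENNReal.toReal_nonneg fun h0 => ?_
    rw [← h0, Real.log_zero] at h
    linarith
  have htop : x ≠ ⊤ := fun h0 => by simp [h0] at hx
  rw [← ENNReal.ofReal_toReal htop]
  refine ENNReal.ofReal_le_ofReal ((Real.log_le_iff_le_exp hx).1 (by linarith))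

lemma exists_euclSq_lt_subset {S : Set (Cn n)} (hS : S ∈ 𝓝 0) :
    ∃ s : ℝ, 0 < s ∧ {z : Cn n | euclSq z < s} ⊆ S := by
  obtain ⟨r, hr, hrS⟩ := Metric.mem_nhds_iff.1 hS
  refine ⟨r ^ 2, by positivity, fun z hz => hrS (mem_ball_zero_iff.2 ?_)⟩
  exact lt_of_pow_lt_pow_left₀ 2 hr.le ((norm_sq_le_euclSq z).trans_lt hz)

lemma isOpen_polydisc (n : ℕ) : IsOpen (polydisc n) := by
  have h : polydisc n = ⋂ j, {z : Cn n | ‖z j‖ < 1} := by ext z; simp [polydisc]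
  rw [h]
  exact isOpen_iInter_of_finite fun j => isOpen_lt (by fun_prop) continuous_const

lemma polydisc_mem_nhds (n : ℕ) : polydisc n ∈ 𝓝 (0 : Cn n) :=
  (isOpen_polydisc n).mem_nhds fun j => by simp

lemma PSHOn.eventually_le {u : Cn n → EReal} (hu : PSHOn u (polydisc n)) :
    ∃ M : ℝ, ∀ᶠ z in 𝓝 (0 : Cn n), u z ≤ M := by
  have h0 := mem_of_mem_nhds (polydisc_mem_nhds n)
  obtain ⟨M, hM, -⟩ := EReal.lt_iff_exists_real_btwn.1 (hu.lt_top 0 h0)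
  have h1 := hu.usc 0 h0 M hM
  rw [nhdsWithin_eq_nhds.2 (polydisc_mem_nhds n)] at h1
  exact ⟨M, h1.mono fun z hz => hz.le⟩

lemma IntNear.finset_sum {ι : Type*} {T : Finset ι} {g : ι → Cn n → ℝ≥0∞}
    {S : Set (Cn n)} (hS : S ∈ 𝓝 0)
    (hm : ∀ i ∈ T, AEMeasurable (g i) (volume.restrict S)) (hg : ∀ i ∈ T, IntNear (g i)) :
    IntNear fun z => ∑ i ∈ T, g i z := by
  choose! U hU hUg using hg
  obtain ⟨O, hO, hOo, h0⟩ := mem_nhds_iff.1 (Filter.inter_mem hS ((biInter_finset_mem T).2 hU))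
  refine ⟨O, hOo.mem_nhds h0, ?_⟩
  rw [lintegral_finsetSum' _ fun i hi =>
    (hm i hi).mono_measure (Measure.restrict_mono (fun z hz => (hO hz).1) le_rfl)]
  refine ENNReal.sum_lt_top.2 fun i hi => (lintegral_mono_set fun z hz => ?_).trans_lt (hUg i hi)
  exact Set.mem_iInter₂.1 (hO hz).2 i hi

end LimsupBound

/-- asymptotic upper bound for `-log ∫_{{φ<-t}∩U} |f₀|²e^{-2φ₀}`. -/
theorem statement10 {n m : ℕ} (f₀ : Fin m → Cn n → ℂ) (φ φ₀ : Cn n → EReal)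
    (hf₀ : ∀ j, DifferentiableOn ℂ (f₀ j) (polydisc n))
    (hφ : PSHOn φ (polydisc n)) (hφ₀ : PSHOn φ₀ (polydisc n))
    (hnonint : ¬ IntNear fun z => normSq2 f₀ z * wexp (-2) (fun w => φ w + φ₀ w) z)
    (hint : IntNear (dens0 f₀ φ₀)) :
    ∀ U ∈ 𝓝 (0 : Cn n), closure U ⊆ polydisc n →
      limsup (fun t : ℝ =>
          (- Real.log
              ((∫⁻ z in {z : Cn n | φ z < ((-t : ℝ) : EReal)} ∩ U, dens0 f₀ φ₀ z).toReal))
            / (2 * t)) atTop ≤ 1 := by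
  intro U hU _
  by_contra! hlim
  obtain ⟨c, hc1, hc⟩ := exists_between hlim
  have hfreq := frequently_lt_of_lt_limsup (by linarith) hc
  obtain ⟨W, hW, hWint⟩ := hint
  obtain ⟨M₁, hM₁⟩ := hφ.eventually_le
  obtain ⟨M₂, hM₂⟩ := hφ₀.eventually_le
  obtain ⟨s, hs, hsub⟩ := exists_euclSq_lt_subset
    (Filter.inter_mem (Filter.inter_mem hU hW) (Filter.inter_mem (polydisc_mem_nhds n)
      (hM₁.and hM₂)))
  have hΩ : {z : Cn n | euclSq z < s} ⊆ polydisc n := fun z hz => (hsub hz).2.1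
  have hM : ∀ z, euclSq z < s → φ z ≤ (max M₁ M₂ : ℝ) := fun z hz =>
    (hsub hz).2.2.1.trans (EReal.coe_le_coe_iff.2 (le_max_left _ _))
  have hM₀ : ∀ z, euclSq z < s → φ₀ z ≤ (max M₁ M₂ : ℝ) := fun z hz =>
    (hsub hz).2.2.2.trans (EReal.coe_le_coe_iff.2 (le_max_right _ _))
  have hle (j : Fin m) (z : Cn n) : ‖f₀ j z‖ₑ ^ 2 * wexp (-2) φ₀ z ≤ dens0 f₀ φ₀ z := by
    refine mul_le_mul_left ?_ _
    exact Finset.single_le_sum (f := fun j => (‖f₀ j z‖₊ : ℝ≥0∞) ^ 2) (fun _ _ => zero_le)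
      (Finset.mem_univ j)
  have hj (j : Fin m) : SqIntNear (ballWeight φ φ₀ s) (f₀ j) := by
    refine sqIntNear_of_frequently_le (γ := c - 1) hφ hφ₀ hs hΩ hM hM₀ ((hf₀ j).mono hΩ) ?_
      (by linarith) ?_
    · exact (((lintegral_mono (hle j)).trans
        (lintegral_mono_set fun z hz => (hsub hz).1.2)).trans_lt hWint).ne
    · refine (hfreq.and_eventually (eventually_gt_atTop 0)).mono fun t ht => ?_
      have ht2 : 0 < 2 * t := by linarith [ht.2]
      have h1 := (lt_div_iff₀ ht2).1 ht.1
      rw [sub_add_cancel, show 2 * c * t = c * (2 * t) by ring]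
      refine ((lintegral_mono (hle j)).trans (lintegral_mono_set fun z hz => ?_)).trans
        (lt_ofReal_exp_of_lt_neg_log (by positivity) h1)
      exact ⟨hz.2, (hsub hz.1).1.1⟩
  have hball := isOpen_euclSq_lt (n := n) s
  have hball0 : {z : Cn n | euclSq z < s} ∈ 𝓝 0 := hball.mem_nhds (by simpa [euclSq] using hs)
  obtain ⟨O, hO, hOint⟩ := IntNear.finset_sum (T := Finset.univ)
    (g := fun j z => ‖f₀ j z‖ₑ ^ 2 * ballWeight φ φ₀ s z) hball0
    (fun j _ => ((((hf₀ j).mono hΩ).continuousOn.aemeasurable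
      hball.measurableSet).enorm.pow_const 2).mul
        (measurable_ballWeight (hφ.usc.mono hΩ) (hφ₀.usc.mono hΩ)).aemeasurable)
    fun j _ => hj j
  obtain ⟨O', hO', hOo, h0⟩ := mem_nhds_iff.1 (Filter.inter_mem hO hball0)
  refine hnonint ⟨O', hOo.mem_nhds h0, lt_of_le_of_lt ?_ hOint⟩
  refine (setLIntegral_mono' hOo.measurableSet fun z hz => le_of_eq ?_).trans
    (lintegral_mono_set fun z hz => (hO' hz).1)
  have hzs : z ∈ {z : Cn n | euclSq z < s} := (hO' hz).2
  rw [wexp_neg_two_add ((hM z hzs).trans_lt (EReal.coe_lt_top _))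
    ((hM₀ z hzs).trans_lt (EReal.coe_lt_top _)), normSq2, Finset.sum_mul]
  simp only [ballWeight, Set.indicator_of_mem hzs]
  rfl
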